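/- Let κ be an uncountable cardinal. The set of algebraic hypergraphs H with χ(H) = κ is decidable: there is a computable function mapping each ((k,n)+ℓ)-ary polynomial p(x_0,…,x_{k-1},y) over ℚ to an L_OF-formula θ(y) in ℓ free variables such that for every c ∈ ℝ^ℓ, the zero k-hypergraph H_c of p(x_0,…,x_{k-1},c) satisfies χ(H_c) = κ if and only if ℝ ⊨ θ(c). -/

import Mathlib

open Cardinal

universe u v

/-- `f` is one-to-one in each coordinate: if `a` and `b` differ in exactly one
coordinate, then `f a ≠ f b`. -/
def OneToOneEachCoord {d : ℕ} {X C : Type*} (f : (Fin d → X) → C) : Prop :=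
  ∀ a b : Fin d → X, (∃ i, a i ≠ b i ∧ ∀ j, j ≠ i → a j = b j) → f a ≠ f b

/-- `Q` is a homomorphic image of the template `P`: there is a surjection of `P`
onto `Q` preserving coordinate equalities. -/
def IsHomImage {d : ℕ} {α β : Type*} (P : Finset (Fin d → α)) (Q : Finset (Fin d → β)) : Prop :=
  ∃ f : (Fin d → α) → (Fin d → β),
    (∀ x ∈ P, f x ∈ Q) ∧ (∀ y ∈ Q, ∃ x ∈ P, f x = y) ∧
    (∀ x ∈ P, ∀ y ∈ P, ∀ i, x i = y i → f x i = f y i)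

/-- The edge set of the template hypergraph `L(X^d, P)`: the edges are the
`k`-element subsets of `X^d` that are homomorphic images of `P`. -/
def LEdges (k : ℕ) {d : ℕ} {α : Type*} (P : Finset (Fin d → α)) (X : Type*) :
    Set (Finset (Fin d → X)) :=
  {Q | Q.card = k ∧ IsHomImage P Q}

/-- Image of a finset (with classical decidable equality). -/
noncomputable def fimg {V W : Type*} (g : V → W) (e : Finset V) : Finset W :=
  @Finset.image _ _ (Classical.decEq W) g e

/-- `g` is an embedding of the hypergraph with edge set `E₁` into the one with
edge set `E₂`: an injection on vertices mapping every edge to an edge. -/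
def IsHGEmbedding {V W : Type*} (E₁ : Set (Finset V)) (E₂ : Set (Finset W)) (g : V → W) : Prop :=
  Function.Injective g ∧ ∀ e ∈ E₁, fimg g e ∈ E₂

def Embeddable {V W : Type*} (E₁ : Set (Finset V)) (E₂ : Set (Finset W)) : Prop :=
  ∃ g, IsHGEmbedding E₁ E₂ g

/-- The hypergraph with edge set `E` has a coloring with at most `κ` colors
that is not constant on any edge. -/
def ProperlyColorable {V : Type u} (E : Set (Finset V)) (κ : Cardinal.{u}) : Prop :=
  ∃ (C : Type u) (φ : V → C), #C ≤ κ ∧ ∀ e ∈ E, ∃ x ∈ e, ∃ y ∈ e, φ x ≠ φ y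

/-- The chromatic number: the least `κ` admitting a proper `κ`-coloring. -/
noncomputable def chromaticNumber {V : Type u} (E : Set (Finset V)) : Cardinal.{u} :=
  sInf {κ | ProperlyColorable E κ}

/-- The edge set of the zero `k`-hypergraph of a `(k,n)`-ary real polynomial:
the `k`-element subsets of `ℝ^n` admitting an enumeration on which `p` vanishes. -/
def zeroEdges (k n : ℕ) (p : MvPolynomial (Fin k × Fin n) ℝ) : Set (Finset (Fin n → ℝ)) :=
  {s | ∃ a : Fin k → (Fin n → ℝ), Function.Injective a ∧
        fimg a Finset.univ = s ∧ MvPolynomial.eval (fun v => a v.1 v.2) p = 0}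

/-- Terms of the first-order language of ordered fields `{+,-,×,0,1,≤}`,
with variables indexed by `ℕ`. -/
inductive OFTerm : Type
  | var : ℕ → OFTerm
  | zero : OFTerm
  | one : OFTerm
  | add : OFTerm → OFTerm → OFTerm
  | mul : OFTerm → OFTerm → OFTerm
  | neg : OFTerm → OFTerm

/-- First-order formulas of the language of ordered fields (with equality;
`≠`, `∨`, `→`, `∀`, `<` etc. are expressible from `=`, `≤`, `¬`, `∧`, `∃`). -/
inductive OFFml : Type
  | eq : OFTerm → OFTerm → OFFml
  | le : OFTerm → OFTerm → OFFml
  | not : OFFml → OFFml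
  | and : OFFml → OFFml → OFFml
  | ex : ℕ → OFFml → OFFml

def OFTerm.eval (v : ℕ → ℝ) : OFTerm → ℝ
  | var i => v i
  | zero => 0
  | one => 1
  | add s t => s.eval v + t.eval v
  | mul s t => s.eval v * t.eval v
  | neg t => - t.eval v

/-- Realization (satisfaction) of a formula in the ordered field `ℝ`
under the valuation `v`. -/
def OFFml.Realize (v : ℕ → ℝ) : OFFml → Prop
  | eq s t => s.eval v = t.eval v
  | le s t => s.eval v ≤ t.eval v
  | not φ => ¬ φ.Realize v
  | and φ ψ => φ.Realize v ∧ ψ.Realize v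
  | ex i φ => ∃ r : ℝ, φ.Realize (Function.update v i r)

def OFTerm.fv : OFTerm → Finset ℕ
  | var i => {i}
  | zero => ∅
  | one => ∅
  | add s t => s.fv ∪ t.fv
  | mul s t => s.fv ∪ t.fv
  | neg t => t.fv

/-- The free variables of a formula. -/
def OFFml.fv : OFFml → Finset ℕ
  | eq s t => s.fv ∪ t.fv
  | le s t => s.fv ∪ t.fv
  | not φ => φ.fv
  | and φ ψ => φ.fv ∪ ψ.fv
  | ex i φ => φ.fv.erase i

/-- A natural injective numerical encoding of terms, via the pairing function. -/
def OFTerm.code : OFTerm → ℕ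
  | var i => Nat.pair 0 i
  | zero => Nat.pair 1 0
  | one => Nat.pair 2 0
  | add s t => Nat.pair 3 (Nat.pair s.code t.code)
  | mul s t => Nat.pair 4 (Nat.pair s.code t.code)
  | neg t => Nat.pair 5 t.code

/-- A natural injective numerical encoding of formulas, via the pairing function. -/
def OFFml.code : OFFml → ℕ
  | eq s t => Nat.pair 0 (Nat.pair s.code t.code)
  | le s t => Nat.pair 1 (Nat.pair s.code t.code)
  | not φ => Nat.pair 2 φ.code
  | and φ ψ => Nat.pair 3 (Nat.pair φ.code ψ.code)
  | ex i φ => Nat.pair 4 (Nat.pair i φ.code)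

/-- The edge set of the zero `k`-hypergraph `H_c` of `p(x₀,…,x_{k-1}, c)`, where `p`
is a `((k,n)+ℓ)`-ary polynomial over `ℚ` and `c ∈ ℝ^ℓ`. -/
def zeroEdgesParam (k n ℓ : ℕ) (p : MvPolynomial ((Fin k × Fin n) ⊕ Fin ℓ) ℚ)
    (c : Fin ℓ → ℝ) : Set (Finset (Fin n → ℝ)) :=
  {s | ∃ a : Fin k → (Fin n → ℝ), Function.Injective a ∧ fimg a Finset.univ = s ∧
        MvPolynomial.aeval (Sum.elim (fun v : Fin k × Fin n => a v.1 v.2) c) p = (0 : ℝ)}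

/-- Codes for polynomials over `ℚ`: a list of monomials, each given by a rational
coefficient together with a list of exponents. -/
abbrev PolyCode : Type := List (ℚ × List ℕ)

/-- Decoding a code into a `((k,n)+ℓ)`-ary polynomial over `ℚ`: the variable `x_{i,j}`
gets the exponent stored at position `i * n + j`, and the parameter variable `y_j` the
one stored at position `k * n + j`.  Every `((k,n)+ℓ)`-ary polynomial over `ℚ` is
`decodePolyP k n ℓ c` for some code `c`, so this is a natural computable encoding. -/
noncomputable def decodePolyP (k n ℓ : ℕ) (c : PolyCode) :
    MvPolynomial ((Fin k × Fin n) ⊕ Fin ℓ) ℚ :=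
  (c.map fun e =>
    (MvPolynomial.C e.1 : MvPolynomial ((Fin k × Fin n) ⊕ Fin ℓ) ℚ) *
      ∏ v : (Fin k × Fin n) ⊕ Fin ℓ,
        MvPolynomial.X v ^
          (e.2.getD (Sum.elim (fun w => w.1.1 * n + w.2.1) (fun j => k * n + j.1) v) 0)).sum

/-- Finite colourings of a sufficiently large finite grid are constant on a subgrid. -/
theorem exists_grid_pigeonhole (e K : ℕ) (P : Type) [Finite P] :
    ∃ K' : ℕ, K ≤ K' ∧ ∀ χ : (Fin e → Fin K') → P, ∃ ι : Fin e → Fin K → Fin K',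
      (∀ j, Function.Injective (ι j)) ∧ ∃ c, ∀ a : Fin e → Fin K, χ (fun j => ι j (a j)) = c := by
  classical
  induction e with
  | zero =>
    refine ⟨K, le_rfl, fun χ => ⟨fun j => j.elim0, fun j => j.elim0, χ Fin.elim0, fun a => ?_⟩⟩
    congr 1
    exact Subsingleton.elim _ _
  | succ e ih =>
    obtain ⟨K1, hK1, h1⟩ := ih
    have := Fintype.ofFinite P
    set L := Fintype.card ((Fin e → Fin K1) → P) with hL
    obtain ⟨K', hle, hLK⟩ : ∃ K', K1 ≤ K' ∧ L * K < K' :=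
      ⟨max K1 (L * K + 1), le_max_left _ _,
        lt_of_lt_of_le (Nat.lt_succ_self _) (le_max_right _ _)⟩
    refine ⟨K', le_trans hK1 hle, fun χ => ?_⟩
    let F : Fin K' → ((Fin e → Fin K1) → P) := fun y a =>
      χ (Fin.snoc (α := fun _ => Fin K') (fun j => Fin.castLE hle (a j)) y)
    have hcard : Fintype.card ((Fin e → Fin K1) → P) * K < Fintype.card (Fin K') := by
      rwa [Fintype.card_fin, ← hL]
    obtain ⟨y, hy⟩ := Fintype.exists_lt_card_fiber_of_mul_lt_card F hcard
    obtain ⟨ι, hι, c, hc⟩ := h1 y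
    obtain ⟨s, hs, hsK⟩ := Finset.exists_subset_card_eq hy.le
    let emb : Fin K → Fin K' := s.orderEmbOfFin hsK
    have hemb : ∀ i, F (emb i) = y := fun i => by
      have := hs (s.orderEmbOfFin_mem hsK i)
      simpa using this
    refine ⟨Fin.snoc (α := fun _ => Fin K → Fin K') (fun j v => Fin.castLE hle (ι j v)) emb, ?_, c,
      fun a => ?_⟩
    · intro j
      refine Fin.lastCases ?_ (fun j => ?_) j
      · simpa using (s.orderEmbOfFin hsK).injective
      · simp only [Fin.snoc_castSucc]
        exact (Fin.castLE_injective hle).comp (hι j)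
    · have := congrFun (hemb (a (Fin.last e))) (fun j => ι j (a j.castSucc))
      rw [hc (fun j => a j.castSucc)] at this
      rw [← this]
      simp only [F]
      congr 1
      funext j
      refine Fin.lastCases ?_ (fun j => ?_) j <;> simp

/-- A finite family of sequences can be thinned so that each one is constant or takes values
distinct from all other values of the family at different times. -/
theorem exists_thinning {A T : Type*} [Finite A] (s : ℕ → A → T) :
    ∃ (φ : ℕ → ℕ) (Cst : Set A), Function.Injective φ ∧
      (∀ p ∈ Cst, ∀ m m', s (φ m) p = s (φ m') p) ∧
      (∀ p ∉ Cst, ∀ p' m m', m ≠ m' → s (φ m) p ≠ s (φ m') p') := by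
  classical
  let U := Filter.hyperfilter ℕ
  let Cst : Set A := {p | ∃ v, ∀ᶠ m in (U : Filter ℕ), s m p = v}
  have hN : ∀ p ∉ Cst, ∀ v, ∀ᶠ m in (U : Filter ℕ), s m p ≠ v := by
    intro p hp v
    rw [Ultrafilter.eventually_not]
    exact fun h => hp ⟨v, h⟩
  have hC : ∀ p : A, ∃ v, p ∈ Cst → ∀ᶠ m in (U : Filter ℕ), s m p = v := by
    intro p
    by_cases hp : p ∈ Cst
    · obtain ⟨v, hv⟩ := hp; exact ⟨v, fun _ => hv⟩
    · exact ⟨s 0 p, fun h => absurd h hp⟩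
  choose v hv using hC
  let P : ℕ → Prop := fun m => (∀ p ∈ Cst, s m p = v p) ∧ ∀ p ∉ Cst, ∀ p' ∈ Cst, s m p ≠ v p'
  let r : ℕ → ℕ → Prop := fun m m' => m ≠ m' ∧ ∀ p ∉ Cst, ∀ p', s m' p ≠ s m p'
  have hP : ∀ᶠ m in (U : Filter ℕ), P m := by
    refine Filter.Eventually.and ?_ ?_
    · rw [Filter.eventually_all]; intro p
      by_cases hp : p ∈ Cst
      · exact (hv p hp).mono fun m hm _ => hm
      · exact Filter.Eventually.of_forall fun m h => absurd h hp
    · rw [Filter.eventually_all]; intro p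
      by_cases hp : p ∈ Cst
      · exact Filter.Eventually.of_forall fun m h => absurd hp h
      · have : ∀ p' : A, ∀ᶠ m in (U : Filter ℕ), s m p ≠ v p' := fun p' => hN p hp _
        exact (Filter.eventually_all.2 this).mono fun m hm _ p' _ => hm p'
  obtain ⟨φ, hφP, hφr⟩ := exists_seq_of_forall_finset_exists P r (by
    intro F _
    have : ∀ᶠ m in (U : Filter ℕ), P m ∧ ∀ x ∈ F, r x m := by
      refine hP.and ?_
      rw [Filter.eventually_all_finset]
      intro x _
      refine Filter.Eventually.and ?_ ?_
      · have : ∀ᶠ m in (U : Filter ℕ), m ≠ x := by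
          apply Filter.hyperfilter_le_cofinite
          simp
        exact this.mono fun m hm => hm.symm
      · rw [Filter.eventually_all]; intro p
        by_cases hp : p ∈ Cst
        · exact Filter.Eventually.of_forall fun m h => absurd hp h
        · have : ∀ p' : A, ∀ᶠ m in (U : Filter ℕ), s m p ≠ s x p' := fun p' => hN p hp _
          exact (Filter.eventually_all.2 this).mono fun m hm _ p' => hm p'
    obtain ⟨y, hy⟩ := this.exists
    exact ⟨y, hy.1, hy.2⟩)
  refine ⟨φ, Cst, ?_, ?_, ?_⟩
  · intro m m' h
    by_contra hne
    rcases lt_or_gt_of_ne hne with h1 | h1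
    · exact (hφr _ _ h1).1 h
    · exact (hφr _ _ h1).1 h.symm
  · intro p hp m m'
    rw [(hφP m).1 p hp, (hφP m').1 p hp]
  · intro p hp p' m m' hne
    by_cases hp' : p' ∈ Cst
    · rw [(hφP m').1 p' hp']
      exact (hφP m).2 p hp p' hp'
    · rcases lt_or_gt_of_ne hne with h1 | h1
      · exact fun h => (hφr _ _ h1).2 p' hp' p h.symm
      · exact (hφr _ _ h1).2 p hp p'

theorem aleph0_le_succ_iterate {κ : Cardinal.{u}} (hκ : ℵ₀ ≤ κ) (m : ℕ) :
    ℵ₀ ≤ Order.succ^[m] κ :=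
  hκ.trans (Order.le_succ_iterate m κ)

/-- The canonical grid lemma: a colouring of a product of sets of increasing cardinalities,
together with finitely many labels for each point, is canonical on a finite subgrid
whose size may depend on the colour. -/
theorem exists_canonical_grid {κ : Cardinal.{0}} (hκ : ℵ₀ ≤ κ) {Ω C T : Type} (hC : #C ≤ κ)
    (r : C → ℕ) (e : ℕ) (K : C → ℕ) (X : Fin e → Set Ω)
    (hX : ∀ j : Fin e, #(X j) = Order.succ^[j.1 + 1] κ) (col : (Fin e → Ω) → C)
    (τ : (Fin e → Ω) → ℕ → T)
    (hτ : ∀ x, (∀ j, x j ∈ X j) → ∀ i < r (col x), ∀ i' < r (col x), τ x i = τ x i' → i = i') :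
    ∃ (c : C) (α : Fin e → Fin (K c) → Ω) (J : ℕ → Finset (Fin e)),
      (∀ j, Function.Injective (α j)) ∧ (∀ j w, α j w ∈ X j) ∧
      (∀ a : Fin e → Fin (K c), col (fun j => α j (a j)) = c) ∧
      ∀ i < r c, ∀ i' < r c, ∀ a a' : Fin e → Fin (K c),
        τ (fun j => α j (a j)) i = τ (fun j => α j (a' j)) i' ↔
          i = i' ∧ ∀ j ∈ J i, a j = a' j := by
  classical
  induction e generalizing K with
  | zero =>
    refine ⟨col Fin.elim0, fun j => j.elim0, fun _ => ∅, fun j => j.elim0, fun j => j.elim0,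
      fun a => congrArg col (Subsingleton.elim _ _), fun i hi i' hi' a a' => ?_⟩
    have h0 : ∀ b : Fin 0 → Fin (K (col Fin.elim0)),
      (fun j => (fun j : Fin 0 => (j.elim0 : Fin (K (col Fin.elim0)) → Ω)) j (b j)) = Fin.elim0 :=
      fun b => Subsingleton.elim _ _
    rw [h0, h0]
    constructor
    · intro h
      exact ⟨hτ _ (fun j => j.elim0) i hi i' hi' h, fun j => j.elim0⟩
    · rintro ⟨rfl, _⟩; rfl
  | succ e ih =>
    have hFG : ∀ c : C, ∃ K' : ℕ, K c ≤ K' ∧ ∀ χ : (Fin e → Fin K') → (Fin (r c) → Bool),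
        ∃ ι : Fin e → Fin (K c) → Fin K', (∀ j, Function.Injective (ι j)) ∧
        ∃ t, ∀ a : Fin e → Fin (K c), χ (fun j => ι j (a j)) = t :=
      fun c => exists_grid_pigeonhole e (K c) _
    choose K' hKK' hK' using hFG
    let X' : Fin e → Set Ω := fun j => X j.castSucc
    let Xl : Set Ω := X (Fin.last e)
    have hsn : ∀ (x : Fin e → Ω) (y : Ω), (∀ j, x j ∈ X' j) → y ∈ Xl →
        ∀ j, (Fin.snoc x y : Fin (e + 1) → Ω) j ∈ X j := by
      intro x y hx hy j
      refine Fin.lastCases ?_ (fun j => ?_) j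
      · simpa using hy
      · simpa using hx j
    have key : ∀ y : Xl, ∃ (c : C) (α : Fin e → Fin (K' c) → Ω) (J : ℕ → Finset (Fin e)),
      (∀ j, Function.Injective (α j)) ∧ (∀ j w, α j w ∈ X' j) ∧
      (∀ a : Fin e → Fin (K' c), col (Fin.snoc (fun j => α j (a j)) y.1) = c) ∧
      ∀ i < r c, ∀ i' < r c, ∀ a a' : Fin e → Fin (K' c),
        τ (Fin.snoc (fun j => α j (a j)) y.1) i = τ (Fin.snoc (fun j => α j (a' j)) y.1) i' ↔
          i = i' ∧ ∀ j ∈ J i, a j = a' j := fun y =>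
      ih K' X' (fun j => hX j.castSucc) (fun x => col (Fin.snoc x y.1))
        (fun x => τ (Fin.snoc x y.1)) (fun x hx => hτ _ (hsn x y.1 hx y.2))
    choose c α J hα hαX hcol hτJ using key
    -- pigeonhole on the data
    let Z : Set Ω := ⋃ j, X' j
    have hs : ℵ₀ ≤ Order.succ^[e] κ := aleph0_le_succ_iterate hκ e
    have hZ : #Z ≤ Order.succ^[e] κ := by
      refine (Cardinal.mk_iUnion_le_sum_mk).trans ?_
      refine (Cardinal.sum_le_mk_mul_iSup _).trans ?_
      refine Cardinal.mul_le_of_le hs ?_ ?_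
      · exact (Cardinal.mk_lt_aleph0.le).trans hs
      · refine ciSup_le' fun j => ?_
        rw [show #(X' j) = Order.succ^[j.1 + 1] κ from hX j.castSucc]
        exact Monotone.monotone_iterate_of_le_map Order.succ_mono (Order.le_succ κ) j.2
    let D := Σ c : C, (Fin e → Fin (K' c) → Z) × (Fin (r c) → Finset (Fin e))
    have hD : #D ≤ Order.succ^[e] κ := by
      rw [Cardinal.mk_sigma]
      refine (Cardinal.sum_le_mk_mul_iSup _).trans ?_
      refine Cardinal.mul_le_of_le hs (hC.trans (Order.le_succ_iterate e κ)) ?_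
      refine ciSup_le' fun c => ?_
      rw [Cardinal.mk_prod, Cardinal.lift_id, Cardinal.lift_id]
      refine Cardinal.mul_le_of_le hs ?_ ((Cardinal.mk_lt_aleph0.le).trans hs)
      have h1 : #(Fin (K' c) → Z) ≤ Order.succ^[e] κ := by
        rw [Cardinal.mk_arrow, Cardinal.lift_id, Cardinal.lift_id, Cardinal.mk_fin]
        exact (Cardinal.power_le_power_right hZ).trans (Cardinal.power_nat_le hs)
      rw [Cardinal.mk_arrow, Cardinal.lift_id, Cardinal.lift_id, Cardinal.mk_fin]
      exact (Cardinal.power_le_power_right h1).trans (Cardinal.power_nat_le hs)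
    let F : Xl → D := fun y => ⟨c y, fun j w => ⟨α y j w, Set.mem_iUnion.2 ⟨j, hαX y j w⟩⟩,
      fun i => J y i⟩
    have hXl : #D < #Xl := by
      have : #Xl = Order.succ^[e + 1] κ := hX (Fin.last e)
      rw [this, Function.iterate_succ_apply']
      exact Order.lt_succ_of_le hD
    have : Infinite Xl := by
      rw [Cardinal.infinite_iff, show #Xl = Order.succ^[e + 1] κ from hX (Fin.last e)]
      exact aleph0_le_succ_iterate hκ _
    obtain ⟨⟨c0, α0, J0⟩, hinf⟩ := Cardinal.exists_infinite_fiber F hXl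
    let y : ℕ → Xl := fun m => ((Infinite.natEmbedding (F ⁻¹' {⟨c0, α0, J0⟩})) m).1
    have hyinj : Function.Injective y := fun m m' h =>
      (Infinite.natEmbedding _).injective (Subtype.ext h)
    have hyF : ∀ m, F (y m) = ⟨c0, α0, J0⟩ := fun m =>
      ((Infinite.natEmbedding (F ⁻¹' {⟨c0, α0, J0⟩})) m).2
    -- uniform description on the fiber
    have hdesc : ∀ m, (∀ j, Function.Injective (α0 j)) ∧ (∀ j w, (α0 j w).1 ∈ X' j) ∧
      (∀ a : Fin e → Fin (K' c0), col (Fin.snoc (fun j => (α0 j (a j)).1) (y m).1) = c0) ∧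
      ∀ i i' : Fin (r c0), ∀ a a' : Fin e → Fin (K' c0),
        τ (Fin.snoc (fun j => (α0 j (a j)).1) (y m).1) i =
          τ (Fin.snoc (fun j => (α0 j (a' j)).1) (y m).1) i' ↔
          i = i' ∧ ∀ j ∈ J0 i, a j = a' j := by
      intro m
      have h := hyF m
      have hd : ∀ d : D, F (y m) = d → (∀ j, Function.Injective (d.2.1 j)) ∧
        (∀ j w, (d.2.1 j w).1 ∈ X' j) ∧
        (∀ a : Fin e → Fin (K' d.1), col (Fin.snoc (fun j => (d.2.1 j (a j)).1) (y m).1) = d.1) ∧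
        ∀ i i' : Fin (r d.1), ∀ a a' : Fin e → Fin (K' d.1),
          τ (Fin.snoc (fun j => (d.2.1 j (a j)).1) (y m).1) i =
            τ (Fin.snoc (fun j => (d.2.1 j (a' j)).1) (y m).1) i' ↔
            i = i' ∧ ∀ j ∈ d.2.2 i, a j = a' j := by
        rintro d rfl
        refine ⟨fun j w w' h => hα (y m) j (congrArg Subtype.val h), hαX (y m), hcol (y m), ?_⟩
        intro i i' a a'
        rw [Fin.ext_iff]
        exact hτJ (y m) i i.2 i' i'.2 a a'
      exact hd _ h
    let A := Fin (r c0) × (Fin e → Fin (K' c0))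
    obtain ⟨φ, Cst, hφ, hcst, hncst⟩ := exists_thinning (A := A)
      (fun m p => τ (Fin.snoc (fun j => (α0 j (p.2 j)).1) (y m).1) p.1)
    obtain ⟨ι, hι, t, ht⟩ := hK' c0 (fun a i => decide ((i, a) ∈ Cst))
    let J1 : ℕ → Finset (Fin (e + 1)) := fun i =>
      if h : i < r c0 then
        (if t ⟨i, h⟩ then (J0 ⟨i, h⟩).map Fin.castSuccEmb
          else insert (Fin.last e) ((J0 ⟨i, h⟩).map Fin.castSuccEmb))
      else ∅
    let α1 : Fin (e + 1) → Fin (K c0) → Ω := Fin.snoc (α := fun _ => Fin (K c0) → Ω)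
      (fun j w => (α0 j (ι j w)).1) (fun w => (y (φ w)).1)
    have hα1 : ∀ a : Fin (e + 1) → Fin (K c0), (fun j => α1 j (a j)) =
        Fin.snoc (α := fun _ => Ω) (fun j => (α0 j (ι j (a j.castSucc))).1)
          (y (φ (a (Fin.last e)))).1 := by
      intro a
      funext j
      refine Fin.lastCases ?_ (fun j => ?_) j <;> simp [α1]
    refine ⟨c0, α1, J1, ?_, ?_, ?_, ?_⟩
    · intro j
      refine Fin.lastCases ?_ (fun j => ?_) j
      · simp only [α1, Fin.snoc_last]
        intro w w' h
        exact Fin.ext (hφ (hyinj (Subtype.ext h)))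
      · simp only [α1, Fin.snoc_castSucc]
        intro w w' h
        exact hι j ((hdesc 0).1 j (Subtype.ext h))
    · intro j
      refine Fin.lastCases ?_ (fun j => ?_) j
      · simp only [α1, Fin.snoc_last]
        intro w
        exact (y (φ w)).2
      · simp only [α1, Fin.snoc_castSucc]
        intro w
        exact (hdesc 0).2.1 j _
    · intro a
      rw [hα1]
      exact (hdesc _).2.2.1 (fun j => ι j (a j.castSucc))
    · intro i hi i' hi' a a'
      rw [hα1, hα1]
      set b : Fin e → Fin (K' c0) := fun j => ι j (a j.castSucc) with hb
      set b' : Fin e → Fin (K' c0) := fun j => ι j (a' j.castSucc) with hb'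
      have hmem : ∀ (i : Fin (r c0)), t i = true ↔ (i, b) ∈ Cst := by
        intro i
        rw [← congrFun (ht (fun j => a j.castSucc)) i]
        simp [hb]
      have hJ : (∀ j ∈ J1 i, a j = a' j) ↔
          (∀ j ∈ J0 ⟨i, hi⟩, b j = b' j) ∧
            (t ⟨i, hi⟩ = false → a (Fin.last e) = a' (Fin.last e)) := by
        have h0 : (∀ j ∈ J0 ⟨i, hi⟩, b j = b' j) ↔
            ∀ j ∈ J0 ⟨i, hi⟩, a j.castSucc = a' j.castSucc := by
          refine forall₂_congr fun j _ => ?_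
          exact (hι j).eq_iff
        rw [h0]
        simp only [J1, hi, dif_pos]
        cases htt : t ⟨i, hi⟩
        · simp [and_comm]
        · simp
      rw [hJ]
      by_cases hm : a (Fin.last e) = a' (Fin.last e)
      · rw [← hm]
        have := (hdesc (φ (a (Fin.last e)))).2.2.2 ⟨i, hi⟩ ⟨i', hi'⟩ b b'
        simp only [Fin.mk.injEq] at this
        rw [this]
        simp
      · have hm' : (a (Fin.last e) : ℕ) ≠ a' (Fin.last e) := fun h => hm (Fin.ext h)
        cases htt : t ⟨i, hi⟩
        · have h1 : ((⟨i, hi⟩, b) : A) ∉ Cst := fun h => by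
            rw [← hmem, htt] at h; exact absurd h (by simp)
          have h2 := hncst _ h1 (⟨i', hi'⟩, b') _ _ hm'
          simp only at h2
          constructor
          · intro h; exact absurd h h2
          · rintro ⟨_, _, h⟩; exact absurd (h rfl) hm
        · have h1 : ((⟨i, hi⟩, b) : A) ∈ Cst := (hmem _).1 htt
          have h2 := hcst _ h1 (a (Fin.last e)) (a' (Fin.last e))
          simp only at h2
          rw [h2]
          have := (hdesc (φ (a' (Fin.last e)))).2.2.2 ⟨i, hi⟩ ⟨i', hi'⟩ b b'
          simp only [Fin.mk.injEq] at this
          rw [this]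
          simp

/-- A set of cardinality at most `κ^{+m}` has a colouring of its `r`-tuples by `κ` colours such
that tuples of a given colour are determined by at most `m` of their coordinates. -/
theorem exists_separating_coloring {κ : Cardinal.{0}} (hκ : ℵ₀ ≤ κ) (m : ℕ) (T : Type)
    (hT : #T ≤ Order.succ^[m] κ) (r : ℕ) :
    ∃ (C : Type) (g : (Fin r → T) → C), #C ≤ κ ∧ ∀ c, ∃ I : Finset (Fin r), I.card ≤ m ∧
      ∀ t t', g t = c → g t' = c → (∀ i ∈ I, t i = t' i) → t = t' := by
  classical
  induction m generalizing T with
  | zero =>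
    refine ⟨Fin r → T, id, ?_, fun c => ⟨∅, by simp, fun t t' h h' _ => h.trans h'.symm⟩⟩
    rw [Cardinal.mk_arrow, Cardinal.lift_id, Cardinal.lift_id, Cardinal.mk_fin]
    exact (Cardinal.power_le_power_right hT).trans (Cardinal.power_nat_le hκ)
  | succ m ih =>
    rcases Nat.eq_zero_or_pos r with rfl | hr
    · exact ⟨PUnit, fun _ => ⟨⟩, by simpa using (Cardinal.one_lt_aleph0.le.trans hκ),
        fun c => ⟨∅, by simp, fun t t' _ _ _ => Subsingleton.elim _ _⟩⟩
    set μ := Order.succ^[m] κ with hμ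
    rw [Function.iterate_succ_apply', ← hμ] at hT
    let W := (Order.succ μ).ord.ToType
    have hW : #W = Order.succ μ := by simp [W]
    obtain ⟨emb⟩ : Nonempty (T ↪ W) := by
      rw [← Cardinal.le_def, hW]; exact hT
    have hsmall : ∀ w : W, #(Set.Iic w) ≤ μ := by
      intro w
      have h1 : #(Set.Iio w) ≤ μ := Order.lt_succ_iff.1 
        ((Cardinal.mk_Iio_lt w (by simp [W])).trans_eq hW)
      have : Set.Iic w = insert w (Set.Iio w) := by
        ext x; simp [le_iff_eq_or_lt]
      rw [this]
      refine (Cardinal.mk_insert_le).trans ?_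
      exact Cardinal.add_le_of_le (aleph0_le_succ_iterate hκ m) h1
        (Cardinal.one_lt_aleph0.le.trans (aleph0_le_succ_iterate hκ m))
    let T' : Type := μ.out
    have hT' : #T' = μ := Cardinal.mk_out μ
    have hh : ∀ w : W, ∃ h : W → T', Set.InjOn h (Set.Iic w) := by
      intro w
      obtain ⟨f⟩ : Nonempty (Set.Iic w ↪ T') := by
        rw [← Cardinal.le_def, hT']; exact hsmall w
      refine ⟨fun x => if hx : x ∈ Set.Iic w then f ⟨x, hx⟩ else f ⟨w, Set.mem_Iic.2 le_rfl⟩, ?_⟩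
      intro x hx y hy hxy
      simp only [dif_pos hx, dif_pos hy] at hxy
      exact congrArg Subtype.val (f.injective hxy)
    choose h hinj using hh
    obtain ⟨C', g', hC', hg'⟩ := ih T' hT'.le
    have hmax : ∀ t : Fin r → T, ∃ i, ∀ i', emb (t i') ≤ emb (t i) := by
      intro t
      have : Nonempty (Fin r) := ⟨⟨0, hr⟩⟩
      obtain ⟨i, -, hi⟩ := Finset.exists_max_image Finset.univ (fun i => emb (t i))
        Finset.univ_nonempty
      exact ⟨i, fun i' => hi i' (Finset.mem_univ _)⟩
    choose i0 hi0 using hmax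
    refine ⟨Fin r × C', fun t => (i0 t, g' fun i => h (emb (t (i0 t))) (emb (t i))), ?_, ?_⟩
    · rw [Cardinal.mk_prod, Cardinal.lift_id, Cardinal.lift_id]
      exact Cardinal.mul_le_of_le hκ (Cardinal.mk_lt_aleph0.le.trans hκ) hC'
    · rintro ⟨i, c⟩
      obtain ⟨I, hI, hIs⟩ := hg' c
      refine ⟨insert i I, (Finset.card_insert_le _ _).trans (by omega), ?_⟩
      intro t t' ht ht' hagree
      simp only [Prod.mk.injEq] at ht ht'
      obtain ⟨hi, hc⟩ := ht
      obtain ⟨hi', hc'⟩ := ht'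
      have hit : t i = t' i := hagree i (Finset.mem_insert_self _ _)
      rw [hi] at hc; rw [hi', ← hit] at hc'
      have := hIs _ _ hc hc' (fun l hl => by rw [hagree l (Finset.mem_insert_of_mem hl)])
      funext l
      have hl := congrFun this l
      refine emb.injective (hinj (emb (t i)) ?_ ?_ hl)
      · have := hi0 t l; rw [hi] at this; exact this
      · have := hi0 t' l; rw [hi', ← hit] at this; exact this

/-- The relation `Z` contains a copy of a pattern in `e` directions, each running through
continuum many values. -/
def GoodArr {k : ℕ} {V : Type} (Z : (Fin k → V) → Prop) (e : ℕ) : Prop :=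
  ∃ e' ≤ e, ∃ (P : Fin k → Fin e' → ℕ) (B : Fin e' → Set ℝ) (f : (Fin e' → ℝ) → V),
    Function.Injective P ∧ (∀ i, #(B i) = 𝔠) ∧
    (∀ a b : Fin e' → ℝ, (∀ i, a i ∈ B i) → (∀ i, b i ∈ B i) →
      ∀ i, a i ≠ b i → (∀ j, j ≠ i → a j = b j) → f a ≠ f b) ∧
    ∀ y : Fin e' → ℕ → ℝ, (∀ i w, y i w ∈ B i) → Z fun j => f fun i => y i (P j i)

theorem GoodArr.mono {k : ℕ} {V : Type} {Z : (Fin k → V) → Prop} {e e₁ : ℕ} (h : e ≤ e₁)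
    (hG : GoodArr Z e) : GoodArr Z e₁ := by
  obtain ⟨e', he', h'⟩ := hG
  exact ⟨e', he'.trans h, h'⟩

/-- The relation `Z` contains a copy of the pattern `P` on the finite grid `q^e`. -/
def HasGrid {k e : ℕ} {V : Type*} (Z : (Fin k → V) → Prop) (P : Fin k → Fin e → Fin k)
    (q : ℕ) : Prop :=
  ∃ x : (Fin e → Fin q) → V, Function.Injective x ∧
    ∀ β : Fin e → Fin k → Fin q, Z fun j => x fun d => β d (P j d)

theorem HasGrid.mono {k e : ℕ} {V : Type*} {Z : (Fin k → V) → Prop}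
    {P : Fin k → Fin e → Fin k} {q q' : ℕ} (h : q ≤ q') (hq : HasGrid Z P q') :
    HasGrid Z P q := by
  obtain ⟨x, hx, hZ⟩ := hq
  refine ⟨fun a => x fun d => Fin.castLE h (a d), fun a b hab => ?_,
    fun β => hZ fun d w => Fin.castLE h (β d w)⟩
  funext d
  exact Fin.castLE_injective h (congrFun (hx hab) d)

/-- A pattern restricted to a canonical subgrid: an injective grid of a given colour class. -/
theorem exists_injective_grid {V : Type} {e' : ℕ}
    {B : Fin e' → Set ℝ} {f : (Fin e' → ℝ) → V}
    (hB : ∀ i, #(B i) = 𝔠)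
    (hf : ∀ a b : Fin e' → ℝ, (∀ i, a i ∈ B i) → (∀ i, b i ∈ B i) →
      ∀ i, a i ≠ b i → (∀ j, j ≠ i → a j = b j) → f a ≠ f b)
    {κ : Cardinal.{0}} (hκ : ℵ₀ ≤ κ) (hle : Order.succ^[e'] κ ≤ 𝔠) {C : Type} (hC : #C ≤ κ)
    (φ : V → C) (K : ℕ) (hK : 2 ≤ K) :
    ∃ (α : Fin e' → Fin K → ℝ) (c : C), (∀ i w, α i w ∈ B i) ∧
      (∀ a : Fin e' → Fin K, φ (f fun i => α i (a i)) = c) ∧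
      Function.Injective fun a : Fin e' → Fin K => f fun i => α i (a i) := by
  have hsub : ∀ j : Fin e', ∃ X ⊆ B j, #X = Order.succ^[j.1 + 1] κ := by
    intro j
    rw [← Cardinal.le_mk_iff_exists_subset, hB]
    exact le_trans (Monotone.monotone_iterate_of_le_map Order.succ_mono (Order.le_succ κ) j.2) hle
  choose X hXB hX using hsub
  obtain ⟨c, α, J, hα, hαX, hcol, hJ⟩ := exists_canonical_grid hκ hC (fun _ => 1) e' (fun _ => K)
    X hX (fun x => φ (f x)) (fun x _ => f x) (fun x _ i hi i' hi' _ => by omega)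
  refine ⟨α, c, fun i w => hXB i (hαX i w), hcol, ?_⟩
  have hall : ∀ d, d ∈ J 0 := by
    intro d
    by_contra hd
    let a : Fin e' → Fin K := fun _ => ⟨0, by omega⟩
    let b : Fin e' → Fin K := Function.update a d ⟨1, by omega⟩
    have h1 := (hJ 0 (by simp) 0 (by simp) a b).2 ⟨rfl, fun j hj => by
      have : j ≠ d := fun h => hd (h ▸ hj)
      simp [b, this]⟩
    refine hf _ _ (fun i => hXB _ (hαX i _)) (fun i => hXB _ (hαX i _)) d ?_ ?_ h1
    · intro h
      have := hα d h
      simp [a, b] at this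
    · intro j hj
      simp [b, hj]
  intro a b hab
  funext d
  exact ((hJ 0 (by simp) 0 (by simp) a b).1 hab).2 d (hall d)

/-- The enumerated edges of a `k`-ary relation. -/
def relEdges {k : ℕ} {V : Type} (Z : (Fin k → V) → Prop) : Set (Finset V) :=
  {s | ∃ a : Fin k → V, Function.Injective a ∧ fimg a Finset.univ = s ∧ Z a}

theorem properlyColorable_relEdges_iff {k : ℕ} {V : Type} {Z : (Fin k → V) → Prop}
    {κ : Cardinal.{0}} : ProperlyColorable (relEdges Z) κ ↔ ∃ (C : Type) (φ : V → C), #C ≤ κ ∧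
      ∀ a : Fin k → V, Function.Injective a → Z a → ∃ j j', φ (a j) ≠ φ (a j') := by
  refine exists₂_congr fun C φ => and_congr_right fun _ => ?_
  constructor
  · intro h a ha hZ
    obtain ⟨x, hx, y, hy, hxy⟩ := h _ ⟨a, ha, rfl, hZ⟩
    simp only [fimg, Finset.mem_image, Finset.mem_univ, true_and] at hx hy
    obtain ⟨j, rfl⟩ := hx
    obtain ⟨j', rfl⟩ := hy
    exact ⟨j, j', hxy⟩
  · rintro h _ ⟨a, ha, rfl, hZ⟩
    obtain ⟨j, j', hjj⟩ := h a ha hZ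
    refine ⟨a j, ?_, a j', ?_, hjj⟩ <;> simp [fimg]

theorem GoodArr.not_properlyColorable {k : ℕ} {V : Type} {Z : (Fin k → V) → Prop} {e : ℕ}
    (hG : GoodArr Z e) {κ : Cardinal.{0}} (hκ : ℵ₀ ≤ κ) (hle : Order.succ^[e] κ ≤ 𝔠) :
    ¬ ProperlyColorable (relEdges Z) κ := by
  rw [properlyColorable_relEdges_iff]
  rintro ⟨C, φ, hC, hφ⟩
  obtain ⟨e', he', P, B, f, hP, hB, hf, hZ⟩ := hG
  have hle' : Order.succ^[e'] κ ≤ 𝔠 :=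
    le_trans (Monotone.monotone_iterate_of_le_map Order.succ_mono (Order.le_succ κ) he') hle
  obtain ⟨L, hL⟩ : ∃ L, ∀ j i, P j i < L := by
    refine ⟨(Finset.univ.sup fun p : Fin k × Fin e' => P p.1 p.2) + 1, fun j i => ?_⟩
    exact Nat.lt_succ_of_le
      (Finset.le_sup (f := fun p : Fin k × Fin e' => P p.1 p.2) (Finset.mem_univ (j, i)))
  obtain ⟨α, c, hαB, hcol, hinj⟩ := exists_injective_grid hB hf hκ hle' hC φ
    (L + 2) (by omega)
  have hPlt : ∀ j i, P j i < L + 2 := fun j i => (hL j i).trans (by omega)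
  obtain ⟨j, j', hjj⟩ := hφ (fun j => f fun i => α i ⟨P j i, hPlt j i⟩)
    (fun j j' h => hP (by
      funext i
      have := congrFun (hinj h) i
      exact congrArg Fin.val this))
    (by
      have := hZ (fun i w => if h : w < L + 2 then α i ⟨w, h⟩ else α i ⟨0, by omega⟩)
        (fun i w => by split_ifs <;> exact hαB _ _)
      simpa [hPlt] using this)
  exact hjj ((hcol fun i => ⟨P j i, hPlt j i⟩).trans (hcol fun i => ⟨P j' i, hPlt j' i⟩).symm)

theorem GoodArr.exists_hasGrid {k : ℕ} {V : Type} {Z : (Fin k → V) → Prop} {e : ℕ}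
    (hG : GoodArr Z e) (hle : Order.succ^[e] (ℵ₀ : Cardinal.{0}) ≤ 𝔠) :
    ∃ e' ≤ e, ∃ P : Fin k → Fin e' → Fin k, Function.Injective P ∧ ∀ q, HasGrid Z P q := by
  classical
  obtain ⟨e', he', P, B, f, hP, hB, hf, hZ⟩ := hG
  have hle' : Order.succ^[e'] (ℵ₀ : Cardinal.{0}) ≤ 𝔠 :=
    le_trans (Monotone.monotone_iterate_of_le_map Order.succ_mono (Order.le_succ _) he') hle
  have hrep : ∀ (j : Fin k) (i : Fin e'), ∃ j' : Fin k, P j' i = P j i ∧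
      ∀ j₁ : Fin k, P j₁ i = P j i → j' ≤ j₁ := by
    intro j i
    have hne : (Finset.univ.filter fun j₁ : Fin k => P j₁ i = P j i).Nonempty := ⟨j, by simp⟩
    refine ⟨_, (Finset.mem_filter.1 (Finset.min'_mem _ hne)).2, fun j₁ h => ?_⟩
    exact Finset.min'_le _ _ (by simp [h])
  choose R hR hRmin using hrep
  have hRiff : ∀ j j' i, P j i = P j' i → R j i = R j' i := by
    intro j j' i h
    apply le_antisymm
    · exact hRmin _ _ _ ((hR j' i).trans h.symm)
    · exact hRmin _ _ _ ((hR j i).trans h)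
  refine ⟨e', he', R, fun j j' h => hP ?_, fun q => HasGrid.mono (q' := q + 2) (by omega) ?_⟩
  · funext i
    rw [← hR j i, ← hR j' i, congrFun h i]
  · obtain ⟨α, c, hαB, -, hinj⟩ := exists_injective_grid hB hf le_rfl hle'
      (C := PUnit) (by simp) (fun _ => ⟨⟩) (q + 2) (by omega)
    refine ⟨fun a => f fun i => α i (a i), hinj, fun β => ?_⟩
    have := hZ (fun i w => if h : ∃ j, P j i = w then α i (β i (R h.choose i)) else α i 0)
        (fun i w => by split_ifs <;> exact hαB _ _)
    convert this using 4 with j i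
    have hex : ∃ j', P j' i = P j i := ⟨j, rfl⟩
    rw [dif_pos hex, hRiff _ _ _ hex.choose_spec]

open MvPolynomial in
theorem aeval_optionEquivLeft {F R : Type*} [Field F] [Field R] [Algebra F R] {σ : Type*}
    (t : σ → R) (x : R) (m : MvPolynomial (Option σ) F) :
    aeval (fun o => o.elim x t) m =
      (optionEquivLeft F σ m).eval₂ (aeval t).toRingHom x := by
  induction m using MvPolynomial.induction_on with
  | C a => simp
  | add p q hp hq => rw [map_add, map_add, Polynomial.eval₂_add, hp, hq]
  | mul_X p o hp => cases o <;> simp [hp, Polynomial.eval₂_mul]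

open MvPolynomial in
theorem optionEquivLeft_pderiv_none {F : Type*} [Field F] {σ : Type*}
    (m : MvPolynomial (Option σ) F) :
    optionEquivLeft F σ (pderiv none m) = Polynomial.derivative (optionEquivLeft F σ m) := by
  classical
  induction m using MvPolynomial.induction_on with
  | C a => simp
  | add p q hp hq => simp only [map_add, hp, hq]
  | mul_X p o hp =>
    cases o <;> simp [Derivation.leibniz, pderiv_X, hp, mul_comm]

open MvPolynomial in
theorem exists_pderiv_aeval_ne_zero {F R : Type} [Field F] [Field R] [CharZero F] [Algebra F R]
    {σ : Type} {t : σ → R} (ht : AlgebraicIndependent F t) {x : R}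
    (h : ∃ P : MvPolynomial (Option σ) F, P ≠ 0 ∧ aeval (fun o => o.elim x t) P = 0) :
    ∃ P : MvPolynomial (Option σ) F, P ≠ 0 ∧ aeval (fun o => o.elim x t) P = 0 ∧
      aeval (fun o => o.elim x t) (pderiv none P) ≠ 0 := by
  classical
  obtain ⟨P, ⟨hP0, hP⟩, hmin⟩ := exists_minimalFor_of_wellFoundedLT
    (fun P : MvPolynomial (Option σ) F => P ≠ 0 ∧ aeval (fun o => o.elim x t) P = 0)
    (fun P => (optionEquivLeft F σ P).natDegree) h
  refine ⟨P, hP0, hP, fun hd => ?_⟩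
  have hdeg : (optionEquivLeft F σ P).natDegree ≠ 0 := by
    intro h0
    obtain ⟨b, hb⟩ := Polynomial.natDegree_eq_zero.1 h0
    have h1 := hP
    rw [aeval_optionEquivLeft, ← hb, Polynomial.eval₂_C] at h1
    have hb0 : b = 0 := ht.eq_zero_of_aeval_eq_zero b h1
    rw [hb0, map_zero, eq_comm, EmbeddingLike.map_eq_zero_iff] at hb
    exact hP0 hb
  have hd0 : pderiv none P ≠ 0 := by
    intro h0
    apply hdeg
    apply (Polynomial.derivative_eq_zero (R := MvPolynomial σ F)).1
    rw [← optionEquivLeft_pderiv_none, h0, map_zero]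
  have h1 := hmin ⟨hd0, hd⟩
  simp only [optionEquivLeft_pderiv_none] at h1
  have h2 := Polynomial.natDegree_derivative_lt hdeg
  exact absurd (h1 h2.le) (not_le.2 h2)

open MvPolynomial in
theorem exists_ne_zero_aeval_eq_zero {F R : Type} [Field F] [Field R] [Algebra F R] {s : Set R}
    (hs : IsTranscendenceBasis F ((↑) : s → R)) (x : R) :
    ∃ P : MvPolynomial (Option s) F, P ≠ 0 ∧ aeval (fun o => o.elim x (↑)) P = 0 := by
  have halg : Algebra.IsAlgebraic (Algebra.adjoin F (Set.range ((↑) : s → R))) R := hs.isAlgebraic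
  have h1 : ¬ AlgebraicIndependent F (fun o : Option s => o.elim x ((↑) : s → R)) := by
    rw [hs.1.option_iff_transcendental]
    exact fun h => h (halg.isAlgebraic x)
  rw [algebraicIndependent_iff] at h1
  push Not at h1
  obtain ⟨P, hP, hP0⟩ := h1
  exact ⟨P, hP0, hP⟩

open MvPolynomial in
/-- A point algebraic over an independent set is algebraic over a minimal tuple from it, by
separable equations that depend on every coordinate of the tuple. -/
theorem exists_point_representation {F R : Type} [Field F] [Field R] [CharZero F] [Algebra F R]
    {s : Set R} (hs : AlgebraicIndependent F ((↑) : s → R)) {n : ℕ} {x : Fin n → R}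
    (hx : ∀ l, ∃ P : MvPolynomial (Option s) F, P ≠ 0 ∧ aeval (fun o => o.elim (x l) (↑)) P = 0) :
    ∃ (r : ℕ) (t : Fin r → R) (m : Fin n → MvPolynomial (Option (Fin r)) F),
      Function.Injective t ∧ (∀ i, t i ∈ s) ∧ (∀ l, m l ≠ 0) ∧
      (∀ l, aeval (fun o => o.elim (x l) t) (m l) = 0) ∧
      (∀ l, aeval (fun o => o.elim (x l) t) (pderiv none (m l)) ≠ 0) ∧
      ∀ i, ∃ l, ∃ z : R, aeval (fun o => o.elim (x l) (Function.update t i z)) (m l) ≠ 0 := by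
  classical
  let Good (r : ℕ) : Prop := ∃ t : Fin r → R, Function.Injective t ∧ (∀ i, t i ∈ s) ∧
    ∀ l, ∃ P : MvPolynomial (Option (Fin r)) F, P ≠ 0 ∧ aeval (fun o => o.elim (x l) t) P = 0
  have hex : ∃ r, Good r := by
    choose P hP0 hP using hx
    let S : Finset s := Finset.univ.biUnion fun l => Finset.eraseNone (P l).vars
    let ι : Fin S.card → s := fun i => (S.equivFin.symm i).1
    have hι : Function.Injective ι := Subtype.val_injective.comp S.equivFin.symm.injective
    refine ⟨S.card, fun i => ι i, Subtype.val_injective.comp hι, fun i => (ι i).2, fun l => ?_⟩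
    obtain ⟨Q, hQ⟩ := exists_rename_eq_of_vars_subset_range (P l) (Option.map ι)
      (Option.map_injective hι) (by
        intro o ho
        cases o with
        | none => exact ⟨none, rfl⟩
        | some a =>
          have ha : a ∈ S := by
            simp only [S, Finset.mem_biUnion, Finset.mem_univ, true_and, Finset.mem_eraseNone]
            exact ⟨l, ho⟩
          exact ⟨some (S.equivFin ⟨a, ha⟩), by simp [ι]⟩)
    refine ⟨Q, fun h => hP0 l (by rw [← hQ, h, map_zero]), ?_⟩
    have h1 := hP l
    rw [← hQ, aeval_rename] at h1
    convert h1 using 3 with o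
    funext o
    cases o <;> rfl
  obtain ⟨r, ⟨t, htinj, hts, hP⟩, hmin⟩ : ∃ r, Good r ∧ ∀ r' < r, ¬ Good r' :=
    ⟨Nat.find hex, Nat.find_spec hex, fun _ => Nat.find_min hex⟩
  have ht : AlgebraicIndependent F t :=
    hs.comp (fun i => (⟨t i, hts i⟩ : s)) fun i j h => htinj (congrArg Subtype.val h)
  choose m hm0 hm hm' using fun l => exists_pderiv_aeval_ne_zero ht (hP l)
  refine ⟨r, t, m, htinj, hts, hm0, hm, hm', fun i => ?_⟩
  by_contra hcon
  push Not at hcon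
  obtain ⟨r', hr'⟩ : ∃ r', r = r' + 1 := ⟨r - 1, by have := i.2; omega⟩
  subst hr'
  refine hmin r' (by omega) ?_
  clear hmin hex
  have : Infinite F := inferInstance
  refine ⟨fun j => t (i.succAbove j), htinj.comp Fin.succAbove_right_injective,
    fun j => hts _, fun l => ?_⟩
  obtain ⟨z, hz⟩ : ∃ z : Option (Fin (r' + 1)) → F, eval z (m l) ≠ 0 := by
    by_contra h
    push Not at h
    exact hm0 l (MvPolynomial.funext fun z => by rw [h z, map_zero])
  let φ : MvPolynomial (Option (Fin (r' + 1))) F →ₐ[F] MvPolynomial (Option (Fin r')) F :=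
    aeval fun o => o.elim (X none)
      (i.insertNth (α := fun _ => MvPolynomial (Option (Fin r')) F) (C (z (some i)))
        fun j => X (some j))
  refine ⟨φ (m l), fun h => hz ?_, ?_⟩
  · have h1 : (aeval (fun o => o.elim (z none) fun j => z (some (i.succAbove j))) (φ (m l)) : F) =
        aeval z (m l) := by
      rw [← AlgHom.comp_apply]
      congr 1
      apply MvPolynomial.algHom_ext
      intro o
      rcases o with _ | j
      · simp [φ]
      · refine Fin.succAboveCases i ?_ (fun j => ?_) j <;> simp [φ]
    rw [h, map_zero, aeval_def, eval₂_eq_eval_map] at h1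
    simpa using h1.symm
  · have h1 := hcon l (algebraMap F R (z (some i)))
    rw [← h1, ← AlgHom.comp_apply]
    congr 1
    apply MvPolynomial.algHom_ext
    intro o
    rcases o with _ | j
    · simp [φ]
    · refine Fin.succAboveCases i ?_ (fun j => ?_) j <;> simp [φ, Fin.succAbove_ne]

open MvPolynomial in
/-- A polynomial relation between points that are algebraic over independent elements follows
from the algebraic equations defining these points, away from a proper subvariety. -/
theorem exists_generic_certificate {F R : Type} [Field F] [Field R] [Algebra F R] {Θ S : Type}
    {t : Θ → R} (ht : AlgebraicIndependent F t) (x : S → R) (m : S → MvPolynomial (Option Θ) F)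
    (hm0 : ∀ s, m s ≠ 0) (p : MvPolynomial S F) (hp : aeval x p = 0) :
    ∃ (q : MvPolynomial (S ⊕ Θ) F) (j : ℕ), aeval (Sum.elim x t) q ≠ 0 ∧
      rename Sum.inl p ^ j * q ∈ Ideal.span (Set.range fun s =>
        rename (fun o : Option Θ => o.elim (Sum.inl s) Sum.inr) (m s)) := by
  let M := MvPolynomial (S ⊕ Θ) F
  let ms (s : S) : M := rename (fun o : Option Θ => o.elim (Sum.inl s) Sum.inr) (m s)
  let I : Ideal M := Ideal.span (Set.range ms)
  let φ : MvPolynomial Θ F →+* M ⧸ I :=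
    (Ideal.Quotient.mk I).comp (rename Sum.inr : MvPolynomial Θ F →ₐ[F] M).toRingHom
  let _ : Algebra (MvPolynomial Θ F) (M ⧸ I) := φ.toAlgebra
  have halgφ : algebraMap (MvPolynomial Θ F) (M ⧸ I) = φ := rfl
  have hX (s : S) : IsAlgebraic (MvPolynomial Θ F) (Ideal.Quotient.mk I (X (Sum.inl s))) := by
    refine ⟨optionEquivLeft F Θ (m s), by simpa using hm0 s, ?_⟩
    rw [Polynomial.aeval_def, halgφ]
    have key : ∀ P : MvPolynomial (Option Θ) F,
        Polynomial.eval₂ φ (Ideal.Quotient.mk I (X (Sum.inl s))) (optionEquivLeft F Θ P) =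
        Ideal.Quotient.mk I (rename (fun o : Option Θ => o.elim (Sum.inl s) Sum.inr) P) := by
      intro P
      induction P using MvPolynomial.induction_on with
      | C a => simp [φ]
      | add p q hp hq => simp [hp, hq, Polynomial.eval₂_add]
      | mul_X p o hp =>
        rw [map_mul, Polynomial.eval₂_mul, hp]
        cases o <;> simp [φ]
    rw [key, Ideal.Quotient.eq_zero_iff_mem]
    exact Ideal.subset_span ⟨s, rfl⟩
  have hall : ∀ P : MvPolynomial S F,
      IsAlgebraic (MvPolynomial Θ F) (Ideal.Quotient.mk I (rename Sum.inl P)) := by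
    intro P
    induction P using MvPolynomial.induction_on with
    | C a =>
      have h1 : Ideal.Quotient.mk I (rename Sum.inl (C a : MvPolynomial S F)) =
          algebraMap (MvPolynomial Θ F) (M ⧸ I) (C a) := by
        rw [halgφ]; simp [φ]
      rw [h1]
      exact isAlgebraic_algebraMap _
    | add p q hp hq => rw [map_add, map_add]; exact hp.add hq
    | mul_X p s hp =>
      rw [map_mul, map_mul, rename_X]
      exact hp.mul (hX s)
  obtain ⟨G, hG0, hG⟩ := hall p
  obtain ⟨H, hGH, hH⟩ := Polynomial.exists_eq_pow_rootMultiplicity_mul_and_not_dvd G hG0 0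
  set j := Polynomial.rootMultiplicity 0 G
  rw [map_zero, sub_zero] at hGH hH
  rw [Polynomial.X_dvd_iff] at hH
  let q : M := Polynomial.eval₂ (rename Sum.inr : MvPolynomial Θ F →ₐ[F] M).toRingHom
    (rename Sum.inl p) H
  have haq (Y : S → R) (y : Θ → R) : aeval (Sum.elim Y y) q =
      Polynomial.eval₂ (aeval y : MvPolynomial Θ F →ₐ[F] R).toRingHom (aeval Y p) H := by
    have h1 := Polynomial.hom_eval₂ H (rename Sum.inr : MvPolynomial Θ F →ₐ[F] M).toRingHom
      (aeval (Sum.elim Y y) : M →ₐ[F] R).toRingHom (rename Sum.inl p)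
    have h2 : (aeval (Sum.elim Y y) : M →ₐ[F] R).toRingHom.comp
        (rename Sum.inr : MvPolynomial Θ F →ₐ[F] M).toRingHom =
        (aeval y : MvPolynomial Θ F →ₐ[F] R).toRingHom := by
      ext
      · simp
      · simp
    rw [h2] at h1
    refine h1.trans ?_
    congr 1
    change aeval (Sum.elim Y y) (rename Sum.inl p) = _
    rw [aeval_rename]
    rfl
  refine ⟨q, j, ?_, ?_⟩
  · rw [haq, hp, Polynomial.eval₂_at_zero]
    exact fun h => hH (ht.eq_zero_of_aeval_eq_zero _ h)
  · change rename Sum.inl p ^ j * q ∈ I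
    rw [← Ideal.Quotient.eq_zero_iff_mem, map_mul, map_pow, ← hG, Polynomial.aeval_def, halgφ,
      hGH, Polynomial.eval₂_mul, Polynomial.eval₂_pow, Polynomial.eval₂_X]
    congr 1
    exact (Polynomial.hom_eval₂ H _ (Ideal.Quotient.mk I) _).symm ▸ rfl

open MvPolynomial in
/-- A polynomial relation between points that are algebraic over independent elements propagates
to all points satisfying the same algebraic equations, away from a proper subvariety. -/
theorem exists_generic_propagation {F R : Type} [Field F] [Field R] [Algebra F R] {Θ S : Type}
    {t : Θ → R} (ht : AlgebraicIndependent F t) (x : S → R) (m : S → MvPolynomial (Option Θ) F)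
    (hm0 : ∀ s, m s ≠ 0) (p : MvPolynomial S F) (hp : aeval x p = 0) :
    ∃ q : MvPolynomial (S ⊕ Θ) F, aeval (Sum.elim x t) q ≠ 0 ∧
      ∀ (X : S → R) (y : Θ → R), (∀ s, aeval (fun o => o.elim (X s) y) (m s) = 0) →
        aeval (Sum.elim X y) q ≠ 0 → aeval X p = 0 := by
  obtain ⟨q, j, hq, hmem⟩ := exists_generic_certificate ht x m hm0 p hp
  refine ⟨q, hq, fun X y hX hqX => ?_⟩
  have h1 : Ideal.span (Set.range fun s =>
      rename (fun o : Option Θ => o.elim (Sum.inl s) Sum.inr) (m s)) ≤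
      RingHom.ker (aeval (Sum.elim X y) : MvPolynomial (S ⊕ Θ) F →ₐ[F] R).toRingHom := by
    refine Ideal.span_le.2 ?_
    rintro _ ⟨s, rfl⟩
    change aeval (Sum.elim X y) (rename _ (m s)) = 0
    rw [aeval_rename, ← hX s]
    congr 2
    funext o
    cases o <;> rfl
  have h2 : aeval (Sum.elim X y) (rename Sum.inl p ^ j * q) = 0 := h1 hmem
  rw [map_mul, map_pow, aeval_rename, Sum.elim_comp_inl] at h2
  exact eq_zero_of_pow_eq_zero ((mul_eq_zero.1 h2).resolve_right hqX)

/-- Finitely many analytic functions, none identically zero on a connected open set, have a common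
nonzero point in every nonempty open subset. -/
theorem exists_forall_ne_zero_of_analyticOnNhd {E G ι : Type*} [NormedAddCommGroup E]
    [NormedSpace ℝ E] [NormedAddCommGroup G] [NormedSpace ℝ G] {U : Set E} (hU : IsPreconnected U)
    (g : ι → E → G) (I : Finset ι) (hg : ∀ i ∈ I, AnalyticOnNhd ℝ (g i) U)
    (hne : ∀ i ∈ I, ∃ y ∈ U, g i y ≠ 0) {V : Set E} (hV : IsOpen V) (hVU : V ⊆ U)
    (hVne : V.Nonempty) : ∃ y ∈ V, ∀ i ∈ I, g i y ≠ 0 := by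
  classical
  induction I using Finset.induction_on generalizing V with
  | empty =>
    obtain ⟨y, hy⟩ := hVne
    exact ⟨y, hy, by simp⟩
  | insert i I hi ih =>
    have hgi := hg i (Finset.mem_insert_self i I)
    refine (?_ : ∃ y ∈ V, ∀ j ∈ insert i I, g j y ≠ 0)
    have hopen : IsOpen (V ∩ {y | g i y ≠ 0}) :=
      (hgi.continuousOn.mono hVU).isOpen_inter_preimage hV isOpen_ne
    obtain ⟨y, hy, hyI⟩ := ih (fun j hj => hg j (Finset.mem_insert_of_mem hj))
      (fun j hj => hne j (Finset.mem_insert_of_mem hj)) hopen (fun y hy => hVU hy.1) (by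
        by_contra hcon
        rw [Set.not_nonempty_iff_eq_empty] at hcon
        obtain ⟨z, hz⟩ := hVne
        have h0 : g i =ᶠ[nhds z] 0 := by
          filter_upwards [hV.mem_nhds hz] with y hy
          by_contra h
          have : y ∈ V ∩ {y | g i y ≠ 0} := ⟨hy, h⟩
          simp [hcon] at this
        obtain ⟨y, hy, hy'⟩ := hne i (Finset.mem_insert_self i I)
        exact hy' (hgi.eqOn_zero_of_preconnected_of_eventuallyEq_zero hU (hVU hz) h0 hy))
    refine ⟨y, hy.1, fun j hj => ?_⟩
    rcases Finset.mem_insert.1 hj with rfl | hj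
    · exact hy.2
    · exact hyI j hj

theorem HasStrictFDerivAt.eventually_ne_update {r n : ℕ} {f : (Fin r → ℝ) → Fin n → ℝ}
    {f' : (Fin r → ℝ) →L[ℝ] Fin n → ℝ} {t : Fin r → ℝ} (hf : HasStrictFDerivAt f f' t) {i : Fin r}
    (hi : f' (Pi.single i 1) ≠ 0) :
    ∃ δ > 0, ∀ a ∈ Metric.ball t δ, ∀ b ∈ Metric.ball t δ, a i ≠ b i →
      (∀ j, j ≠ i → a j = b j) → f a ≠ f b := by
  have hpos : 0 < ‖f' (Pi.single i 1)‖ / 2 := by positivity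
  have h1 := hf.isLittleO.def hpos
  rw [nhds_prod_eq, Metric.nhds_basis_ball.prod_self.eventually_iff] at h1
  obtain ⟨δ, hδ, h1⟩ := h1
  refine ⟨δ, hδ, fun a ha b hb hab hj hfab => ?_⟩
  have h2 := h1 (x := (a, b)) ⟨ha, hb⟩
  have h3 : a - b = (a i - b i) • (Pi.single i (1 : ℝ) : Fin r → ℝ) := by
    funext j
    by_cases hji : j = i
    · subst hji; simp
    · simp [hji, hj j hji]
  simp only [hfab, sub_self, zero_sub, norm_neg] at h2
  rw [h3, map_smul, norm_smul, norm_smul, Pi.norm_single, norm_one, mul_one] at h2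
  have h4 : 0 < ‖a i - b i‖ := norm_pos_iff.2 (sub_ne_zero.2 hab)
  nlinarith [mul_pos h4 hpos]

/-- An analytic parametrisation of an arrangement on a box yields an arrangement. -/
theorem GoodArr.of_analytic {k n r : ℕ} {Z : (Fin k → Fin n → ℝ) → Prop}
    {f : (Fin r → ℝ) → Fin n → ℝ} {t : Fin r → ℝ} {ε : ℝ} (hε : 0 < ε)
    (hf : AnalyticOnNhd ℝ f (Metric.ball t ε)) (P : Fin k → Fin r → ℕ) (I : Finset (Fin r))
    (hP : ∀ j j', (∀ i ∈ I, P j i = P j' i) → j = j')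
    (hnc : ∀ i ∈ I, ∃ y ∈ Metric.ball t ε, fderiv ℝ f y (Pi.single i 1) ≠ 0)
    (hZ : ∀ y : Fin r → ℕ → ℝ, (∀ i w, |y i w - t i| < ε) → Z fun j => f fun i => y i (P j i)) :
    GoodArr Z I.card := by
  classical
  have hball : IsPreconnected (Metric.ball t ε) := (convex_ball t ε).isPreconnected
  obtain ⟨u, hu, huI⟩ := exists_forall_ne_zero_of_analyticOnNhd hball
    (fun i y => fderiv ℝ f y (Pi.single i 1)) I (fun i _ => by
      have h1 := hf.fderiv
      exact fun y hy => (ContinuousLinearMap.apply ℝ (Fin n → ℝ)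
        (Pi.single i (1 : ℝ) : Fin r → ℝ)).analyticAt _ |>.comp (h1 y hy)) hnc
    Metric.isOpen_ball subset_rfl ⟨t, Metric.mem_ball_self hε⟩
  have hstrict : HasStrictFDerivAt f (fderiv ℝ f u) u := (hf u hu).hasStrictFDerivAt
  choose! δ hδ hinj using fun i (hi : i ∈ I) => hstrict.eventually_ne_update (huI i hi)
  obtain ⟨δ', hδ', hδ'I⟩ : ∃ δ' > 0, ∀ i ∈ I, δ' ≤ δ i := by
    rcases I.eq_empty_or_nonempty with rfl | hI
    · exact ⟨1, one_pos, by simp⟩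
    · obtain ⟨i, hi, him⟩ := Finset.exists_min_image I δ hI
      exact ⟨δ i, hδ i hi, him⟩
  obtain ⟨ρ, hρ, hρu⟩ := Metric.isOpen_iff.1 Metric.isOpen_ball u hu
  set η := min δ' ρ with hη
  have hη0 : 0 < η := lt_min hδ' hρ
  let ext : (Fin I.card → ℝ) → Fin r → ℝ := fun z i =>
    if h : i ∈ I then z (I.equivFin ⟨i, h⟩) else u i
  have hext {z : Fin I.card → ℝ} (hz : ∀ d, |z d - u (I.equivFin.symm d)| < η) (i : Fin r) :
      |ext z i - u i| < η := by
    by_cases h : i ∈ I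
    · simpa [ext, h] using hz (I.equivFin ⟨i, h⟩)
    · simpa [ext, h] using hη0
  have hmem {y : Fin r → ℝ} (hy : ∀ i, |y i - u i| < η) : y ∈ Metric.ball u η := by
    rw [Metric.mem_ball, dist_pi_lt_iff hη0]
    exact hy
  refine ⟨I.card, le_rfl, fun j d => P j (I.equivFin.symm d),
    fun d => Set.Ioo (u (I.equivFin.symm d) - η) (u (I.equivFin.symm d) + η),
    fun z => f (ext z), fun j j' h => hP j j' fun i hi => ?_, fun d => ?_, ?_, ?_⟩
  · simpa using congrFun h (I.equivFin ⟨i, hi⟩)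
  · exact Cardinal.mk_Ioo_real (by linarith)
  · intro a b ha hb d hab hj
    have ha' : ∀ d, |a d - u (I.equivFin.symm d)| < η := fun d => by
      have := ha d; rw [abs_lt]; constructor <;> linarith [this.1, this.2]
    have hb' : ∀ d, |b d - u (I.equivFin.symm d)| < η := fun d => by
      have := hb d; rw [abs_lt]; constructor <;> linarith [this.1, this.2]
    have hdI : (I.equivFin.symm d : Fin r) ∈ I := (I.equivFin.symm d).2
    have hsub : Metric.ball u η ⊆ Metric.ball u (δ (I.equivFin.symm d)) :=
      Metric.ball_subset_ball ((min_le_left _ _).trans (hδ'I _ hdI))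
    refine hinj _ hdI _ (hsub (hmem (hext ha'))) _ (hsub (hmem (hext hb'))) ?_ fun i hi => ?_
    · simpa [ext] using hab
    · by_cases h : i ∈ I
      · simp only [ext, h, dite_true]
        refine hj _ fun h' => hi ?_
        rw [← h']; simp
      · simp [ext, h]
  · intro y hy
    let y' : Fin r → ℕ → ℝ := fun i w => if h : i ∈ I then y (I.equivFin ⟨i, h⟩) w else u i
    have hy' : ∀ i w, |y' i w - t i| < ε := by
      intro i w
      have h1 : (fun i => y' i w) ∈ Metric.ball t ε := by
        refine hρu (Metric.ball_subset_ball (min_le_right _ _) (hmem ?_))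
        refine hext (z := fun d => y d w) fun d => ?_
        have := hy d w; rw [abs_lt]; constructor <;> linarith [this.1, this.2]
      rw [Metric.mem_ball, dist_pi_lt_iff hε] at h1
      exact h1 i
    convert hZ y' hy' using 4 with j i
    by_cases h : i ∈ I
    · simp [ext, y', h]
    · simp [ext, y', h]

/-- The zero set of separable equations is locally the graph of an analytic function. -/
theorem exists_analytic_graph {r n : ℕ} (M : Fin n → (Fin r → ℝ) × ℝ → ℝ) (t : Fin r → ℝ)
    (x : Fin n → ℝ) (hM : ∀ l, AnalyticAt ℝ (M l) (t, x l)) (h0 : ∀ l, M l (t, x l) = 0)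
    (d : Fin n → ℝ) (hd : ∀ l, HasDerivAt (fun v => M l (t, v)) (d l) (x l))
    (hd0 : ∀ l, d l ≠ 0) :
    ∃ (f : (Fin r → ℝ) → Fin n → ℝ) (ε : ℝ), 0 < ε ∧ AnalyticOnNhd ℝ f (Metric.ball t ε) ∧
      f t = x ∧ (∀ y ∈ Metric.ball t ε, ∀ l, M l (y, f y l) = 0) ∧
      ∀ y ∈ Metric.ball t ε, ∀ X ∈ Metric.ball x ε, (∀ l, M l (y, X l) = 0) → X = f y := by
  have hinv (l : Fin n) : ((fderiv ℝ (M l) (t, x l)).comp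
      (ContinuousLinearMap.inr ℝ (Fin r → ℝ) ℝ)).IsInvertible := by
    have h1 : HasFDerivAt (fun v => M l (t, v)) ((fderiv ℝ (M l) (t, x l)).comp
        (ContinuousLinearMap.inr ℝ (Fin r → ℝ) ℝ)) (x l) := by
      have := (hM l).differentiableAt.hasFDerivAt
      exact this.comp (x l) (hasFDerivAt_prodMk_right t (x l))
    have h2 := h1.unique (hd l).hasFDerivAt
    rw [h2]
    exact ⟨ContinuousLinearEquiv.unitsEquivAut ℝ (Units.mk0 (d l) (hd0 l)), by ext; simp⟩
  have hc (l : Fin n) : ContDiffAt ℝ (⊤ : WithTop ℕ∞) (M l) (t, x l) := (hM l).contDiffAt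
  have hω : (⊤ : WithTop ℕ∞) ≠ 0 := by simp
  let f : (Fin r → ℝ) → Fin n → ℝ := fun y l => (hc l).implicitFunction hω (hinv l) y
  have hfa : AnalyticAt ℝ f t := by
    rw [analyticAt_pi_iff]
    exact fun l => ((hc l).contDiffAt_implicitFunction hω (hinv l)).analyticAt
  have hft : f t = x := funext fun l => (hc l).implicitFunction_apply_self hω (hinv l)
  have h1 : ∀ᶠ y in nhds t, AnalyticAt ℝ f y ∧ ∀ l, M l (y, f y l) = 0 := by
    refine hfa.eventually_analyticAt.and ?_
    rw [Filter.eventually_all]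
    intro l
    filter_upwards [(hc l).eventually_apply_implicitFunction hω (hinv l)] with y hy
    rw [← h0 l, ← hy]
  have h2 : ∀ᶠ p : (Fin r → ℝ) × (Fin n → ℝ) in nhds (t, x),
      ∀ l, M l (p.1, p.2 l) = 0 → p.2 l = f p.1 l := by
    rw [Filter.eventually_all]
    intro l
    have h3 := (hc l).eventually_apply_eq_iff_implicitFunction hω (hinv l)
    have h4 : Filter.Tendsto (fun p : (Fin r → ℝ) × (Fin n → ℝ) => (p.1, p.2 l)) (nhds (t, x))
        (nhds (t, x l)) := by
      apply Continuous.tendsto (x := (t, x))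
        (f := fun p : (Fin r → ℝ) × (Fin n → ℝ) => (p.1, p.2 l))
      fun_prop
    filter_upwards [h4.eventually h3] with p hp hM
    exact (hp.1 (hM.trans (h0 l).symm)).symm
  obtain ⟨ε₁, hε₁, h1⟩ := Metric.eventually_nhds_iff_ball.1 h1
  obtain ⟨ε₂, hε₂, h2⟩ := Metric.eventually_nhds_iff_ball.1 h2
  refine ⟨f, min ε₁ ε₂, lt_min hε₁ hε₂, fun y hy => (h1 y ?_).1, hft, fun y hy => (h1 y ?_).2,
    fun y hy X hX h => funext fun l => ?_⟩
  · exact Metric.ball_subset_ball (min_le_left _ _) hy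
  · exact Metric.ball_subset_ball (min_le_left _ _) hy
  · refine h2 (y, X) ?_ l (h l)
    rw [← ball_prod_same]
    exact ⟨Metric.ball_subset_ball (min_le_right _ _) hy,
      Metric.ball_subset_ball (min_le_right _ _) hX⟩

/-- An implicitly defined function depends on every coordinate on which its equations depend. -/
theorem exists_fderiv_single_ne_zero {r n : ℕ} {M : Fin n → (Fin r → ℝ) × ℝ → ℝ} {t : Fin r → ℝ}
    {f : (Fin r → ℝ) → Fin n → ℝ} {ε : ℝ} (hε : 0 < ε)
    (hf : AnalyticOnNhd ℝ f (Metric.ball t ε))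
    (hfM : ∀ y ∈ Metric.ball t ε, ∀ l, M l (y, f y l) = 0)
    {i : Fin r} {l : Fin n} {z : ℝ} (hz : M l (Function.update t i z, f t l) ≠ 0)
    (hM : ∀ s, AnalyticAt ℝ (fun s => M l (Function.update t i s, f t l)) s) :
    ∃ y ∈ Metric.ball t ε, fderiv ℝ f y (Pi.single i 1) ≠ 0 := by
  by_contra hcon
  push Not at hcon
  have hmem (s : ℝ) (hs : s ∈ Metric.ball (t i) ε) : Function.update t i s ∈ Metric.ball t ε := by
    rw [Metric.mem_ball, dist_pi_lt_iff hε]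
    intro j
    by_cases hj : j = i
    · subst hj; simpa using hs
    · simpa [hj] using hε
  have hder (s : ℝ) (hs : s ∈ Metric.ball (t i) ε) :
      HasDerivAt (fun s => f (Function.update t i s)) 0 s := by
    have h1 := (hf _ (hmem s hs)).differentiableAt.hasFDerivAt.comp_hasDerivAt s
      (hasDerivAt_update t i s)
    rwa [hcon _ (hmem s hs)] at h1
  have hconst (s : ℝ) (hs : s ∈ Metric.ball (t i) ε) : f (Function.update t i s) = f t := by
    have h1 := Metric.isOpen_ball.is_const_of_deriv_eq_zero
      (convex_ball (t i) ε).isPreconnected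
      (fun s hs => (hder s hs).differentiableAt.differentiableWithinAt)
      (fun s hs => (hder s hs).deriv) hs (Metric.mem_ball_self hε)
    simpa using h1
  have hzero : (fun s => M l (Function.update t i s, f t l)) =ᶠ[nhds (t i)] 0 := by
    filter_upwards [Metric.ball_mem_nhds (t i) hε] with s hs
    have := hfM _ (hmem s hs) l
    rwa [hconst s hs] at this
  have hM' : AnalyticOnNhd ℝ (fun s => M l (Function.update t i s, f t l)) Set.univ :=
    fun s _ => hM s
  exact hz (congrFun (hM'.eq_of_eventuallyEq (analyticOnNhd_const (v := (0 : ℝ))) hzero) z)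

/-- `x` is a nondegenerate zero over `t` of the equations `m`, which depend on all of `t`. -/
def IsNondegZero {F R : Type} [Field F] [Field R] [Algebra F R] {n r : ℕ} (t : Fin r → R)
    (x : Fin n → R) (m : Fin n → MvPolynomial (Option (Fin r)) F) : Prop :=
  Function.Injective t ∧ (∀ l, m l ≠ 0) ∧
    (∀ l, MvPolynomial.aeval (fun o => o.elim (x l) t) (m l) = 0) ∧
    (∀ l, MvPolynomial.aeval (fun o => o.elim (x l) t) (MvPolynomial.pderiv none (m l)) ≠ 0) ∧
    ∀ i, ∃ l, ∃ z : R, MvPolynomial.aeval (fun o => o.elim (x l) (Function.update t i z)) (m l) ≠ 0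

theorem hasDerivAt_aeval_none {F : Type} [Field F] [Algebra F ℝ] {r : ℕ}
    (m : MvPolynomial (Option (Fin r)) F) (t : Fin r → ℝ) (x : ℝ) :
    HasDerivAt (fun v : ℝ => MvPolynomial.aeval (fun o => o.elim v t) m)
      (MvPolynomial.aeval (fun o => o.elim x t) (MvPolynomial.pderiv none m)) x := by
  have h1 (v : ℝ) : MvPolynomial.aeval (fun o => o.elim v t) m =
      ((MvPolynomial.optionEquivLeft F (Fin r) m).map
        (MvPolynomial.aeval t : MvPolynomial (Fin r) F →ₐ[F] ℝ).toRingHom).eval v := by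
    rw [aeval_optionEquivLeft, Polynomial.eval_map]
  simp_rw [h1]
  rw [aeval_optionEquivLeft, optionEquivLeft_pderiv_none, ← Polynomial.eval_map,
    ← Polynomial.derivative_map]
  exact Polynomial.hasDerivAt _ _

theorem analyticAt_aeval_option {F : Type} [Field F] [Algebra F ℝ] {r : ℕ}
    (m : MvPolynomial (Option (Fin r)) F) {E : Type*} [NormedAddCommGroup E] [NormedSpace ℝ E]
    {y : E → Fin r → ℝ} {v : E → ℝ} {p : E} (hy : AnalyticAt ℝ y p) (hv : AnalyticAt ℝ v p) :
    AnalyticAt ℝ (fun p => MvPolynomial.aeval (fun o => o.elim (v p) (y p)) m) p := by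
  induction m using MvPolynomial.induction_on with
  | C a => simpa using analyticAt_const
  | add p q hp hq => simp only [map_add]; exact hp.add hq
  | mul_X p o hp =>
    simp only [map_mul, MvPolynomial.aeval_X]
    refine hp.mul ?_
    cases o with
    | none => exact hv
    | some i => exact (analyticAt_pi_iff.1 hy) i

theorem exists_le_abs_sub {r : ℕ} {t : Fin r → ℝ} (htinj : Function.Injective t) :
    ∃ δ > 0, ∀ i i', i ≠ i' → 2 * δ ≤ |t i - t i'| := by
  by_cases hne : (Finset.univ.filter fun p : Fin r × Fin r => p.1 ≠ p.2).Nonempty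
  · obtain ⟨p, hp, hmin⟩ := Finset.exists_min_image _ (fun p => |t p.1 - t p.2|) hne
    simp only [Finset.mem_filter, Finset.mem_univ, true_and] at hp hmin
    have : 0 < |t p.1 - t p.2| := abs_pos.2 (sub_ne_zero.2 fun h => hp (htinj h))
    exact ⟨|t p.1 - t p.2| / 2, by positivity, fun i i' hi => by
      have := hmin (i, i') hi
      simpa [mul_div_cancel₀] using this⟩
  · refine ⟨1, one_pos, fun i i' hi => (hne ⟨(i, i'), by simpa using hi⟩).elim⟩

theorem exists_analytic_chart {F : Type} [Field F] [Algebra F ℝ] {n r : ℕ} {t : Fin r → ℝ}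
    {x : Fin n → ℝ} {m : Fin n → MvPolynomial (Option (Fin r)) F}
    (h0 : ∀ l, MvPolynomial.aeval (fun o => o.elim (x l) t) (m l) = 0)
    (hd : ∀ l, MvPolynomial.aeval (fun o => o.elim (x l) t) (MvPolynomial.pderiv none (m l)) ≠ 0)
    (hdep : ∀ i, ∃ l, ∃ z : ℝ,
      MvPolynomial.aeval (fun o => o.elim (x l) (Function.update t i z)) (m l) ≠ 0) :
    ∃ (f : (Fin r → ℝ) → Fin n → ℝ) (ε : ℝ), 0 < ε ∧ ∀ δ > 0, δ ≤ ε →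
      AnalyticOnNhd ℝ f (Metric.ball t δ) ∧ f t = x ∧
      (∀ y ∈ Metric.ball t δ, ∀ l, MvPolynomial.aeval (fun o => o.elim (f y l) y) (m l) = 0) ∧
      (∀ y ∈ Metric.ball t δ, ∀ X ∈ Metric.ball x δ,
        (∀ l, MvPolynomial.aeval (fun o => o.elim (X l) y) (m l) = 0) → X = f y) ∧
      ∀ i, ∃ y ∈ Metric.ball t δ, fderiv ℝ f y (Pi.single i 1) ≠ 0 := by
  obtain ⟨M, hM⟩ : ∃ M : Fin n → (Fin r → ℝ) × ℝ → ℝ, M = fun l p =>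
    MvPolynomial.aeval (fun o => o.elim p.2 p.1) (m l) := ⟨_, rfl⟩
  have hMa (l y v) : M l (y, v) = MvPolynomial.aeval (fun o => o.elim v y) (m l) := by rw [hM]
  have h1 (l : Fin n) : AnalyticAt ℝ (M l) (t, x l) := by
    rw [hM]; exact analyticAt_aeval_option _ analyticAt_fst analyticAt_snd
  have h2 (l : Fin n) : HasDerivAt (fun v => M l (t, v))
      (MvPolynomial.aeval (fun o => o.elim (x l) t) (MvPolynomial.pderiv none (m l))) (x l) := by
    simp_rw [hMa]; exact hasDerivAt_aeval_none (m l) t (x l)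
  obtain ⟨f, ε, hε, hf, hft, hfM, huniq⟩ := exists_analytic_graph M t x h1
    (fun l => by rw [hMa, h0]) _ h2 hd
  refine ⟨f, ε, hε, fun δ hδ hδε => ?_⟩
  have hsub : Metric.ball t δ ⊆ Metric.ball t ε := Metric.ball_subset_ball hδε
  have hsubx : Metric.ball x δ ⊆ Metric.ball x ε := Metric.ball_subset_ball hδε
  refine ⟨hf.mono hsub, hft, fun y hy l => by rw [← hMa, hfM y (hsub hy)],
    fun y hy X hX h => huniq y (hsub hy) X (hsubx hX) fun l => by rw [hMa, h l], fun i => ?_⟩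
  obtain ⟨l, z, hz⟩ := hdep i
  refine exists_fderiv_single_ne_zero (M := M) (i := i) (l := l) (z := z) hδ
    (hf.mono hsub) (fun y hy => hfM y (hsub hy)) (by rw [hft, hMa]; exact hz) fun s => ?_
  simp_rw [hMa]
  refine analyticAt_aeval_option _ ?_ analyticAt_const
  rw [analyticAt_pi_iff]
  intro j
  by_cases hj : j = i
  · subst hj; simp only [Function.update_self]; exact analyticAt_id
  · simpa [hj] using analyticAt_const

theorem IsNondegZero.exists_chart {F : Type} [Field F] [Algebra F ℝ] {n r : ℕ} {t : Fin r → ℝ}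
    {x : Fin n → ℝ} {m : Fin n → MvPolynomial (Option (Fin r)) F} (h : IsNondegZero t x m) :
    ∃ (f : (Fin r → ℝ) → Fin n → ℝ) (ε : ℝ), 0 < ε ∧
      AnalyticOnNhd ℝ f (Metric.ball t ε) ∧
      (∀ y ∈ Metric.ball t ε, ∀ l, MvPolynomial.aeval (fun o => o.elim (f y l) y) (m l) = 0) ∧
      (∀ y ∈ Metric.ball t ε, ∀ X ∈ Metric.ball x ε,
        (∀ l, MvPolynomial.aeval (fun o => o.elim (X l) y) (m l) = 0) → X = f y) ∧
      (∀ i, ∃ y ∈ Metric.ball t ε, fderiv ℝ f y (Pi.single i 1) ≠ 0) ∧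
      ∀ i i', i ≠ i' → ∀ s s', |s - t i| < ε → |s' - t i'| < ε → s ≠ s' := by
  obtain ⟨htinj, -, h0, hd, hdep⟩ := h
  obtain ⟨f, ε, hε, h⟩ := exists_analytic_chart h0 hd hdep
  obtain ⟨δ, hδ, hδ'⟩ := exists_le_abs_sub htinj
  obtain ⟨h1, -, h2, h3, h4⟩ := h (min ε δ) (lt_min hε hδ) (min_le_left _ _)
  refine ⟨f, min ε δ, lt_min hε hδ, h1, h2, h3, h4, fun i i' hi s s' hs hs' hss => ?_⟩
  subst hss
  have h1 := hs.trans_le (min_le_right _ _)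
  have h2 := hs'.trans_le (min_le_right _ _)
  have h3 := hδ' i i' hi
  have h4 := abs_sub_le (t i) s (t i')
  rw [abs_sub_comm (t i) s] at h4
  linarith

theorem mem_ball_pi_real {ι : Type*} [Fintype ι] {t y : ι → ℝ} {ε : ℝ} (hε : 0 < ε) :
    y ∈ Metric.ball t ε ↔ ∀ i, |y i - t i| < ε := by
  rw [Metric.mem_ball, dist_pi_lt_iff hε]
  simp_rw [Real.dist_eq]

theorem continuousAt_aeval {F : Type} [Field F] [Algebra F ℝ] {σ E : Type*} [TopologicalSpace E]
    {h : E → σ → ℝ} {p : E} (hh : ∀ s, ContinuousAt (fun p => h p s) p) (q : MvPolynomial σ F) :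
    ContinuousAt (fun p => MvPolynomial.aeval (h p) q) p := by
  induction q using MvPolynomial.induction_on with
  | C a => simpa using continuousAt_const
  | add p q hp hq => simp only [map_add]; exact hp.add hq
  | mul_X p o hp => simp only [map_mul, MvPolynomial.aeval_X]; exact hp.mul (hh o)

theorem analyticAt_aeval {F : Type} [Field F] [Algebra F ℝ] {σ E : Type*} [NormedAddCommGroup E]
    [NormedSpace ℝ E] {h : E → σ → ℝ} {p : E} (hh : ∀ s, AnalyticAt ℝ (fun p => h p s) p)
    (q : MvPolynomial σ F) : AnalyticAt ℝ (fun p => MvPolynomial.aeval (h p) q) p := by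
  induction q using MvPolynomial.induction_on with
  | C a => simpa using analyticAt_const
  | add p q hp hq => simp only [map_add]; exact hp.add hq
  | mul_X p o hp => simp only [map_mul, MvPolynomial.aeval_X]; exact hp.mul (hh o)

/-- The relation defined by a polynomial. -/
def polyRel {F R : Type} [Field F] [Field R] [Algebra F R] {k n : ℕ}
    (p : MvPolynomial (Fin k × Fin n) F) (a : Fin k → Fin n → R) : Prop :=
  MvPolynomial.aeval (fun v => a v.1 v.2) p = 0

theorem analyticOnNhd_aeval_reindex {F : Type} [Field F] [Algebra F ℝ] {k n r K : ℕ}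
    (p : MvPolynomial (Fin k × Fin n) F) {f : (Fin r → ℝ) → Fin n → ℝ} {t₀ : Fin r → ℝ} {ε : ℝ}
    (hε : 0 < ε) (hf : AnalyticOnNhd ℝ f (Metric.ball t₀ ε)) (P : Fin k → Fin r → Fin K) :
    AnalyticOnNhd ℝ (fun Y : Fin r → Fin K → ℝ =>
      MvPolynomial.aeval (fun v : Fin k × Fin n => f (fun i => Y i (P v.1 i)) v.2) p)
      (Metric.ball (fun i _ => t₀ i) ε) := by
  intro Y hY
  refine analyticAt_aeval (fun s => ?_) p
  have h1 : (fun i => Y i (P s.1 i)) ∈ Metric.ball t₀ ε := by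
    rw [mem_ball_pi_real hε]
    intro i
    rw [Metric.mem_ball, dist_pi_lt_iff hε] at hY
    have := hY i
    rw [dist_pi_lt_iff hε] at this
    exact this _
  have h2 : AnalyticAt ℝ (fun Y : Fin r → Fin K → ℝ => fun i => Y i (P s.1 i)) Y := by
    rw [analyticAt_pi_iff]
    intro i
    exact ((ContinuousLinearMap.proj (R := ℝ) (φ := fun _ : Fin K => ℝ) (P s.1 i)).comp
      (ContinuousLinearMap.proj (R := ℝ) (φ := fun _ : Fin r => Fin K → ℝ) i)).analyticAt Y
  exact (analyticAt_pi_iff.1 ((hf _ h1).comp_of_eq h2 rfl)) s.2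

/-- The relation between the points of a chart over independent parameters extends to the whole
chart. -/
theorem polyRel_of_chart {F : Type} [Field F] [Algebra F ℝ] {T : Set ℝ}
    (hT : AlgebraicIndependent F ((↑) : T → ℝ)) {k n r K : ℕ} {p : MvPolynomial (Fin k × Fin n) F}
    {m : Fin n → MvPolynomial (Option (Fin r)) F} (hm : ∀ l, m l ≠ 0)
    {f : (Fin r → ℝ) → Fin n → ℝ} {t₀ : Fin r → ℝ} {ε : ℝ}
    (hε : 0 < ε) (hf : AnalyticOnNhd ℝ f (Metric.ball t₀ ε))
    (hfm : ∀ y ∈ Metric.ball t₀ ε, ∀ l,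
      MvPolynomial.aeval (fun o => o.elim (f y l) y) (m l) = 0)
    (hdis : ∀ i i', i ≠ i' → ∀ s s', |s - t₀ i| < ε → |s' - t₀ i'| < ε → s ≠ s')
    (P : Fin k → Fin r → Fin K) {Y₀ : Fin r → Fin K → ℝ}
    (hY₀ : ∀ i w, |Y₀ i w - t₀ i| < ε) (hinj : ∀ i j j', Y₀ i (P j i) = Y₀ i (P j' i) →
      P j i = P j' i) (hYT : ∀ j i, Y₀ i (P j i) ∈ T)
    (hp : polyRel p fun j => f fun i => Y₀ i (P j i))
    {Y : Fin r → Fin K → ℝ} (hY : ∀ i w, |Y i w - t₀ i| < ε) :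
    polyRel p fun j => f fun i => Y i (P j i) := by
  classical
  let θ (j : Fin k) (i : Fin r) : T := ⟨Y₀ i (P j i), hYT j i⟩
  have hθ (j i j' i') (h : θ j i = θ j' i') : i = i' ∧ P j i = P j' i' := by
    have h' : Y₀ i (P j i) = Y₀ i' (P j' i') := congrArg Subtype.val h
    have hi : i = i' := by
      by_contra hne
      exact hdis i i' hne _ _ (hY₀ i (P j i)) (hY₀ i' (P j' i')) h'
    subst hi
    exact ⟨rfl, hinj _ _ _ h'⟩
  have hball (Y : Fin r → Fin K → ℝ) :
      Y ∈ Metric.ball (fun i (_ : Fin K) => t₀ i) ε ↔ ∀ i w, |Y i w - t₀ i| < ε := by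
    rw [Metric.mem_ball, dist_pi_lt_iff hε]
    simp_rw [dist_pi_lt_iff hε, Real.dist_eq]
  have hball' {Y : Fin r → Fin K → ℝ} (h : Y ∈ Metric.ball (fun i (_ : Fin K) => t₀ i) ε) (j) :
      (fun i => Y i (P j i)) ∈ Metric.ball t₀ ε := by
    rw [mem_ball_pi_real hε]
    exact fun i => (hball Y).1 h i _
  obtain ⟨q, hq, hprop⟩ := exists_generic_propagation hT
    (fun v : Fin k × Fin n => f (fun i => Y₀ i (P v.1 i)) v.2)
    (fun v => MvPolynomial.rename (Option.map (θ v.1)) (m v.2))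
    (fun v h => hm v.2 (by
      rw [← map_zero (MvPolynomial.rename (Option.map (θ v.1)))] at h
      refine MvPolynomial.rename_injective _ (Option.map_injective ?_) h
      exact fun i i' h => (hθ _ _ _ _ h).1)) p hp
  let η (Y : Fin r → Fin K → ℝ) (s : T) : ℝ :=
    if h : ∃ a : Fin k × Fin r, θ a.1 a.2 = s then Y h.choose.2 (P h.choose.1 h.choose.2) else s
  have hη (Y j i) : η Y (θ j i) = Y i (P j i) := by
    have h : ∃ a : Fin k × Fin r, θ a.1 a.2 = θ j i := ⟨(j, i), rfl⟩
    obtain ⟨h1, h2⟩ := hθ _ _ _ _ h.choose_spec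
    simp only [η, dif_pos h]
    rw [h2, h1]
  have hη₀ : η Y₀ = ((↑) : T → ℝ) := by
    funext s
    by_cases h : ∃ a : Fin k × Fin r, θ a.1 a.2 = s
    · obtain ⟨a, rfl⟩ := h
      exact hη _ _ _
    · simp only [η, dif_neg h]
  have hY₀b := (hball Y₀).2 hY₀
  have hcont : ContinuousAt (fun Y : Fin r → Fin K → ℝ => MvPolynomial.aeval
      (Sum.elim (fun v : Fin k × Fin n => f (fun i => Y i (P v.1 i)) v.2) (η Y)) q) Y₀ := by
    refine continuousAt_aeval (fun s => ?_) q
    rcases s with v | s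
    · have h1 := (hf _ (hball' hY₀b v.1)).continuousAt
      have h2 : ContinuousAt (fun Y : Fin r → Fin K → ℝ => fun i => Y i (P v.1 i)) Y₀ := by
        apply Continuous.continuousAt
        fun_prop
      have h3 : ContinuousAt (fun Y : Fin r → Fin K → ℝ => f fun i => Y i (P v.1 i)) Y₀ :=
        ContinuousAt.comp (f := fun Y : Fin r → Fin K → ℝ => fun i => Y i (P v.1 i)) h1 h2
      exact (continuous_apply v.2).continuousAt.comp h3
    · simp only [Sum.elim_inr, η]
      split_ifs
      · apply Continuous.continuousAt
        fun_prop
      · exact continuousAt_const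
  have hne := hcont.eventually_ne (y := 0) (by simp only [hη₀]; exact hq)
  have hnear : (fun Y : Fin r → Fin K → ℝ =>
      MvPolynomial.aeval (fun v : Fin k × Fin n => f (fun i => Y i (P v.1 i)) v.2) p) =ᶠ[nhds Y₀]
      0 := by
    filter_upwards [hne, Metric.isOpen_ball.mem_nhds hY₀b] with Y h1 h2
    refine hprop _ (η Y) (fun v => ?_) h1
    rw [MvPolynomial.aeval_rename, ← hfm _ (hball' h2 v.1) v.2]
    congr 2
    funext o
    cases o
    · rfl
    · simp [hη]
  exact (analyticOnNhd_aeval_reindex p hε hf P).eqOn_zero_of_preconnected_of_eventuallyEq_zero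
    (convex_ball _ _).isPreconnected hY₀b hnear ((hball Y).2 hY)

/-- If the hypergraph of a polynomial is not `κ`-colourable, then one of its edges, and the whole
box around it, is parametrized by a single analytic chart; moreover the parameters of the edge can
be taken of the same colour for given colourings of the parameter spaces. -/
theorem exists_analytic_edge {F : Type} [Field F] [CharZero F] [Countable F] [Algebra F ℝ]
    {k n : ℕ} (hk : 0 < k) (p : MvPolynomial (Fin k × Fin n) F) {κ : Cardinal.{0}} (hκ : ℵ₀ ≤ κ)
    (hnc : ¬ ProperlyColorable (relEdges (polyRel (R := ℝ) p)) κ) {D : ℕ → Type}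
    (g : ∀ r, (Fin r → ℝ) → D r) (hD : ∀ r, #(D r) ≤ κ) :
    ∃ (r : ℕ) (f : (Fin r → ℝ) → Fin n → ℝ) (t₀ : Fin r → ℝ) (ε : ℝ) (t : Fin k → Fin r → ℝ)
      (P : Fin k → Fin r → Fin k), 0 < ε ∧ AnalyticOnNhd ℝ f (Metric.ball t₀ ε) ∧
      (∀ i, ∃ y ∈ Metric.ball t₀ ε, fderiv ℝ f y (Pi.single i 1) ≠ 0) ∧
      Function.Injective t ∧ (∀ j j', g r (t j) = g r (t j')) ∧
      (∀ j j' i, P j i = P j' i → t j i = t j' i) ∧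
      ∀ y : Fin r → Fin k → ℝ, (∀ i w, |y i w - t₀ i| < ε) →
        polyRel p fun j => f fun i => y i (P j i) := by
  classical
  obtain ⟨T, hT⟩ := exists_isTranscendenceBasis F ℝ
  let Chart (r : ℕ) := Fin n → MvPolynomial (Option (Fin r)) F
  let W (r : ℕ) (m : Chart r) : Set ((Fin r → ℝ) × (Fin n → ℝ)) :=
    {w | IsNondegZero w.1 w.2 m}
  have hch (r : ℕ) (m : Chart r) (w : W r m) := IsNondegZero.exists_chart w.2
  choose f ε hε hf hfm huniq hfd hdis using hch
  have hcov (r : ℕ) (m : Chart r) : ∃ S : Set (W r m), S.Countable ∧ ∀ w ∈ W r m, ∃ s ∈ S,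
      w ∈ Metric.ball s.1 (ε r m s) := by
    obtain ⟨S, hS, hSc, hSu⟩ := TopologicalSpace.countable_cover_nhdsWithin
      (f := fun w => if h : w ∈ W r m then Metric.ball w (ε r m ⟨w, h⟩) else Set.univ)
      (s := W r m) (fun w hw => by
        simp only [dif_pos hw]
        exact mem_nhdsWithin_of_mem_nhds (Metric.ball_mem_nhds _ (hε _ _ _)))
    refine ⟨(↑) ⁻¹' S, hSc.preimage Subtype.val_injective, fun w hw => ?_⟩
    obtain ⟨s, hs, hws⟩ := Set.mem_iUnion₂.1 (hSu hw)
    rw [dif_pos (hS hs)] at hws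
    exact ⟨⟨s, hS hs⟩, hs, hws⟩
  choose S hSc hSu using hcov
  let C := Σ r : ℕ, (Σ m : Chart r, S r m) × D r
  have hC : #C ≤ κ := by
    rw [Cardinal.mk_sigma]
    refine (Cardinal.sum_le_mk_mul_iSup _).trans ?_
    refine (Cardinal.mul_le_max_of_aleph0_le_left (by simp)).trans (max_le (by simpa using hκ) ?_)
    refine ciSup_le' fun r => ?_
    rw [Cardinal.mk_prod, Cardinal.lift_id, Cardinal.lift_id]
    refine (Cardinal.mul_le_max _ _).trans (max_le (max_le ?_ (hD r)) hκ)
    have : Countable (Σ m : Chart r, S r m) := by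
      have := fun m => (hSc r m).to_subtype
      have : Countable (MvPolynomial (Option (Fin r)) F) :=
        Cardinal.mk_le_aleph0_iff.1 (MvPolynomial.cardinalMk_le_max.trans (by simp))
      infer_instance
    exact (Cardinal.mk_le_aleph0_iff.2 this).trans hκ
  let OK (x : Fin n → ℝ) (c : C) : Prop := ∃ t : Fin c.1 → ℝ, (∀ i, t i ∈ T) ∧
    IsNondegZero t x c.2.1.1 ∧ (t, x) ∈ Metric.ball c.2.1.2.1.1 (ε _ _ c.2.1.2.1) ∧
    g c.1 t = c.2.2
  have hOK (x : Fin n → ℝ) : ∃ c, OK x c := by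
    obtain ⟨r, t, m, h1, h2, h3⟩ := exists_point_representation hT.1
      (fun l => exists_ne_zero_aeval_eq_zero hT (x l))
    obtain ⟨s, hs, hws⟩ := hSu r m (t, x) ⟨h1, h3⟩
    exact ⟨⟨r, ⟨m, s, hs⟩, g r t⟩, t, h2, ⟨h1, h3⟩, hws, rfl⟩
  choose φ hφ using hOK
  rw [properlyColorable_relEdges_iff] at hnc
  push Not at hnc
  obtain ⟨a, ha, hpa, hmono⟩ := hnc C φ hC
  obtain ⟨c, hc⟩ : ∃ c, ∀ j, φ (a j) = c := ⟨φ (a ⟨0, hk⟩), fun j => hmono _ _⟩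
  have hac (j : Fin k) : OK (a j) c := hc j ▸ hφ (a j)
  obtain ⟨r, ⟨m, s, hs⟩, d⟩ := c
  choose t htT ht htb htg using hac
  replace htb (j) : t j ∈ Metric.ball s.1.1 (ε r m s) ∧ a j ∈ Metric.ball s.1.2 (ε r m s) := by
    have h := htb j
    rwa [Metric.mem_ball, Prod.dist_eq, max_lt_iff] at h
  have haf (j) : a j = f r m s (t j) := huniq r m s _ (htb j).1 _ (htb j).2 (ht j).2.2.1
  have hsel (i : Fin r) (j : Fin k) : ∃ j', t j' i = t j i := ⟨j, rfl⟩
  let P (j : Fin k) (i : Fin r) : Fin k := if h : ∃ j', t j' i = t j i then h.choose else j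
  have hP (j i) : t (P j i) i = t j i := by
    simp only [P, dif_pos (hsel i j)]
    exact (hsel i j).choose_spec
  have hP' (i j j') (h : t j i = t j' i) : P j i = P j' i := by
    simp only [P, dif_pos (hsel i _)]
    congr 1
    simp only [h]
  refine ⟨r, f r m s, s.1.1, ε r m s, t, P, hε _ _ _, hf _ _ _, hfd _ _ _, fun j j' h => ha ?_,
    fun j j' => (htg j).trans (htg j').symm, fun j j' i h => ?_, fun y hy => ?_⟩
  · rw [haf, haf, h]
  · rw [← hP j, h, hP]
  · refine polyRel_of_chart hT.1 s.2.2.1 (hε _ _ _) (hf _ _ _) (hfm _ _ _) (hdis _ _ _) P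
      (Y₀ := fun i w => t w i) (fun i w => (mem_ball_pi_real (hε _ _ _)).1 (htb w).1 i)
      (fun i j j' h => hP' _ _ _ ?_) (fun j i => htT _ _) ?_ hy
    · simpa only [hP] using h
    · simp only [hP]
      convert hpa using 2 with j
      exact (haf j).symm

/-- A polynomial hypergraph of uncountable chromatic number contains good arrays. -/
theorem goodArr_of_not_properlyColorable {F : Type} [Field F] [CharZero F] [Countable F]
    [Algebra F ℝ] {k n : ℕ} (hk : 0 < k) (p : MvPolynomial (Fin k × Fin n) F) {κ : Cardinal.{0}}
    (hκ : ℵ₀ ≤ κ) (hnc : ¬ ProperlyColorable (relEdges (polyRel (R := ℝ) p)) κ) :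
    GoodArr (polyRel (R := ℝ) p) (k * k) ∧
      ∀ e, 𝔠 ≤ Order.succ^[e] κ → GoodArr (polyRel (R := ℝ) p) e := by
  classical
  constructor
  · obtain ⟨r, f, t₀, ε, t, P, hε, hf, hfd, ht, -, hP, hZ⟩ := exists_analytic_edge hk p hκ hnc
      (D := fun _ => Unit) (fun _ _ => ()) (fun _ => by
        rw [Cardinal.mk_unit]; exact Cardinal.one_le_aleph0.trans hκ)
    have hsep (v : Fin k × Fin k) : ∃ I : Finset (Fin r), I.card ≤ 1 ∧
        ((∀ i ∈ I, P v.1 i = P v.2 i) → v.1 = v.2) := by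
      by_cases h : ∃ i, P v.1 i ≠ P v.2 i
      · obtain ⟨i, hi⟩ := h
        exact ⟨{i}, by simp, fun h => (hi (h i (by simp))).elim⟩
      · push Not at h
        exact ⟨∅, by simp, fun _ => ht (funext fun i => hP _ _ _ (h i))⟩
    choose I hI hI' using hsep
    refine GoodArr.mono (e := (Finset.univ.biUnion I).card) ?_ (GoodArr.of_analytic hε hf
      (fun j i => (P j i : ℕ)) (Finset.univ.biUnion I) (fun j j' h => hI' (j, j') fun i hi => ?_)
      (fun i _ => hfd i) fun y hy => ?_)
    · refine Finset.card_biUnion_le.trans ((Finset.sum_le_card_nsmul _ _ 1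
        fun v _ => hI v).trans ?_)
      simp
    · exact Fin.ext (h i (Finset.mem_biUnion.2 ⟨_, Finset.mem_univ _, hi⟩))
    · exact hZ (fun i w => y i w) fun i w => hy i w
  · intro e he
    choose D g hD hg using fun r => exists_separating_coloring (κ := κ) hκ e ℝ
      (Cardinal.mk_real.trans_le he) r
    obtain ⟨r, f, t₀, ε, t, P, hε, hf, hfd, ht, hgt, hP, hZ⟩ := exists_analytic_edge hk p hκ hnc
      g hD
    obtain ⟨I, hI, hsep⟩ := hg r (g r (t ⟨0, hk⟩))
    refine GoodArr.mono hI (GoodArr.of_analytic hε hf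
      (fun j i => (P j i : ℕ)) I (fun j j' h => ht ?_) (fun i _ => hfd i) fun y hy => ?_)
    · exact hsep _ _ (hgt _ _) (hgt _ _) fun i hi => hP _ _ _ (Fin.ext (h i hi))
    · exact hZ (fun i w => y i w) fun i w => hy i w

theorem MultilinearMap.eq_zero_of_mem_span {k : ℕ} {V : Type*} [AddCommGroup V] [Module ℝ V]
    (T : MultilinearMap ℝ (fun _ : Fin k => V) ℝ) (S : Fin k → Set V)
    (hT : ∀ x : Fin k → V, (∀ w, x w ∈ S w) → T x = 0) (x : Fin k → V)
    (hx : ∀ w, x w ∈ Submodule.span ℝ (S w)) : T x = 0 := by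
  classical
  suffices h : ∀ W : Finset (Fin k), ∀ x : Fin k → V, (∀ w ∈ W, x w ∈ Submodule.span ℝ (S w)) →
      (∀ w ∉ W, x w ∈ S w) → T x = 0 from
    h Finset.univ x (fun w _ => hx w) (fun w hw => absurd (Finset.mem_univ w) hw)
  intro W
  induction W using Finset.induction_on with
  | empty => exact fun x _ h => hT x fun w => h w (Finset.notMem_empty w)
  | insert w W hw ih =>
    intro x h1 h2
    suffices h : ∀ y ∈ Submodule.span ℝ (S w), T (Function.update x w y) = 0 by
      simpa using h (x w) (h1 w (Finset.mem_insert_self w W))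
    intro y hy
    induction hy using Submodule.span_induction with
    | mem y hy =>
      refine ih _ (fun w' hw' => ?_) fun w' hw' => ?_
      · have hne : w' ≠ w := fun h => hw (h ▸ hw')
        rw [Function.update_of_ne hne]
        exact h1 w' (Finset.mem_insert_of_mem hw')
      · by_cases hne : w' = w
        · subst hne; simpa using hy
        · rw [Function.update_of_ne hne]
          exact h2 w' (by simp [hne, hw'])
    | zero => exact T.map_update_zero x w
    | add y z _ _ hy hz => rw [T.map_update_add, hy, hz, add_zero]
    | smul a y _ hy => rw [T.map_update_smul, hy, smul_zero]

theorem exists_finset_span {U V : Type*} [AddCommGroup V] [Module ℝ V] [Module.Finite ℝ V]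
    (E : U → V) (B : Finset U) : ∃ C ⊆ B, C.card ≤ Module.finrank ℝ V ∧
      ∀ u ∈ B, E u ∈ Submodule.span ℝ (E '' C) := by
  classical
  obtain ⟨b, hb, -, h1, h2⟩ := exists_linearIndepOn_extension (K := ℝ) (v := E)
    (linearIndepOn_empty ℝ E) (Set.empty_subset (B : Set U))
  have hfin : b.Finite := B.finite_toSet.subset hb
  have hcoe : (hfin.toFinset : Set U) = b := hfin.coe_toFinset
  refine ⟨hfin.toFinset, fun u hu => hb (by simpa using hu), ?_, fun u hu => ?_⟩
  · rw [← hcoe] at h2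
    simpa using LinearIndependent.fintype_card_le_finrank h2
  · rw [hcoe]
    exact h1 ⟨u, hu, rfl⟩

theorem exists_disjoint_spanning {U V : Type*} [AddCommGroup V] [Module ℝ V] [Module.Finite ℝ V]
    {k : ℕ} (E : U → Fin k → V) (B : Finset U) (hB : k * Module.finrank ℝ V < B.card) :
    ∃ u ∈ B, ∃ C : Fin k → Set U, (∀ w, C w ⊆ B) ∧
      (∀ w w', w ≠ w' → Disjoint (C w) (C w')) ∧
      ∀ w, E u w ∈ Submodule.span ℝ ((fun c => E c w) '' C w) := by
  classical
  suffices h : ∀ W : Finset (Fin k), ∃ C : Fin k → Finset U, (∀ w, C w ⊆ B) ∧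
      (∀ w, (C w).card ≤ Module.finrank ℝ V) ∧
      (∀ w ∈ W, ∀ w' ∈ W, w ≠ w' → Disjoint (C w) (C w')) ∧
      ∀ u ∈ B, (∀ w ∈ W, u ∉ C w) → ∀ w ∈ W, E u w ∈ Submodule.span ℝ ((fun c => E c w) '' C w) by
    obtain ⟨C, h1, h2, h3, h4⟩ := h Finset.univ
    have h5 : (Finset.univ.biUnion C).card ≤ k * Module.finrank ℝ V := by
      simpa using Finset.card_biUnion_le_card_mul Finset.univ C _ fun w _ => h2 w
    obtain ⟨u, hu, huC⟩ := Finset.exists_mem_notMem_of_card_lt_card (h5.trans_lt hB)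
    refine ⟨u, hu, fun w => C w, fun w => by exact_mod_cast h1 w, fun w w' hne => ?_, fun w =>
      h4 u hu (fun w _ hw => huC (Finset.mem_biUnion.2 ⟨w, Finset.mem_univ w, hw⟩)) w
        (Finset.mem_univ w)⟩
    exact Finset.disjoint_coe.2 (h3 w (Finset.mem_univ _) w' (Finset.mem_univ _) hne)
  intro W
  induction W using Finset.induction_on with
  | empty => exact ⟨fun _ => ∅, by simp, by simp, by simp, by simp⟩
  | insert w W hw ih =>
    obtain ⟨C, h1, h2, h3, h4⟩ := ih
    obtain ⟨D, hD, hDc, hDs⟩ := exists_finset_span (fun u => E u w) (B \ W.biUnion C)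
    have hne {w'} (h : w' ∈ W) : w' ≠ w := fun h' => hw (h' ▸ h)
    have hdis {w'} (h : w' ∈ W) : Disjoint (C w') D := by
      rw [Finset.disjoint_left]
      intro u hu huD
      exact (Finset.mem_sdiff.1 (hD huD)).2 (Finset.mem_biUnion.2 ⟨w', h, hu⟩)
    refine ⟨Function.update C w D, fun w' => ?_, fun w' => ?_, fun w₁ h₁ w₂ h₂ h12 => ?_,
      fun u hu huC w' hw' => ?_⟩
    · by_cases h : w' = w
      · subst h; simpa using hD.trans Finset.sdiff_subset
      · rw [Function.update_of_ne h]; exact h1 w'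
    · by_cases h : w' = w
      · subst h; simpa using hDc
      · rw [Function.update_of_ne h]; exact h2 w'
    · rcases Finset.mem_insert.1 h₁ with rfl | h₁'
      · rcases Finset.mem_insert.1 h₂ with rfl | h₂'
        · exact absurd rfl h12
        · rw [Function.update_self, Function.update_of_ne (hne h₂')]
          exact (hdis h₂').symm
      · rcases Finset.mem_insert.1 h₂ with rfl | h₂'
        · rw [Function.update_self, Function.update_of_ne (hne h₁')]
          exact hdis h₁'
        · rw [Function.update_of_ne (hne h₁'), Function.update_of_ne (hne h₂')]
          exact h3 _ h₁' _ h₂' h12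
    · have huC' : ∀ w ∈ W, u ∉ C w := fun w' h => by
        simpa [Function.update_of_ne (hne h)] using huC w' (Finset.mem_insert_of_mem h)
      rcases Finset.mem_insert.1 hw' with rfl | h
      · rw [Function.update_self]
        refine hDs u (Finset.mem_sdiff.2 ⟨hu, fun h => ?_⟩)
        obtain ⟨w', h, h'⟩ := Finset.mem_biUnion.1 h
        exact huC' w' h h'
      · rw [Function.update_of_ne (hne h)]
        exact h4 u hu huC' w' h

/-- If a sum of products vanishes whenever its slots are filled by different objects, then it
vanishes on the diagonal with few exceptions. -/
theorem card_diagonal_le {U M : Type*} [Fintype M] {k : ℕ} (c : M → ℝ) (E : U → Fin k → M → ℝ)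
    (B : Finset U)
    (h : ∀ σ : Fin k → U, Function.Injective σ → (∀ w, σ w ∈ B) →
      ∑ m, c m * ∏ w, E (σ w) w m = 0)
    (hB : ∀ u ∈ B, ∑ m, c m * ∏ w, E u w m ≠ 0) : B.card ≤ k * Fintype.card M := by
  classical
  by_contra! hcon
  obtain ⟨u, hu, C, hC, hdis, hspan⟩ := exists_disjoint_spanning E B (by simpa using hcon)
  let T : MultilinearMap ℝ (fun _ : Fin k => M → ℝ) ℝ :=
    (∑ m, c m • LinearMap.proj m : (M → ℝ) →ₗ[ℝ] ℝ).compMultilinearMap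
      (MultilinearMap.mkPiAlgebra ℝ (Fin k) (M → ℝ))
  have hT (x : Fin k → M → ℝ) : T x = ∑ m, c m * ∏ w, x w m := by simp [T]
  refine hB u hu ?_
  rw [← hT fun w => E u w]
  refine T.eq_zero_of_mem_span (fun w => (fun c => E c w) '' C w) (fun x hx => ?_) _ hspan
  choose σ hσ hσx using hx
  obtain rfl : (fun w => E (σ w) w) = x := funext hσx
  rw [hT]
  refine h σ (fun w w' hww => ?_) fun w => by exact_mod_cast hC w (hσ w)
  by_contra hne
  exact Set.disjoint_left.1 (hdis w w' hne) (hσ w) (hww ▸ hσ w')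

theorem card_not_polyRel_diagonal_le {F : Type} [Field F] [Algebra F ℝ] {k n : ℕ} {U E : Type}
    [NormedAddCommGroup E] [NormedSpace ℝ E] (p : MvPolynomial (Fin k × Fin n) F)
    (s : Fin k → Fin k) {B : Set E} (hBo : IsOpen B) (hBc : IsPreconnected B)
    (ξ : U → Fin k → E → Fin n → ℝ) (hξ : ∀ u j l, AnalyticOnNhd ℝ (fun z => ξ u j z l) B)
    (W : Finset U)
    (h : ∀ σ : Fin k → U, Function.Injective σ → (∀ w, σ w ∈ W) → ∀ z ∈ B,
      polyRel p fun j => ξ (σ (s j)) j z)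
    (hW : ∀ u ∈ W, ∃ z ∈ B, ¬ polyRel p fun j => ξ u j z) : W.card ≤ k * p.support.card := by
  classical
  rcases W.eq_empty_or_nonempty with rfl | ⟨u₀, hu₀⟩
  · simp
  obtain ⟨z₀, hz₀, -⟩ := hW u₀ hu₀
  obtain ⟨g, hg⟩ : ∃ g : U → E → ℝ, ∀ u z,
    g u z = MvPolynomial.aeval (fun v : Fin k × Fin n => ξ u v.1 z v.2) p := ⟨_, fun _ _ => rfl⟩
  have hga (u) : AnalyticOnNhd ℝ (g u) B := by
    intro z hz
    have h1 := analyticAt_aeval (h := fun z (v : Fin k × Fin n) => ξ u v.1 z v.2)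
      (fun v => hξ u v.1 v.2 z hz) p
    exact h1.congr (Filter.Eventually.of_forall fun z => (hg u z).symm)
  have hgW (u) (hu : u ∈ W) : ∃ z ∈ B, g u z ≠ 0 := by
    obtain ⟨z, hz, h⟩ := hW u hu
    exact ⟨z, hz, by rw [hg]; exact h⟩
  obtain ⟨z, hz, hzW⟩ := exists_forall_ne_zero_of_analyticOnNhd hBc g W (fun u _ => hga u) hgW
    hBo subset_rfl ⟨z₀, hz₀⟩
  have key (σ : Fin k → U) : MvPolynomial.aeval
      (fun v : Fin k × Fin n => ξ (σ (s v.1)) v.1 z v.2) p =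
      ∑ m : p.support, algebraMap F ℝ (p.coeff m) * ∏ w, ∏ v : Fin k × Fin n with s v.1 = w,
        ξ (σ w) v.1 z v.2 ^ (m.1 v) := by
    rw [MvPolynomial.aeval_def, MvPolynomial.eval₂_eq', ← Finset.sum_coe_sort]
    refine Finset.sum_congr rfl fun m _ => ?_
    congr 1
    rw [← Finset.prod_fiberwise Finset.univ fun v : Fin k × Fin n => s v.1]
    refine Finset.prod_congr rfl fun w _ => Finset.prod_congr rfl fun v hv => ?_
    rw [(Finset.mem_filter.1 hv).2]
  refine (card_diagonal_le (fun m : p.support => algebraMap F ℝ (p.coeff m))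
    (fun u w m => ∏ v : Fin k × Fin n with s v.1 = w, ξ u v.1 z v.2 ^ (m.1 v)) W
    (fun σ hσ hσW => (key σ).symm.trans (h σ hσ hσW z hz))
    (fun u hu => (key fun _ => u).symm.trans_ne (hg u z ▸ hzW u hu))).trans_eq ?_
  rw [Fintype.card_coe]

/-- A grid size sufficient for eliminating the given number of directions with at most `B`
exceptions in each. -/
def gridBound (e k B : ℕ) : ℕ → ℕ
  | 0 => 1
  | j + 1 => gridBound e k B j + 1 + B * (gridBound e k B j ^ k) ^ e

theorem gridBound_mono (e k B : ℕ) : Monotone (gridBound e k B) :=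
  monotone_nat_of_le_succ fun j => by simp only [gridBound]; omega

theorem gridBound_pos (e k B j : ℕ) : 0 < gridBound e k B j := by
  cases j <;> simp [gridBound]

theorem exists_diagonal_of_gridBound_le {e k K B : ℕ} (hK : gridBound e k B e ≤ K)
    (Rel : (Fin e → Fin k → Fin K) → Prop)
    (h0 : ∀ β, (∀ d, Function.Injective (β d)) → Rel β)
    (hstep : ∀ δ β (U : Finset (Fin K)), (∀ σ : Fin k → Fin K, Function.Injective σ →
      (∀ w, σ w ∈ U) → Rel (Function.update β δ σ)) →
      (∀ u ∈ U, ¬ Rel (Function.update β δ fun _ => u)) → U.card ≤ B) :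
    ∃ a : Fin e → Fin K, Rel fun d _ => a d := by
  classical
  suffices h : ∀ i ≤ e, ∃ a : Fin e → Fin K, ∀ β : Fin e → Fin k → Fin K,
      (∀ d : Fin e, d.1 < i → β d = fun _ => a d) →
      (∀ d : Fin e, i ≤ d.1 → Function.Injective (β d) ∧
        ∀ j, (β d j).1 < gridBound e k B (e - i)) → Rel β by
    obtain ⟨a, ha⟩ := h e le_rfl
    exact ⟨a, ha _ (fun _ _ => rfl) fun d hd => absurd d.2 (by omega)⟩
  intro i
  have hK0 : 0 < K := (gridBound_pos e k B e).trans_le hK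
  induction i with
  | zero => exact fun _ => ⟨fun _ => ⟨0, hK0⟩, fun β _ h => h0 β fun d => (h d (by omega)).1⟩
  | succ i ih =>
    intro hi
    obtain ⟨a, ha⟩ := ih (by omega)
    set δ : Fin e := ⟨i, by omega⟩ with hδ
    obtain ⟨s', hs'⟩ : ∃ s', s' = gridBound e k B (e - (i + 1)) := ⟨_, rfl⟩
    have hs : gridBound e k B (e - i) = s' + 1 + B * (s' ^ k) ^ e := by
      rw [show e - i = (e - (i + 1)) + 1 by omega, gridBound, hs']
    have hs'0 : 0 < s' := hs' ▸ gridBound_pos e k B _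
    have hsK : gridBound e k B (e - i) ≤ K := (gridBound_mono e k B (by omega)).trans hK
    rw [← hs']
    rw [hs] at ha hsK
    obtain ⟨s, hss⟩ : ∃ s, s = s' + 1 + B * (s' ^ k) ^ e := ⟨_, rfl⟩
    rw [← hss] at ha hsK
    by_contra! hcon
    have hbad : ∀ u : Fin K, ∃ β : Fin e → Fin k → Fin K,
        (∀ d : Fin e, d.1 < i → β d = fun _ => a d) ∧ (β δ = fun _ => u) ∧
        (∀ d : Fin e, i + 1 ≤ d.1 → Function.Injective (β d) ∧ ∀ j, (β d j).1 < s') ∧ ¬ Rel β := by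
      intro u
      obtain ⟨β, h1, h2, h3⟩ := hcon (Function.update a δ u)
      refine ⟨β, fun d hd => ?_, ?_, h2, h3⟩
      · rw [h1 d (by omega), Function.update_of_ne]
        rintro rfl
        simp [hδ] at hd
      · rw [h1 δ (by simp [hδ]), Function.update_self]
    choose β hβ1 hβ2 hβ3 hβ4 using hbad
    let γ (u : Fin K) : Fin e → Fin k → Fin s' := fun d j =>
      if h : (β u d j).1 < s' then ⟨_, h⟩ else ⟨0, hs'0⟩
    let W : Finset (Fin K) := Finset.univ.filter fun u => u.1 < s
    have hW : W.card = s := by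
      have := Fin.card_filter_val_lt (n := K) (m := s)
      simp only [W]
      omega
    obtain ⟨g, -, hg⟩ := Finset.exists_lt_card_fiber_of_mul_lt_card_of_maps_to
      (s := W) (t := Finset.univ) (f := γ) (n := B) (fun _ _ => Finset.mem_univ _) (by
        rw [hW, hss, Finset.card_univ]
        simp only [Fintype.card_pi, Fintype.card_fin, Finset.prod_const, Finset.card_univ]
        nlinarith)
    obtain ⟨u₀, hu₀⟩ := Finset.card_pos.1 ((Nat.zero_le B).trans_lt hg)
    have hupd : ∀ u ∈ W.filter fun u => γ u = g, β u = Function.update (β u₀) δ fun _ => u := by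
      intro u hu
      funext d
      by_cases hd : d = δ
      · rw [hd, hβ2, Function.update_self]
      rw [Function.update_of_ne hd]
      rcases Nat.lt_or_ge d.1 i with h | h
      · rw [hβ1 _ _ h, hβ1 _ _ h]
      · have h' : i + 1 ≤ d.1 := by
          have : d.1 ≠ i := fun h => hd (Fin.ext h)
          omega
        funext j
        have h1 : γ u d j = γ u₀ d j := by
          rw [(Finset.mem_filter.1 hu).2, (Finset.mem_filter.1 hu₀).2]
        simp only [γ, dif_pos ((hβ3 _ d h').2 j)] at h1
        exact Fin.ext (by simpa [Fin.ext_iff] using h1)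
    refine absurd (hstep δ (β u₀) (W.filter fun u => γ u = g) (fun σ hσ hσU => ha _ ?_ ?_)
      fun u hu => hupd u hu ▸ hβ4 u) (not_le.2 hg)
    · intro d hd
      rw [Function.update_of_ne (by rintro rfl; simp [hδ] at hd), hβ1 _ _ hd]
    · intro d hd
      by_cases hd' : d = δ
      · subst hd'
        rw [Function.update_self]
        exact ⟨hσ, fun j => (Finset.mem_filter.1 (Finset.mem_filter.1 (hσU j)).1).2⟩
      · rw [Function.update_of_ne hd']
        have h' : i + 1 ≤ d.1 := by
          have : d.1 ≠ i := fun h => hd' (Fin.ext h)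
          omega
        obtain ⟨h1, h2⟩ := hβ3 u₀ d h'
        exact ⟨h1, fun j => (h2 j).trans_le (by omega)⟩

theorem eventually_small_charts {F : Type} [Field F] [Algebra F ℝ] {n r : ℕ} {A ι : Type}
    [Fintype A] [Finite ι]
    {Y : Fin r → A → ℝ} {X : A → Fin n → ℝ} {f : A → (Fin r → ℝ) → Fin n → ℝ} {ε : A → ℝ}
    (hε : ∀ a, 0 < ε a)
    (hf : ∀ a, AnalyticOnNhd ℝ (f a) (Metric.ball (fun i => Y i a) (ε a)))
    (hfX : ∀ a, f a (fun i => Y i a) = X a)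
    (q : ι → MvPolynomial ((A × Fin n) ⊕ (Fin r × A)) F)
    (hq : ∀ b, MvPolynomial.aeval (Sum.elim (fun v : A × Fin n => X v.1 v.2)
      (fun v : Fin r × A => Y v.1 v.2)) (q b) ≠ 0) :
    ∃ δ > 0, (∀ a, δ ≤ ε a) ∧ ∀ b, ∀ Y' : Fin r → A → ℝ, (∀ i a, |Y' i a - Y i a| < δ) →
      MvPolynomial.aeval (Sum.elim (fun v : A × Fin n => f v.1 (fun i => Y' i v.1) v.2)
        (fun v : Fin r × A => Y' v.1 v.2)) (q b) ≠ 0 := by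
  obtain ⟨G, hG⟩ : ∃ G : ι → (Fin r → A → ℝ) → ℝ, ∀ b Y', G b Y' = MvPolynomial.aeval
      (Sum.elim (fun v : A × Fin n => f v.1 (fun i => Y' i v.1) v.2)
        (fun v : Fin r × A => Y' v.1 v.2)) (q b) := ⟨_, fun _ _ => rfl⟩
  have hcont (b) : ContinuousAt (G b) Y := by
    have h := continuousAt_aeval (p := Y) (h := fun Y' : Fin r → A → ℝ =>
      (Sum.elim (fun v : A × Fin n => f v.1 (fun i => Y' i v.1) v.2)
        (fun v : Fin r × A => Y' v.1 v.2))) (fun s => ?_) (q b)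
    · exact h.congr (Filter.Eventually.of_forall fun Y' => (hG b Y').symm)
    · rcases s with v | v
      · have h1 := (hf v.1 _ (Metric.mem_ball_self (hε v.1))).continuousAt
        have h2 : ContinuousAt (fun Y' : Fin r → A → ℝ => fun i => Y' i v.1) Y := by
          apply Continuous.continuousAt
          fun_prop
        have h3 : ContinuousAt (fun Y' : Fin r → A → ℝ => f v.1 fun i => Y' i v.1) Y :=
          ContinuousAt.comp (f := fun Y' : Fin r → A → ℝ => fun i => Y' i v.1) h1 h2
        exact (continuous_apply v.2).continuousAt.comp h3
      · simp only [Sum.elim_inr]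
        apply Continuous.continuousAt
        fun_prop
  have hne : ∀ᶠ Y' in nhds Y, ∀ b, G b Y' ≠ 0 := by
    rw [Filter.eventually_all]
    intro b
    refine (hcont b).eventually_ne ?_
    rw [hG]
    simpa only [hfX] using hq b
  obtain ⟨δ₁, hδ₁, h1⟩ := Metric.eventually_nhds_iff_ball.1 hne
  obtain ⟨δ₂, hδ₂, h2⟩ : ∃ δ > 0, ∀ a, δ ≤ ε a := by
    rcases isEmpty_or_nonempty A with h | h
    · exact ⟨1, one_pos, fun a => h.elim a⟩
    · obtain ⟨a, ha⟩ := Finite.exists_min ε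
      exact ⟨ε a, hε a, ha⟩
  refine ⟨min δ₁ δ₂, lt_min hδ₁ hδ₂, fun a => (min_le_right _ _).trans (h2 a), fun b Y' hY' => ?_⟩
  rw [← hG]
  refine h1 Y' ?_ b
  rw [Metric.mem_ball, dist_pi_lt_iff hδ₁]
  intro i
  rw [dist_pi_lt_iff hδ₁]
  intro a
  rw [Real.dist_eq]
  exact (hY' i a).trans_le (min_le_left _ _)

/-- Functions on a power depending, in each component, only on prescribed coordinates. -/
def DependsOnCoords {r e : ℕ} {K R : Type} (J : Fin r → Finset (Fin e))
    (Y : Fin r → (Fin e → K) → R) : Prop :=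
  ∀ i a a', (∀ d ∈ J i, a d = a' d) → Y i a = Y i a'

/-- The relation holds along a family of charts. -/
def ChartRel {F : Type} [Field F] [Algebra F ℝ] {k n e r K : ℕ}
    (p : MvPolynomial (Fin k × Fin n) F) (P : Fin k → Fin e → Fin k)
    (J : Fin r → Finset (Fin e)) (Y : Fin r → (Fin e → Fin K) → ℝ)
    (f : (Fin e → Fin K) → (Fin r → ℝ) → Fin n → ℝ) (δ : ℝ) (β : Fin e → Fin k → Fin K) : Prop :=
  ∀ y : Fin r → (Fin e → Fin k) → ℝ, DependsOnCoords J y →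
    (∀ i v, |y i v - Y i (fun d => β d (v d))| < δ) →
    polyRel p fun j => f (fun d => β d (P j d)) fun i => y i (P j)

theorem chartRel_of_injective {F : Type} [Field F] [Algebra F ℝ] {k n e r K : ℕ}
    {p : MvPolynomial (Fin k × Fin n) F} {P : Fin k → Fin e → Fin k}
    {J : Fin r → Finset (Fin e)} {Y : Fin r → (Fin e → Fin K) → ℝ} (hY : DependsOnCoords J Y)
    {f : (Fin e → Fin K) → (Fin r → ℝ) → Fin n → ℝ} {δ : ℝ} (hδ : 0 < δ)
    {β : Fin e → Fin k → Fin K} (hβ : ∀ d, Function.Injective (β d))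
    (h : ∀ Y' : Fin r → (Fin e → Fin K) → ℝ, DependsOnCoords J Y' →
      (∀ i a, |Y' i a - Y i a| < δ) →
      polyRel p fun j => f (fun d => β d (P j d)) fun i => Y' i fun d => β d (P j d)) :
    ChartRel p P J Y f δ β := by
  classical
  intro y hy hyY
  let Y' : Fin r → (Fin e → Fin K) → ℝ := fun i a =>
    if h : ∃ v : Fin e → Fin k, ∀ d ∈ J i, β d (v d) = a d then y i h.choose else Y i a
  have hval (i) (v : Fin e → Fin k) : Y' i (fun d => β d (v d)) = y i v := by
    have h : ∃ v' : Fin e → Fin k, ∀ d ∈ J i, β d (v' d) = β d (v d) := ⟨v, fun _ _ => rfl⟩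
    simp only [Y', dif_pos h]
    exact hy i _ _ fun d hd => hβ d (h.choose_spec d hd)
  have hYd : DependsOnCoords J Y' := by
    intro i a a' haa
    by_cases h : ∃ v : Fin e → Fin k, ∀ d ∈ J i, β d (v d) = a d
    · have h' : ∃ v : Fin e → Fin k, ∀ d ∈ J i, β d (v d) = a' d := by
        obtain ⟨v, hv⟩ := h
        exact ⟨v, fun d hd => (hv d hd).trans (haa d hd)⟩
      simp only [Y', dif_pos h, dif_pos h']
      exact hy i _ _ fun d hd => hβ d (((h.choose_spec d hd).trans (haa d hd)).trans
        (h'.choose_spec d hd).symm)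
    · have h' : ¬ ∃ v : Fin e → Fin k, ∀ d ∈ J i, β d (v d) = a' d := by
        rintro ⟨v, hv⟩
        exact h ⟨v, fun d hd => (hv d hd).trans (haa d hd).symm⟩
      simp only [Y', dif_neg h, dif_neg h']
      exact hY i a a' haa
  have := h Y' hYd fun i a => ?_
  · simpa only [hval] using this
  · by_cases h : ∃ v : Fin e → Fin k, ∀ d ∈ J i, β d (v d) = a d
    · simp only [Y', dif_pos h]
      have h1 := hyY i h.choose
      rwa [hY i _ a h.choose_spec] at h1
    · simp only [Y', dif_neg h, sub_self, abs_zero]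
      exact hδ

theorem card_not_chartRel_le {F : Type} [Field F] [Algebra F ℝ] {k n e r K : ℕ}
    {p : MvPolynomial (Fin k × Fin n) F} {P : Fin k → Fin e → Fin k}
    {J : Fin r → Finset (Fin e)} {Y : Fin r → (Fin e → Fin K) → ℝ} (hY : DependsOnCoords J Y)
    {f : (Fin e → Fin K) → (Fin r → ℝ) → Fin n → ℝ} {δ : ℝ} (hδ : 0 < δ)
    (hf : ∀ a, AnalyticOnNhd ℝ (f a) (Metric.ball (fun i => Y i a) δ))
    (d₀ : Fin e) (β : Fin e → Fin k → Fin K) (U : Finset (Fin K))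
    (h : ∀ σ : Fin k → Fin K, Function.Injective σ → (∀ w, σ w ∈ U) →
      ChartRel p P J Y f δ (Function.update β d₀ σ))
    (hU : ∀ u ∈ U, ¬ ChartRel p P J Y f δ (Function.update β d₀ fun _ => u)) :
    U.card ≤ k * p.support.card := by
  classical
  rcases U.eq_empty_or_nonempty with rfl | ⟨u₀, hu₀⟩
  · simp
  obtain ⟨up, hup⟩ : ∃ up : Fin K → (Fin e → Fin k) → Fin e → Fin K,
    ∀ u v d, up u v d = Function.update β d₀ (fun _ => u) d (v d) := ⟨_, fun _ _ _ => rfl⟩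
  have hup' (σ : Fin k → Fin K) (v : Fin e → Fin k) :
      (fun d => Function.update β d₀ σ d (v d)) = up (σ (v d₀)) v := by
    funext d
    rw [hup]
    by_cases hd : d = d₀
    · subst hd; simp
    · simp [hd]
  obtain ⟨z₀, hz₀⟩ : ∃ z₀ : Fin r → Option (Fin K) → (Fin e → Fin k) → ℝ,
    ∀ i o v, z₀ i o v = Y i (up (o.getD u₀) v) := ⟨_, fun _ _ _ => rfl⟩
  let name (i : Fin r) (u : Fin K) : Option (Fin K) := if d₀ ∈ J i then some u else none
  let mask (i : Fin r) (v : Fin e → Fin k) : Fin e → Fin k :=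
    fun d => if d ∈ J i then v d else ⟨0, (Nat.zero_le _).trans_lt (v d).2⟩
  have hz₀name (i u v) : z₀ i (name i u) v = Y i (up u v) := by
    rw [hz₀]
    refine hY i _ _ fun d hd => ?_
    rw [hup, hup]
    by_cases hdd : d = d₀
    · subst hdd; simp [name, hd]
    · simp [hdd]
  have hYmask (i u v) : Y i (up u (mask i v)) = Y i (up u v) :=
    hY i _ _ fun d hd => by rw [hup, hup]; simp [mask, hd]
  have hball (z : Fin r → Option (Fin K) → (Fin e → Fin k) → ℝ) :
      z ∈ Metric.ball z₀ δ ↔ ∀ i o v, |z i o v - z₀ i o v| < δ := by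
    rw [Metric.mem_ball, dist_pi_lt_iff hδ]
    simp_rw [dist_pi_lt_iff hδ, Real.dist_eq]
  have hnear {z} (hz : z ∈ Metric.ball z₀ δ) (u v i) :
      |z i (name i u) (mask i v) - Y i (up u v)| < δ := by
    rw [← hYmask, ← hz₀name]
    exact (hball z).1 hz _ _ _
  obtain ⟨ξ, hξ⟩ : ∃ ξ : Fin K → Fin k → (Fin r → Option (Fin K) → (Fin e → Fin k) → ℝ) →
      Fin n → ℝ, ∀ u j z, ξ u j z =
        f (up u (P j)) fun i => z i (name i u) (mask i (P j)) := ⟨_, fun _ _ _ => rfl⟩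
  refine card_not_polyRel_diagonal_le p (fun j => P j d₀) (B := Metric.ball z₀ δ)
    Metric.isOpen_ball (convex_ball z₀ δ).isPreconnected ξ ?_ U ?_ ?_
  · intro u j l z hz
    have h1 : (fun i => z i (name i u) (mask i (P j))) ∈
        Metric.ball (fun i => Y i (up u (P j))) δ := by
      rw [mem_ball_pi_real hδ]
      exact fun i => hnear hz u (P j) i
    have h2 : AnalyticAt ℝ (fun (z : Fin r → Option (Fin K) → (Fin e → Fin k) → ℝ) =>
        fun i => z i (name i u) (mask i (P j))) z := by
      rw [analyticAt_pi_iff]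
      intro i
      exact ((ContinuousLinearMap.proj (R := ℝ) (φ := fun _ : Fin e → Fin k => ℝ)
        (mask i (P j))).comp ((ContinuousLinearMap.proj (R := ℝ)
          (φ := fun _ : Option (Fin K) => (Fin e → Fin k) → ℝ) (name i u)).comp
            (ContinuousLinearMap.proj (R := ℝ)
              (φ := fun _ : Fin r => Option (Fin K) → (Fin e → Fin k) → ℝ) i))).analyticAt z
    have h3 := (hf _ _ h1).comp_of_eq h2 rfl
    exact (analyticAt_pi_iff.1 (h3.congr (Filter.Eventually.of_forall fun z =>
      (hξ u j z).symm))) l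
  · intro σ hσ hσU z hz
    have h1 := h σ hσ hσU (fun i v => z i (name i (σ (v d₀))) (mask i v)) (fun i v v' hv => ?_)
      fun i v => ?_
    · simp_rw [hup'] at h1
      simp_rw [hξ]
      exact h1
    · have h1 : mask i v = mask i v' := by
        funext d
        by_cases hd : d ∈ J i <;> simp [mask, hd, hv]
      have h2 : name i (σ (v d₀)) = name i (σ (v' d₀)) := by
        by_cases hd : d₀ ∈ J i
        · simp [name, hd, hv d₀ hd]
        · simp [name, hd]
      simp only [h1, h2]
    · rw [hup']
      exact hnear hz _ _ _
  · intro u hu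
    have h1 := hU u hu
    simp only [ChartRel] at h1
    push Not at h1
    obtain ⟨y, hy, hyY, hp⟩ := h1
    simp only [hup'] at hyY hp
    refine ⟨fun i o v => if o = name i u then y i v else z₀ i o v, ?_, ?_⟩
    · rw [hball]
      intro i o v
      by_cases ho : o = name i u
      · subst ho
        simpa [hz₀name] using hyY i v
      · simpa [ho] using hδ
    · intro hcon
      refine hp ?_
      simp only [hξ, if_true] at hcon
      convert hcon using 4 with j i
      exact hy i _ _ fun d hd => by simp [mask, hd]

/-- A finite grid of nondegenerate zeros with generic certificates forces an arrangement. -/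
theorem GoodArr.of_certGrid {F : Type} [Field F] [Algebra F ℝ] {k n e r K : ℕ}
    {p : MvPolynomial (Fin k × Fin n) F} {P : Fin k → Fin e → Fin k} (hP : Function.Injective P)
    {J : Fin r → Finset (Fin e)} (hJ : ∀ d, ∃ i, d ∈ J i)
    {m : Fin n → MvPolynomial (Option (Fin r)) F}
    {Y : Fin r → (Fin e → Fin K) → ℝ} (hY : DependsOnCoords J Y) {X : (Fin e → Fin K) → Fin n → ℝ}
    (h0 : ∀ a l, MvPolynomial.aeval (fun o => o.elim (X a l) fun i => Y i a) (m l) = 0)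
    (hd : ∀ a l, MvPolynomial.aeval (fun o => o.elim (X a l) fun i => Y i a)
      (MvPolynomial.pderiv none (m l)) ≠ 0)
    (hdep : ∀ a i, ∃ l, ∃ z : ℝ, MvPolynomial.aeval
      (fun o => o.elim (X a l) (Function.update (fun i => Y i a) i z)) (m l) ≠ 0)
    (hK : gridBound e k (k * p.support.card) e ≤ K)
    (hq : ∀ β : Fin e → Fin k → Fin K, (∀ d, Function.Injective (β d)) →
      ∃ q : MvPolynomial (((Fin e → Fin K) × Fin n) ⊕ (Fin r × (Fin e → Fin K))) F,
      MvPolynomial.aeval (Sum.elim (fun v => X v.1 v.2) (fun v => Y v.1 v.2)) q ≠ 0 ∧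
      ∀ (X' : (Fin e → Fin K) → Fin n → ℝ) (Y' : Fin r → (Fin e → Fin K) → ℝ),
        DependsOnCoords J Y' →
        (∀ a l, MvPolynomial.aeval (fun o => o.elim (X' a l) fun i => Y' i a) (m l) = 0) →
        MvPolynomial.aeval (Sum.elim (fun v => X' v.1 v.2) (fun v => Y' v.1 v.2)) q ≠ 0 →
        polyRel p fun j => X' fun d => β d (P j d)) :
    GoodArr (polyRel (R := ℝ) p) e := by
  classical
  have hch (a) := exists_analytic_chart (h0 a) (hd a) (hdep a)
  choose f ε hε hf using hch
  have hq' : ∀ b : {β : Fin e → Fin k → Fin K // ∀ d, Function.Injective (β d)}, _ :=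
    fun b => hq b.1 b.2
  choose q hq0 hq1 using hq'
  obtain ⟨δ, hδ, hδε, hδq⟩ := eventually_small_charts hε
    (fun a => (hf a (ε a) (hε a) le_rfl).1) (fun a => (hf a (ε a) (hε a) le_rfl).2.1) q hq0
  have hfδ (a) := hf a δ hδ (hδε a)
  obtain ⟨a, ha⟩ := exists_diagonal_of_gridBound_le hK (ChartRel p P J Y f δ)
    (fun β hβ => chartRel_of_injective hY hδ hβ fun Y' hY' hnear =>
      hq1 ⟨β, hβ⟩ (fun a => f a fun i => Y' i a) Y' hY'
        (fun a l => (hfδ a).2.2.1 _ ((mem_ball_pi_real hδ).2 fun i => hnear i a) l)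
        (hδq ⟨β, hβ⟩ Y' hnear))
    fun d₀ β U h1 h2 => card_not_chartRel_le hY hδ (fun a => (hfδ a).1) d₀ β U h1 h2
  choose ι hι using hJ
  let enc (i : Fin r) (v : Fin e → Fin k) : ℕ :=
    Encodable.encode fun d : Fin e => if d ∈ J i then some (v d) else none
  have henc {i v v'} (h : enc i v = enc i v') : ∀ d ∈ J i, v d = v' d := by
    intro d hd
    have := congrFun (Encodable.encode_injective h) d
    simpa [hd] using this
  have henc' {i v v'} (h : ∀ d ∈ J i, v d = v' d) : enc i v = enc i v' := by
    simp only [enc]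
    congr 1
    funext d
    by_cases hd : d ∈ J i
    · simp [hd, h d hd]
    · simp [hd]
  have hgood := GoodArr.of_analytic (Z := polyRel (R := ℝ) p) hδ (hfδ a).1
    (fun j i => enc i (P j)) (Finset.univ.image ι)
    (fun j j' h => hP (funext fun d => henc (h (ι d) (Finset.mem_image_of_mem _
      (Finset.mem_univ d))) d (hι d)))
    (fun i _ => (hfδ a).2.2.2.2 i) fun y hy => by
      have := ha (fun i v => y i (enc i v)) (fun i v v' h => by simp only [henc' h])
        fun i v => hy i _
      exact this
  exact hgood.mono (Finset.card_image_le.trans (by simp))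

/-- Erasing the coordinates outside `J`. -/
def maskFun {e K : ℕ} (J : Finset (Fin e)) (a : Fin e → Fin K) : Fin e → Fin K :=
  fun d => if d ∈ J then a d else ⟨0, (Nat.zero_le _).trans_lt (a d).2⟩

theorem maskFun_eq_iff {e K : ℕ} {J : Finset (Fin e)} {a a' : Fin e → Fin K} :
    maskFun J a = maskFun J a' ↔ ∀ d ∈ J, a d = a' d := by
  constructor
  · intro h d hd
    have := congrFun h d
    simpa [maskFun, hd] using this
  · intro h
    funext d
    by_cases hd : d ∈ J
    · simp [maskFun, hd, h d hd]
    · simp [maskFun, hd]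

theorem maskFun_maskFun {e K : ℕ} (J : Finset (Fin e)) (a : Fin e → Fin K) :
    maskFun J (maskFun J a) = maskFun J a :=
  maskFun_eq_iff.2 fun d hd => by simp [maskFun, hd]

/-- The ideal of relations between the coordinates of a grid of points and their
shared parameters. -/
noncomputable def gridIdeal {F : Type} [Field F] {e r n : ℕ} (K : ℕ) (J : Fin r → Finset (Fin e))
    (m : Fin n → MvPolynomial (Option (Fin r)) F) :
    Ideal (MvPolynomial (((Fin e → Fin K) × Fin n) ⊕ (Fin r × (Fin e → Fin K))) F) :=
  Ideal.span (Set.range fun v : (Fin e → Fin K) × Fin n =>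
    MvPolynomial.rename (fun o : Option (Fin r) =>
      o.elim (Sum.inl v) fun i => Sum.inr (i, maskFun (J i) v.1)) (m v.2))

/-- The polynomial `p` evaluated at the coordinates of the grid points `b j`. -/
noncomputable def gridPoly {F : Type} [Field F] {k e n : ℕ} {K : ℕ} (r : ℕ)
    (p : MvPolynomial (Fin k × Fin n) F) (b : Fin k → Fin e → Fin K) :
    MvPolynomial (((Fin e → Fin K) × Fin n) ⊕ (Fin r × (Fin e → Fin K))) F :=
  MvPolynomial.rename (fun v => Sum.inl (b v.1, v.2)) p

theorem exists_natCast_aeval_update_ne_zero {F G : Type} [Field F] [Field G] [CharZero F]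
    [Algebra F G] {r : ℕ} {m : MvPolynomial (Option (Fin r)) F} {x z : G}
    {t : Fin r → G} {i : Fin r}
    (h : MvPolynomial.aeval (fun o => o.elim x (Function.update t i z)) m ≠ 0) :
    ∃ w : ℕ, MvPolynomial.aeval (fun o => o.elim x (Function.update t i (w : G))) m ≠ 0 := by
  classical
  have : CharZero G := charZero_of_injective_algebraMap (algebraMap F G).injective
  let g : MvPolynomial (Option (Fin r)) F →ₐ[F] Polynomial G := MvPolynomial.aeval fun o =>
    o.elim (Polynomial.C x) (Function.update (fun i => Polynomial.C (t i)) i Polynomial.X)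
  have hg (w : G) : Polynomial.eval w (g m) =
      MvPolynomial.aeval (fun o => o.elim x (Function.update t i w)) m := by
    have : ((Polynomial.aeval w).restrictScalars F).comp g = MvPolynomial.aeval
        (fun o => o.elim x (Function.update t i w)) := by
      refine MvPolynomial.algHom_ext fun o => ?_
      cases o with
      | none => simp [g]
      | some j => by_cases hj : j = i <;> simp [g, hj, Function.update_of_ne]
    rw [← this]
    simp
  have hne : g m ≠ 0 := fun h0 => h (by rw [← hg, h0, Polynomial.eval_zero])
  by_contra hcon
  push Not at hcon
  refine hne (Polynomial.eq_zero_of_infinite_isRoot _ ?_)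
  refine Set.Infinite.mono ?_ (Set.infinite_range_of_injective (Nat.cast_injective (R := G)))
  rintro _ ⟨w, rfl⟩
  exact (hg w).trans (hcon w)

theorem card_le_prod_natDegree {F G : Type} [Field F] [Field G] [Algebra F G] {r n : ℕ}
    {m : Fin n → MvPolynomial (Option (Fin r)) F} {t : Fin r → G} {ι : Type} [Fintype ι]
    {x : ι → Fin n → G} (hx : Function.Injective x)
    (h0 : ∀ w l, MvPolynomial.aeval (fun o => o.elim (x w l) t) (m l) = 0)
    (hd : ∀ w l,
      MvPolynomial.aeval (fun o => o.elim (x w l) t) (MvPolynomial.pderiv none (m l)) ≠ 0) :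
    Fintype.card ι ≤ ∏ l, (MvPolynomial.optionEquivLeft F (Fin r) (m l)).natDegree ∨
      Fintype.card ι = 0 := by
  classical
  rcases isEmpty_or_nonempty ι with hι | ⟨⟨w₀⟩⟩
  · exact Or.inr (Fintype.card_eq_zero)
  left
  let f (l : Fin n) : Polynomial G := (MvPolynomial.optionEquivLeft F (Fin r) (m l)).map
    (MvPolynomial.aeval t : MvPolynomial (Fin r) F →ₐ[F] G).toRingHom
  have hf (l y) : (f l).eval y = MvPolynomial.aeval (fun o => o.elim y t) (m l) := by
    rw [aeval_optionEquivLeft, Polynomial.eval_map]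
  have hne (l) : f l ≠ 0 := by
    intro h
    refine hd w₀ l ?_
    rw [aeval_optionEquivLeft, optionEquivLeft_pderiv_none, Polynomial.eval₂_eq_eval_map,
      ← Polynomial.derivative_map]
    simp only [f] at h
    rw [h]
    simp
  have hmaps : ∀ w ∈ (Finset.univ : Finset ι),
      x w ∈ Fintype.piFinset fun l => (f l).roots.toFinset := by
    intro w _
    rw [Fintype.mem_piFinset]
    intro l
    rw [Multiset.mem_toFinset, Polynomial.mem_roots (hne l)]
    exact (hf l _).trans (h0 w l)
  refine (Finset.card_le_card_of_injOn x hmaps hx.injOn).trans ?_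
  rw [Fintype.card_piFinset]
  refine Finset.prod_le_prod' fun l _ => ?_
  exact (Multiset.toFinset_card_le _).trans
    ((Polynomial.card_roots' _).trans Polynomial.natDegree_map_le)

theorem gridPoly_eq_rename {F : Type} [Field F] {k e n r : ℕ} {K : ℕ} {Θ : Type}
    (p : MvPolynomial (Fin k × Fin n) F) (b : Fin k → Fin e → Fin K)
    (φ : ((Fin e → Fin K) × Fin n) ⊕ Θ → ((Fin e → Fin K) × Fin n) ⊕ (Fin r × (Fin e → Fin K)))
    (hφ : ∀ v, φ (Sum.inl v) = Sum.inl v) :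
    gridPoly r p b = MvPolynomial.rename φ (MvPolynomial.rename Sum.inl
      (MvPolynomial.rename (fun v => (b v.1, v.2)) p)) := by
  rw [MvPolynomial.rename_rename, MvPolynomial.rename_rename, gridPoly]
  congr 2
  funext v
  exact (hφ _).symm

theorem rename_mem_gridIdeal {F : Type} [Field F] {e n r : ℕ} {K : ℕ} {Θ : Type}
    {J : Fin r → Finset (Fin e)} {m : Fin n → MvPolynomial (Option (Fin r)) F}
    {v : Θ → Fin r × (Fin e → Fin K)} {ν : Fin r → (Fin e → Fin K) → Θ}
    (hν : ∀ i a, v (ν i a) = (i, maskFun (J i) a))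
    {Q : MvPolynomial (((Fin e → Fin K) × Fin n) ⊕ Θ) F}
    (hQ : Q ∈ Ideal.span (Set.range fun s : (Fin e → Fin K) × Fin n =>
      MvPolynomial.rename (fun o : Option Θ => o.elim (Sum.inl s) Sum.inr)
        (MvPolynomial.rename (Option.map fun i => ν i s.1) (m s.2)))) :
    MvPolynomial.rename (Sum.map id v) Q ∈ gridIdeal K J m := by
  have h1 := Ideal.mem_map_of_mem (MvPolynomial.rename (R := F) (Sum.map id v)) hQ
  rw [Ideal.map_span, ← Set.range_comp] at h1
  refine (Ideal.span_mono ?_ : _ ≤ gridIdeal K J m) h1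
  rintro _ ⟨s, rfl⟩
  refine ⟨s, ?_⟩
  simp only [Function.comp, MvPolynomial.rename_rename]
  congr 2
  funext o
  cases o with
  | none => rfl
  | some i => simp [hν]

theorem exists_certificate_of_algebraicIndependent {F G : Type} [Field F] [Field G] [Algebra F G]
    {k e n r K : ℕ} {p : MvPolynomial (Fin k × Fin n) F} {J : Fin r → Finset (Fin e)}
    {m : Fin n → MvPolynomial (Option (Fin r)) F} {T : Fin r → (Fin e → Fin K) → G}
    {X : (Fin e → Fin K) → Fin n → G}
    {s : Set G} (hs : AlgebraicIndependent F ((↑) : s → G)) (hTs : ∀ i a, T i a ∈ s)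
    (hTJ : ∀ i i' a a', T i a = T i' a' → i = i' ∧ ∀ d ∈ J i, a d = a' d)
    (hm : ∀ l, m l ≠ 0) (b : Fin k → Fin e → Fin K) (hp : polyRel p fun j => X (b j)) :
    ∃ q ι, MvPolynomial.aeval (Sum.elim (fun v => X v.1 v.2)
        fun v => T v.1 (maskFun (J v.1) v.2)) q ≠ 0 ∧
      gridPoly r p b ^ ι * q ∈ gridIdeal K J m := by
  have hT : AlgebraicIndependent F fun v : {v : Fin r × (Fin e → Fin K) //
      maskFun (J v.1) v.2 = v.2} => T v.1.1 v.1.2 := by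
    refine hs.comp (fun v : {v : Fin r × (Fin e → Fin K) // maskFun (J v.1) v.2 = v.2} =>
      (⟨T v.1.1 v.1.2, hTs _ _⟩ : s)) ?_
    rintro ⟨⟨i, a⟩, hv⟩ ⟨⟨i', a'⟩, hv'⟩ h
    obtain ⟨h1, h2⟩ := hTJ _ _ _ _ (congrArg Subtype.val h)
    dsimp only at hv hv' h1 h2
    subst h1
    have : a = a' := by
      rw [← hv, ← hv', maskFun_eq_iff]
      exact h2
    subst this
    rfl
  obtain ⟨Θ, v, ν, hν, hT⟩ : ∃ (Θ : Type) (v : Θ → Fin r × (Fin e → Fin K))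
      (ν : Fin r → (Fin e → Fin K) → Θ), (∀ i a, v (ν i a) = (i, maskFun (J i) a)) ∧
      AlgebraicIndependent F (fun θ => T (v θ).1 (v θ).2) ∧ (∀ i i' a, ν i a = ν i' a → i = i') ∧
      ∀ θ, maskFun (J (v θ).1) (v θ).2 = (v θ).2 :=
    ⟨_, Subtype.val, fun i a => ⟨(i, maskFun (J i) a), maskFun_maskFun _ _⟩, fun _ _ => rfl, hT,
      fun i i' a h => congrArg (fun θ => θ.1.1) h, fun θ => θ.2⟩
  obtain ⟨hT, hinj, hmask⟩ := hT
  obtain ⟨q, ι, hq, hI⟩ := exists_generic_certificate hT (fun s => X s.1 s.2)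
    (fun s : (Fin e → Fin K) × Fin n => MvPolynomial.rename (Option.map fun i => ν i s.1) (m s.2))
    (fun s => (map_ne_zero_iff _ (MvPolynomial.rename_injective _ (Option.map_injective
      fun i i' h => hinj i i' _ h))).2 (hm _))
    (MvPolynomial.rename (fun v => (b v.1, v.2)) p) (by
      rw [MvPolynomial.aeval_rename]
      exact hp)
  refine ⟨MvPolynomial.rename (Sum.map id v) q, ι, ?_, ?_⟩
  · rw [MvPolynomial.aeval_rename]
    convert hq using 2
    congr 1
    funext w
    rcases w with w | w
    · rfl
    · simp [hmask]
  · rw [gridPoly_eq_rename _ _ (Sum.map id v) fun _ => rfl, ← map_pow, ← map_mul]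
    exact rename_mem_gridIdeal hν hI

theorem exists_cert_grid {F G Ω : Type} [Field F] [Field G] [CharZero F] [Countable F]
    [Algebra F G] {k n e : ℕ} (hk : 0 < k) (hle : Order.succ^[e] ℵ₀ ≤ #Ω)
    {p : MvPolynomial (Fin k × Fin n) F}
    {P : Fin k → Fin e → Fin k} {x : (Fin e → Ω) → Fin n → G} (hx : Function.Injective x)
    (hrel : ∀ β : Fin e → Fin k → Ω, polyRel p fun j => x fun d => β d (P j d)) (K : ℕ) :
    ∃ (r : ℕ) (J : Fin r → Finset (Fin e)) (m : Fin n → MvPolynomial (Option (Fin r)) F)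
      (α : Fin e → Fin K → Ω) (bY : Fin r → (Fin e → Fin K) → (Fin e → Ω) × Fin n),
      (∀ d, ∃ i, d ∈ J i) ∧ DependsOnCoords J bY ∧
      (∀ a l, MvPolynomial.aeval (fun o => o.elim (x (fun d => α d (a d)) l)
        fun i => x (bY i a).1 (bY i a).2) (m l) = 0) ∧
      (∀ a l, MvPolynomial.aeval (fun o => o.elim (x (fun d => α d (a d)) l)
        fun i => x (bY i a).1 (bY i a).2) (MvPolynomial.pderiv none (m l)) ≠ 0) ∧
      (∀ a i, ∃ l, ∃ z : ℕ, MvPolynomial.aeval (fun o => o.elim (x (fun d => α d (a d)) l)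
        (Function.update (fun i => x (bY i a).1 (bY i a).2) i (z : G))) (m l) ≠ 0) ∧
      ∀ β : Fin e → Fin k → Fin K, ∃ q ι,
        MvPolynomial.aeval (Sum.elim (fun v => x (fun d => α d (v.1 d)) v.2)
          fun v => x (bY v.1 v.2).1 (bY v.1 v.2).2) q ≠ 0 ∧
        gridPoly r p (fun j d => β d (P j d)) ^ ι * q ∈ gridIdeal K J m := by
  classical
  let S : Set G := Set.range fun v : (Fin e → Ω) × Fin n => x v.1 v.2
  obtain ⟨s, -, hs⟩ := exists_maximal_algebraicIndependent (R := F) (∅ : Set G) S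
    (Set.empty_subset _) (algebraicIndependent_empty_type_iff.2 (algebraMap F G).injective :
      AlgebraicIndependent F ((↑) : (∅ : Set G) → G))
  have hsi : AlgebraicIndependent F ((↑) : s → G) := hs.prop.1
  have hsS : s ⊆ S := hs.prop.2
  have hdep (b : Fin e → Ω) (l : Fin n) : ∃ Q : MvPolynomial (Option s) F, Q ≠ 0 ∧
      MvPolynomial.aeval (fun o => o.elim (x b l) (↑)) Q = 0 := by
    by_contra hcon
    push Not at hcon
    have hai : AlgebraicIndependent F (fun o : Option s => o.elim (x b l) (fun y => (y : G))) := by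
      rw [algebraicIndependent_iff]
      intro Q hQ
      by_contra h0
      exact hcon Q h0 hQ
    have hrange : Set.range (fun o : Option s => o.elim (x b l) (fun y => (y : G))) =
        insert (x b l) s := by
      ext y
      constructor
      · rintro ⟨o, rfl⟩
        cases o with
        | none => exact Set.mem_insert _ _
        | some y => exact Set.mem_insert_of_mem _ y.2
      · rintro (rfl | hy)
        · exact ⟨none, rfl⟩
        · exact ⟨some ⟨y, hy⟩, rfl⟩
    have h1 : AlgebraicIndependent F ((↑) : (insert (x b l) s : Set G) → G) := by
      have := hai.coe_range
      rwa [hrange] at this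
    have h2 : x b l ∈ s := hs.le_of_ge ⟨h1, Set.insert_subset ⟨(b, l), rfl⟩ hsS⟩
      (Set.subset_insert _ _) (Set.mem_insert _ _)
    have h3 : (none : Option s) = some ⟨x b l, h2⟩ := hai.injective rfl
    cases h3
  choose r t m htinj hts hm0 hm hmd hmdep using
    fun b => exists_point_representation hsi (hdep b)
  let C := Σ r : ℕ, Fin n → MvPolynomial (Option (Fin r)) F
  let D (c : C) : ℕ := ∏ l, (MvPolynomial.optionEquivLeft F (Fin c.1) (c.2 l)).natDegree
  have hsub (j : Fin e) : ∃ X : Set Ω, #X = Order.succ^[j.1 + 1] ℵ₀ := by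
    rw [← Cardinal.le_mk_iff_exists_set]
    exact le_trans (Monotone.monotone_iterate_of_le_map Order.succ_mono (Order.le_succ ℵ₀) j.2) hle
  choose X hX using hsub
  have hCount : Countable C := by
    have (r : ℕ) : Countable (MvPolynomial (Option (Fin r)) F) := by
      rw [← Cardinal.mk_le_aleph0_iff]
      exact (MvPolynomial.cardinalMk_le_max).trans (by simp)
    infer_instance
  obtain ⟨⟨r₀, m₀⟩, α, J, hα, -, hcol, hJ⟩ := exists_canonical_grid le_rfl
    (Cardinal.mk_le_aleph0_iff.2 hCount) (fun c : C => c.1) e (fun c => max K (D c + 1 + 1)) X hX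
    (fun b => (⟨r b, m b⟩ : C)) (fun b i => if h : i < r b then t b ⟨i, h⟩ else 0) (by
      intro b _ i hi i' hi' h
      simp only at hi hi'
      rw [dif_pos hi, dif_pos hi'] at h
      exact congrArg Fin.val (htinj b h))
  dsimp only at hcol hJ
  generalize hL : max K (D ⟨r₀, m₀⟩ + 1 + 1) = L at α hα hcol hJ
  have key (b : Fin e → Ω) (c : C) (hc : (⟨r b, m b⟩ : C) = c) : ∃ t' : Fin c.1 → G,
      (∀ i, t' i ∈ s) ∧ (∀ i, t' i = if h : i.1 < r b then t b ⟨i.1, h⟩ else 0) ∧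
      (∀ l, MvPolynomial.aeval (fun o => o.elim (x b l) t') (c.2 l) = 0) ∧
      (∀ l, MvPolynomial.aeval (fun o => o.elim (x b l) t') (MvPolynomial.pderiv none (c.2 l)) ≠ 0)
      ∧ (∀ l, c.2 l ≠ 0) ∧
      ∀ i, ∃ l, ∃ z : G,
        MvPolynomial.aeval (fun o => o.elim (x b l) (Function.update t' i z)) (c.2 l) ≠ 0 := by
    subst hc
    exact ⟨t b, hts b, fun i => by simp, hm b, hmd b, hm0 b, hmdep b⟩
  choose t' ht's ht'eq ht'0 ht'd hm₀ ht'dep using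
    fun a : Fin e → Fin L => key (fun j => α j (a j)) ⟨r₀, m₀⟩ (hcol a)
  dsimp only at t' ht's ht'eq ht'0 ht'd hm₀ ht'dep
  have ht'J (i i' a a') : t' a i = t' a' i' ↔ i = i' ∧ ∀ j ∈ J i.1, a j = a' j := by
    rw [ht'eq, ht'eq, hJ i i.2 i' i'.2 a a', Fin.ext_iff]
  have hLD : D ⟨r₀, m₀⟩ + 1 + 1 ≤ L := hL ▸ le_max_right _ _
  have hcov (d : Fin e) : ∃ i : Fin r₀, d ∈ J i.1 := by
    by_contra hcon
    push Not at hcon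
    let a₀ : Fin e → Fin L := fun _ => ⟨0, by omega⟩
    let a (w : Fin L) : Fin e → Fin L := Function.update a₀ d w
    have hta (w) : t' (a w) = t' a₀ := by
      funext i
      rw [ht'J]
      refine ⟨rfl, fun j hj => ?_⟩
      have : j ≠ d := fun h => hcon i (h ▸ hj)
      simp [a, this]
    have hinj : Function.Injective fun w => x fun j => α j (a w j) := by
      intro w w' h
      have := congrFun (hx h) d
      simp only [a, Function.update_self] at this
      exact hα d this
    rcases card_le_prod_natDegree (m := m₀) (t := t' a₀) hinj
      (fun w l => by rw [← hta w]; exact ht'0 _ l)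
      (fun w l => by rw [← hta w]; exact ht'd _ l) with h | h
    · rw [Fintype.card_fin] at h
      have : L ≤ D ⟨r₀, m₀⟩ := h
      omega
    · rw [Fintype.card_fin] at h
      omega
  have hKL : K ≤ L := hL ▸ le_max_left _ _
  let up (a : Fin e → Fin K) : Fin e → Fin L := fun d => Fin.castLE hKL (a d)
  have hex (i : Fin r₀) (a : Fin e → Fin K) : ∃ v : (Fin e → Ω) × Fin n,
      x v.1 v.2 = t' (up (maskFun (J i) a)) i := hsS (ht's _ i)
  choose bY hbY using hex
  have hY (a : Fin e → Fin K) (i : Fin r₀) : x (bY i (maskFun (J i) a)).1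
      (bY i (maskFun (J i) a)).2 = t' (up a) i := by
    rw [hbY, maskFun_maskFun, ht'J]
    exact ⟨rfl, fun j hj => by simp [up, maskFun, hj]⟩
  refine ⟨r₀, fun i => J i, m₀, fun d w => α d (Fin.castLE hKL w),
    fun i a => bY i (maskFun (J i) a),
    hcov, fun i a a' h => by simp only [maskFun_eq_iff.2 h], ?_, ?_, ?_, ?_⟩
  · intro a l
    simp only [hY]
    exact ht'0 (up a) l
  · intro a l
    simp only [hY]
    exact ht'd (up a) l
  · intro a i
    simp only [hY]
    obtain ⟨l, z, hz⟩ := ht'dep (up a) i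
    exact ⟨l, exists_natCast_aeval_update_ne_zero hz⟩
  intro β
  obtain ⟨q, ι, hq, hI⟩ := exists_certificate_of_algebraicIndependent
    (T := fun i a => t' (up a) i) (X := fun a => x (fun d => α d (Fin.castLE hKL (a d))))
    hsi (fun i a => ht's _ _) (fun i i' a a' h => by
      obtain ⟨h1, h2⟩ := (ht'J _ _ _ _).1 h
      exact ⟨h1, fun d hd => Fin.castLE_injective hKL (h2 d hd)⟩)
    (hm₀ (up fun d => β d (P ⟨0, hk⟩ d))) (fun j d => β d (P j d))
    (hrel fun d w => α d (Fin.castLE hKL (β d w)))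
  refine ⟨q, ι, ?_, hI⟩
  convert hq using 4
  exact funext fun v => (hbY _ _).trans (by rw [maskFun_maskFun])

/-- Germs along a nonprincipal ultrafilter on `ℕ`, as a field extension. -/
abbrev Ultrapower (R : Type) : Type := Filter.Germ (Filter.hyperfilter ℕ : Filter ℕ) R

/-- The algebra structure of an ultrapower. -/
@[reducible]
noncomputable def ultrapowerAlgebra (F R : Type) [Field F] [Field R] [Algebra F R] :
    Algebra F (Ultrapower R) :=
  ((Filter.Germ.coeRingHom (Filter.hyperfilter ℕ : Filter ℕ)).comp
    (algebraMap F (ℕ → R))).toAlgebra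

attribute [local instance] ultrapowerAlgebra

theorem aeval_ultrapower {F R σ : Type} [Field F] [Field R] [Algebra F R]
    (m : MvPolynomial σ F) (v : σ → ℕ → R) {w : σ → Ultrapower R}
    (hw : ∀ i, w i = (v i : Ultrapower R)) :
    MvPolynomial.aeval w m =
      ((fun N => MvPolynomial.aeval (fun i => v i N) m : ℕ → R) : Ultrapower R) := by
  obtain rfl : w = fun i => (v i : Ultrapower R) := funext hw
  induction m using MvPolynomial.induction_on with
  | C a => simp only [MvPolynomial.aeval_C]; rfl
  | add p q hp hq => simp only [map_add, hp, hq]; rfl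
  | mul_X p i hp => simp only [map_mul, hp, MvPolynomial.aeval_X]; rfl

theorem aeval_ultrapower_eq_zero_iff {F R σ : Type} [Field F] [Field R] [Algebra F R]
    (m : MvPolynomial σ F) (v : σ → ℕ → R) {w : σ → Ultrapower R}
    (hw : ∀ i, w i = (v i : Ultrapower R)) :
    MvPolynomial.aeval w m = 0 ↔
      ∀ᶠ N in (Filter.hyperfilter ℕ : Filter ℕ), MvPolynomial.aeval (fun i => v i N) m = 0 := by
  rw [aeval_ultrapower m v hw]
  exact Filter.Germ.coe_eq

theorem aeval_option_ultrapower_eq_zero_iff {F R : Type} [Field F] [Field R] [Algebra F R] {r : ℕ}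
    (m : MvPolynomial (Option (Fin r)) F) (u : ℕ → R) (t : Fin r → ℕ → R) :
    MvPolynomial.aeval (fun o => o.elim (u : Ultrapower R) fun i => (t i : Ultrapower R)) m = 0 ↔
      ∀ᶠ N in (Filter.hyperfilter ℕ : Filter ℕ),
        MvPolynomial.aeval (fun o => o.elim (u N) fun i => t i N) m = 0 := by
  rw [aeval_ultrapower_eq_zero_iff m (fun o N => o.elim (u N) fun i => t i N)]
  rintro (_ | _) <;> rfl

theorem aeval_update_ultrapower_eq_zero_iff {F R : Type} [Field F] [Field R] [Algebra F R] {r : ℕ}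
    (m : MvPolynomial (Option (Fin r)) F) (u : ℕ → R) (t : Fin r → ℕ → R) (i : Fin r) (z : ℕ) :
    MvPolynomial.aeval (fun o => o.elim (u : Ultrapower R)
        (Function.update (fun i => (t i : Ultrapower R)) i (z : Ultrapower R))) m = 0 ↔
      ∀ᶠ N in (Filter.hyperfilter ℕ : Filter ℕ),
        MvPolynomial.aeval (fun o => o.elim (u N) (Function.update (fun i => t i N) i (z : R))) m
          = 0 := by
  rw [aeval_ultrapower_eq_zero_iff m
    (fun o N => o.elim (u N) (Function.update (fun i => t i N) i (z : R)))]
  rintro (_ | j)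
  · rfl
  · by_cases hj : j = i
    · subst hj
      simp only [Option.elim, Function.update_self]
      rfl
    · simp only [Option.elim, Function.update_of_ne hj]

theorem aeval_sum_ultrapower_eq_zero_iff {F R : Type} [Field F] [Field R] [Algebra F R] {S T : Type}
    (m : MvPolynomial (S ⊕ T) F) (u : S → ℕ → R) (t : T → ℕ → R) :
    MvPolynomial.aeval (Sum.elim (fun s => (u s : Ultrapower R)) fun i => (t i : Ultrapower R)) m
        = 0 ↔
      ∀ᶠ N in (Filter.hyperfilter ℕ : Filter ℕ),
        MvPolynomial.aeval (Sum.elim (fun s => u s N) fun i => t i N) m = 0 := by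
  rw [aeval_ultrapower_eq_zero_iff m (fun v N => Sum.elim (fun s => u s N) (fun i => t i N) v)]
  rintro (_ | _) <;> rfl

theorem exists_cert_grid_of_forall_grid {F R : Type} [Field F] [Field R] [CharZero F] [Countable F]
    [Algebra F R] {k n e : ℕ} (hk : 0 < k) (hle : Order.succ^[e] ℵ₀ ≤ (𝔠 : Cardinal.{0}))
    {p : MvPolynomial (Fin k × Fin n) F} {P : Fin k → Fin e → Fin k}
    {x : ∀ q, (Fin e → Fin q) → Fin n → R} (hx : ∀ q, Function.Injective (x q))
    (hrel : ∀ q, ∀ β : Fin e → Fin k → Fin q, polyRel p fun j => x q fun d => β d (P j d)) (K : ℕ) :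
    ∃ (q r : ℕ) (J : Fin r → Finset (Fin e)) (m : Fin n → MvPolynomial (Option (Fin r)) F)
      (bX : (Fin e → Fin K) → Fin e → Fin q)
      (bY : Fin r → (Fin e → Fin K) → (Fin e → Fin q) × Fin n),
      (∀ d, ∃ i, d ∈ J i) ∧ DependsOnCoords J bY ∧
      (∀ a l, MvPolynomial.aeval (fun o => o.elim (x q (bX a) l)
        fun i => x q (bY i a).1 (bY i a).2) (m l) = 0) ∧
      (∀ a l, MvPolynomial.aeval (fun o => o.elim (x q (bX a) l)
        fun i => x q (bY i a).1 (bY i a).2) (MvPolynomial.pderiv none (m l)) ≠ 0) ∧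
      (∀ a i, ∃ l, ∃ z : ℕ, MvPolynomial.aeval (fun o => o.elim (x q (bX a) l)
        (Function.update (fun i => x q (bY i a).1 (bY i a).2) i (z : R))) (m l) ≠ 0) ∧
      ∀ β : Fin e → Fin k → Fin K, ∃ Q ι,
        MvPolynomial.aeval (Sum.elim (fun v => x q (bX v.1) v.2)
          fun v => x q (bY v.1 v.2).1 (bY v.1 v.2).2) Q ≠ 0 ∧
        gridPoly r p (fun j d => β d (P j d)) ^ ι * Q ∈ gridIdeal K J m := by
  classical
  let cod (N : ℕ) (b : ℕ → Bool) : Fin (2 ^ N) :=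
    Fintype.equivFinOfCardEq (α := Fin N → Bool) (by simp) fun i => b i
  obtain ⟨y, hy⟩ : ∃ y : (Fin e → ℕ → Bool) → Fin n → ℕ → R,
      ∀ b l N, y b l N = x (2 ^ N) (fun d => cod N (b d)) l := ⟨_, fun _ _ _ => rfl⟩
  obtain ⟨y', hy'⟩ : ∃ y' : (Fin e → ℕ → Bool) → Fin n → Ultrapower R,
      ∀ b l, y' b l = (y b l : Ultrapower R) := ⟨_, fun _ _ => rfl⟩
  have hinj : Function.Injective y' := by
    intro b b' h
    funext d i
    have h1 : ∀ᶠ N in (Filter.hyperfilter ℕ : Filter ℕ), ∀ l, y b l N = y b' l N :=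
      Filter.eventually_all.2 fun l =>
        Filter.Germ.coe_eq.1 (by simpa only [hy'] using congrFun h l)
    have h2 : ∀ᶠ N in (Filter.hyperfilter ℕ : Filter ℕ), i < N :=
      (Filter.hyperfilter_le_cofinite.trans Nat.cofinite_eq_atTop.le) (Filter.eventually_gt_atTop i)
    obtain ⟨N, hN, hiN⟩ := (h1.and h2).exists
    have h3 := congrFun (hx _ (funext fun l => by simpa only [hy] using hN l)) d
    exact congrFun ((Fintype.equivFinOfCardEq _).injective h3) ⟨i, hiN⟩
  have hrel' : ∀ β : Fin e → Fin k → ℕ → Bool, polyRel p fun j => y' fun d => β d (P j d) := by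
    intro β
    refine (aeval_ultrapower_eq_zero_iff p (fun v => y (fun d => β d (P v.1 d)) v.2)
      fun _ => hy' _ _).2 (Filter.Eventually.of_forall fun N => ?_)
    simp only [hy]
    exact hrel (2 ^ N) fun d j => cod N (β d j)
  obtain ⟨r, J, m, α, bY, hJ, hbY, h0, hd, hdep, hcert⟩ :=
    exists_cert_grid hk (by simpa using hle) hinj hrel' K
  choose ld zd hdep using hdep
  choose Q ι hQ hI using hcert
  simp only [hy', aeval_option_ultrapower_eq_zero_iff] at h0
  simp only [hy', ne_eq, aeval_option_ultrapower_eq_zero_iff, ← Ultrafilter.eventually_not] at hd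
  simp only [hy', ne_eq, aeval_update_ultrapower_eq_zero_iff, ← Ultrafilter.eventually_not] at hdep
  simp only [hy', ne_eq, aeval_sum_ultrapower_eq_zero_iff, ← Ultrafilter.eventually_not] at hQ
  simp only [← Filter.eventually_all] at h0 hd hdep hQ
  obtain ⟨N, ⟨⟨h0, hd⟩, hdep⟩, hQ⟩ := (((h0.and hd).and hdep).and hQ).exists
  simp only [hy] at h0 hd hdep hQ
  exact ⟨2 ^ N, r, J, m, fun a d => cod N (α d (a d)),
    fun i a => (fun d => cod N ((bY i a).1 d), (bY i a).2), hJ,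
    fun i a a' h => by simp only [hbY i a a' h], h0, hd,
    fun a i => ⟨ld a i, zd a i, hdep a i⟩, fun β => ⟨Q β, ι β, hQ β, hI β⟩⟩

/-! ### Numerical codes of terms and of integer polynomials -/

/-- The code of the variable `i`. -/
def tvar (i : ℕ) : ℕ := Nat.pair 0 i

/-- The code of the constant `0`. -/
def tzero : ℕ := Nat.pair 1 0

/-- The code of the constant `1`. -/
def tone : ℕ := Nat.pair 2 0

/-- The code of a sum. -/
def tadd (s t : ℕ) : ℕ := Nat.pair 3 (Nat.pair s t)

/-- The code of a product. -/
def tmul (s t : ℕ) : ℕ := Nat.pair 4 (Nat.pair s t)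

/-- The code of a negative. -/
def tneg (t : ℕ) : ℕ := Nat.pair 5 t

/-- An interpretation of all natural numbers, read as codes of terms, in a ring. -/
structure TermHom {S : Type*} [CommRing S] (h : ℕ → S) : Prop where
  zero : h tzero = 0
  one : h tone = 1
  add : ∀ s t, h (tadd s t) = h s + h t
  mul : ∀ s t, h (tmul s t) = h s * h t
  neg : ∀ t, h (tneg t) = -h t

theorem TermHom.comp {S T : Type*} [CommRing S] [CommRing T] {h : ℕ → S} (hh : TermHom h)
    (f : S →+* T) : TermHom (fun t => f (h t)) where
  zero := by rw [hh.zero, map_zero]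
  one := by rw [hh.one, map_one]
  add s t := by rw [hh.add, map_add]
  mul s t := by rw [hh.mul, map_mul]
  neg t := by rw [hh.neg, map_neg]

/-- The code of a numeral. -/
def tnum : ℕ → ℕ
  | 0 => tzero
  | n + 1 => tadd (tnum n) tone

theorem TermHom.num {S : Type*} [CommRing S] {h : ℕ → S} (hh : TermHom h) (n : ℕ) :
    h (tnum n) = n := by
  induction n with
  | zero => simp [tnum, hh.zero]
  | succ n ih => rw [tnum, hh.add, ih, hh.one, Nat.cast_succ]

/-- Codes of integer polynomials: sums of signed products of indeterminates. -/
abbrev PolyL : Type := List (Bool × List ℕ)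

/-- The value of a coded polynomial under an assignment of its indeterminates. -/
def polyVal {S : Type*} [CommRing S] (σ : ℕ → S) (Q : PolyL) : S :=
  (Q.map fun x => (bif x.1 then 1 else -1) * (x.2.map σ).prod).sum

/-- The code of the term obtained by substituting terms in a coded polynomial. -/
def polyTerm (σ : ℕ → ℕ) (Q : PolyL) : ℕ :=
  Q.foldr (fun x t => tadd (bif x.1 then x.2.foldr (fun i s => tmul (σ i) s) tone
    else tneg (x.2.foldr (fun i s => tmul (σ i) s) tone)) t) tzero

theorem TermHom.polyTerm {S : Type*} [CommRing S] {h : ℕ → S} (hh : TermHom h) (σ : ℕ → ℕ)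
    (Q : PolyL) : h (polyTerm σ Q) = polyVal (fun i => h (σ i)) Q := by
  have hm : ∀ L : List ℕ, h (L.foldr (fun i s => tmul (σ i) s) tone) =
      (L.map fun i => h (σ i)).prod := by
    intro L
    induction L with
    | nil => simpa using hh.one
    | cons i L ih => rw [List.foldr_cons, hh.mul, ih, List.map_cons, List.prod_cons]
  induction Q with
  | nil => simpa [polyVal, _root_.polyTerm] using hh.zero
  | cons x Q ih =>
    have e : _root_.polyTerm σ (x :: Q) = tadd (bif x.1 then
        x.2.foldr (fun i s => tmul (σ i) s) tone
      else tneg (x.2.foldr (fun i s => tmul (σ i) s) tone)) (_root_.polyTerm σ Q) := rfl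
    rw [e, hh.add, ih]
    simp only [polyVal, List.map_cons, List.sum_cons]
    congr 1
    cases x.1 with
    | true => simp [hm]
    | false => simp [hh.neg, hm]

theorem polyVal_nil {S : Type*} [CommRing S] (σ : ℕ → S) : polyVal σ [] = 0 := rfl

theorem polyVal_cons {S : Type*} [CommRing S] (σ : ℕ → S) (x : Bool × List ℕ) (Q : PolyL) :
    polyVal σ (x :: Q) = (bif x.1 then 1 else -1) * (x.2.map σ).prod + polyVal σ Q := by
  simp [polyVal]

theorem polyVal_append {S : Type*} [CommRing S] (σ : ℕ → S) (Q R : PolyL) :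
    polyVal σ (Q ++ R) = polyVal σ Q + polyVal σ R := by
  simp [polyVal]

theorem map_polyVal {S T : Type*} [CommRing S] [CommRing T] (f : S →+* T) (σ : ℕ → S)
    (Q : PolyL) : f (polyVal σ Q) = polyVal (fun i => f (σ i)) Q := by
  induction Q with
  | nil => simp [polyVal_nil]
  | cons x Q ih =>
    rw [polyVal_cons, polyVal_cons, map_add, map_mul, ih, map_list_prod, List.map_map]
    congr 2
    cases x.1 <;> simp

/-- The ring of values of coded polynomials. -/
def polyValSubring {S : Type*} [CommRing S] (σ : ℕ → S) : Subring S where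
  carrier := Set.range (polyVal σ)
  zero_mem' := ⟨[], polyVal_nil σ⟩
  one_mem' := ⟨[(true, [])], by simp [polyVal]⟩
  add_mem' := by
    rintro _ _ ⟨Q, rfl⟩ ⟨R, rfl⟩
    exact ⟨Q ++ R, polyVal_append σ Q R⟩
  neg_mem' := by
    rintro _ ⟨Q, rfl⟩
    refine ⟨Q.map fun x => (!x.1, x.2), ?_⟩
    induction Q with
    | nil => simp [polyVal_nil]
    | cons x Q ih =>
      rw [List.map_cons, polyVal_cons, polyVal_cons, ih]
      cases x.1 <;> simp <;> ring
  mul_mem' := by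
    rintro _ _ ⟨Q, rfl⟩ ⟨R, rfl⟩
    refine ⟨Q.flatMap fun x => R.map fun y => (!(xor x.1 y.1), x.2 ++ y.2), ?_⟩
    induction Q with
    | nil => simp [polyVal_nil]
    | cons x Q ih =>
      rw [List.flatMap_cons, polyVal_append, polyVal_cons, ih, add_mul]
      congr 1
      clear ih
      induction R with
      | nil => simp [polyVal_nil]
      | cons y R ih =>
        rw [List.map_cons, polyVal_cons, polyVal_cons, ih, mul_add, List.map_append,
          List.prod_append]
        cases x.1 <;> cases y.1 <;> simp

open MvPolynomial in
/-- The interpretation of the indeterminates of coded polynomials: `Nat.pair 0 j` is the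
constant `c j`, and `ν v` is the variable `v`. -/
noncomputable def polyVar {τ F : Type*} [CommRing F] (c : ℕ → F) (ν : τ → ℕ) (i : ℕ) :
    MvPolynomial τ F :=
  open scoped Classical in
  if i.unpair.1 = 0 then C (c i.unpair.2) else if h : ∃ v, ν v = i then X h.choose else 0

theorem polyVar_pair_zero {τ F : Type*} [CommRing F] (c : ℕ → F) (ν : τ → ℕ) (j : ℕ) :
    polyVar c ν (Nat.pair 0 j) = MvPolynomial.C (c j) := by
  simp [polyVar]

theorem polyVar_apply {τ F : Type*} [CommRing F] (c : ℕ → F) {ν : τ → ℕ}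
    (hν : Function.Injective ν) (hν0 : ∀ v, (ν v).unpair.1 ≠ 0) (v : τ) :
    polyVar c ν (ν v) = MvPolynomial.X v := by
  have h : ∃ w, ν w = ν v := ⟨v, rfl⟩
  rw [polyVar, if_neg (hν0 v), dif_pos h, hν h.choose_spec]

theorem polyVar_of_forall_ne {τ F : Type*} [CommRing F] (c : ℕ → F) {ν : τ → ℕ} {t j : ℕ}
    (ht : t ≠ 0) (hj : ∀ v, ν v ≠ Nat.pair t j) : polyVar c ν (Nat.pair t j) = 0 := by
  rw [polyVar, if_neg (by simpa using ht), dif_neg (by simpa using hj)]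

theorem TermHom.polyTerm_eq_aeval {S τ F : Type*} [CommRing S] [CommRing F] [Algebra F S]
    {h : ℕ → S} (hh : TermHom h) {c : ℕ → F} {ν : τ → ℕ} (hν : Function.Injective ν)
    (hν0 : ∀ v, (ν v).unpair.1 ≠ 0) {σ : ℕ → ℕ} {w : τ → S}
    (hc : ∀ j, h (σ (Nat.pair 0 j)) = algebraMap F S (c j)) (hw : ∀ v, h (σ (ν v)) = w v)
    (h0 : ∀ t j, t ≠ 0 → (∀ v, ν v ≠ Nat.pair t j) → h (σ (Nat.pair t j)) = 0) (Q : PolyL) :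
    h (_root_.polyTerm σ Q) = MvPolynomial.aeval w (polyVal (polyVar c ν) Q) := by
  have e : (MvPolynomial.aeval w : MvPolynomial τ F →ₐ[F] S) (polyVal (polyVar c ν) Q) =
      polyVal (fun i => MvPolynomial.aeval w (polyVar c ν i)) Q :=
    map_polyVal (MvPolynomial.aeval w : MvPolynomial τ F →ₐ[F] S).toRingHom (polyVar c ν) Q
  rw [hh.polyTerm, e]
  congr 1
  funext i
  obtain ⟨t, j, rfl⟩ : ∃ t j, i = Nat.pair t j := ⟨_, _, (Nat.pair_unpair i).symm⟩
  by_cases ht : t = 0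
  · rw [ht, hc, polyVar_pair_zero, MvPolynomial.aeval_C]
  · by_cases hv : ∃ v, ν v = Nat.pair t j
    · obtain ⟨v, hv⟩ := hv
      rw [← hv, hw, polyVar_apply c hν hν0, MvPolynomial.aeval_X]
    · push Not at hv
      rw [h0 t j ht hv, polyVar_of_forall_ne c ht hv, map_zero]

/-- Over the field generated by the constants `c j`, every polynomial is a coded polynomial
up to a nonzero constant. -/
theorem exists_C_mul_mem_polyValSubring {τ R : Type*} [Field R] {c : ℕ → R} {F : Subfield R}
    (hF : F = Subfield.closure (Set.range c)) (c' : ℕ → F) (hc : ∀ j, (c' j : R) = c j)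
    {ν : τ → ℕ} (hν : Function.Injective ν) (hν0 : ∀ v, (ν v).unpair.1 ≠ 0)
    (f : MvPolynomial τ F) :
    ∃ d : F, d ≠ 0 ∧ MvPolynomial.C d ∈ polyValSubring (polyVar c' ν) ∧
      MvPolynomial.C d * f ∈ polyValSubring (polyVar c' ν) := by
  subst hF
  have hconst : ∀ x ∈ Subring.closure (Set.range c),
      ∃ y : Subfield.closure (Set.range c), (y : R) = x ∧
        MvPolynomial.C (σ := τ) y ∈ polyValSubring (polyVar c' ν) := by
    intro x hx
    induction hx using Subring.closure_induction with
    | mem x hx =>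
      obtain ⟨j, rfl⟩ := hx
      refine ⟨c' j, hc j, [(true, [Nat.pair 0 j])], ?_⟩
      simp [polyVal, polyVar_pair_zero]
    | zero => exact ⟨0, rfl, by rw [map_zero]; exact zero_mem _⟩
    | one => exact ⟨1, rfl, by rw [map_one]; exact one_mem _⟩
    | add x y _ _ hx hy =>
      obtain ⟨x', rfl, hx⟩ := hx
      obtain ⟨y', rfl, hy⟩ := hy
      exact ⟨x' + y', rfl, by rw [map_add]; exact add_mem hx hy⟩
    | neg x _ hx =>
      obtain ⟨x', rfl, hx⟩ := hx
      exact ⟨-x', rfl, by rw [map_neg]; exact neg_mem hx⟩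
    | mul x y _ _ hx hy =>
      obtain ⟨x', rfl, hx⟩ := hx
      obtain ⟨y', rfl, hy⟩ := hy
      exact ⟨x' * y', rfl, by rw [map_mul]; exact mul_mem hx hy⟩
  induction f using MvPolynomial.induction_on with
  | C a =>
    obtain ⟨x, hx, y, hy, hxy⟩ := Subfield.mem_closure_iff.1 a.2
    obtain ⟨x', hx', hxA⟩ := hconst x hx
    obtain ⟨y', hy', hyA⟩ := hconst y hy
    by_cases h0 : y' = 0
    · refine ⟨1, one_ne_zero, by rw [map_one]; exact one_mem _, ?_⟩
      have : a = 0 := by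
        apply Subtype.ext
        rw [← hxy, ← hy', h0]
        simp
      rw [this, map_zero, mul_zero]
      exact zero_mem _
    · refine ⟨y', h0, hyA, ?_⟩
      have : y' * a = x' := by
        apply Subtype.ext
        have h1 : (y' : R) ≠ 0 := by
          intro h
          exact h0 (Subtype.ext h)
        change (y' : R) * (a : R) = x'
        rw [← hxy, hx', ← hy', mul_div_cancel₀ _ h1]
      rw [← map_mul, this]
      exact hxA
  | add f g hf hg =>
    obtain ⟨d, hd, hdA, hf⟩ := hf
    obtain ⟨b, hb, hbA, hg⟩ := hg
    refine ⟨d * b, mul_ne_zero hd hb, by rw [map_mul]; exact mul_mem hdA hbA, ?_⟩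
    have : MvPolynomial.C (d * b) * (f + g) = MvPolynomial.C b * (MvPolynomial.C d * f) +
        MvPolynomial.C d * (MvPolynomial.C b * g) := by
      rw [map_mul]; ring
    rw [this]
    exact add_mem (mul_mem hbA hf) (mul_mem hdA hg)
  | mul_X f v hf =>
    obtain ⟨d, hd, hdA, hf⟩ := hf
    refine ⟨d, hd, hdA, ?_⟩
    rw [← mul_assoc]
    refine mul_mem hf ⟨[(true, [ν v])], ?_⟩
    simp [polyVal, polyVar_apply c' hν hν0]

theorem exists_forall_polyVal_eq_C_mul {τ ι R : Type*} [Finite ι] [Field R] {c : ℕ → R}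
    {F : Subfield R} (hF : F = Subfield.closure (Set.range c)) (c' : ℕ → F)
    (hc : ∀ j, (c' j : R) = c j) {ν : τ → ℕ} (hν : Function.Injective ν)
    (hν0 : ∀ v, (ν v).unpair.1 ≠ 0) (f : ι → MvPolynomial τ F) :
    ∃ d : F, d ≠ 0 ∧ ∀ i, ∃ Q, polyVal (polyVar c' ν) Q = MvPolynomial.C d * f i := by
  classical
  have := Fintype.ofFinite ι
  choose d hd hdA hf using fun i => exists_C_mul_mem_polyValSubring hF c' hc hν hν0 (f i)
  refine ⟨∏ i, d i, Finset.prod_ne_zero_iff.2 fun i _ => hd i, fun i => ?_⟩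
  have h : MvPolynomial.C (∏ i, d i) * f i =
      (∏ j ∈ Finset.univ.erase i, MvPolynomial.C (d j)) * (MvPolynomial.C (d i) * f i) := by
    rw [← mul_assoc, Finset.prod_erase_mul _ _ (Finset.mem_univ i), map_prod]
  change _ ∈ polyValSubring (polyVar c' ν)
  rw [h]
  exact mul_mem (prod_mem fun j _ => hdA j) (hf i)

/-- The derivative of a monomial with respect to the indeterminate `v`. -/
def monoDeriv (v : ℕ) (L : List ℕ) : List (List ℕ) :=
  L.rec [] fun x L D => (bif x == v then [L] else []) ++ D.map (x :: ·)

/-- The derivative of a coded polynomial with respect to the indeterminate `v`. -/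
def polyDeriv (v : ℕ) (Q : PolyL) : PolyL :=
  Q.flatMap fun x => (monoDeriv v x.2).map fun L => (x.1, L)

theorem monoDeriv_cons (v x : ℕ) (L : List ℕ) :
    monoDeriv v (x :: L) = (bif x == v then [L] else []) ++ (monoDeriv v L).map (x :: ·) := rfl

theorem polyVal_polyDeriv {S : Type*} [CommRing S] {A : Type*} [CommRing A] [Algebra A S]
    (D : Derivation A S S) {σ : ℕ → S} {v : ℕ} (h : ∀ i, D (σ i) = if i = v then 1 else 0)
    (Q : PolyL) : polyVal σ (polyDeriv v Q) = D (polyVal σ Q) := by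
  have hm : ∀ L : List ℕ, ((monoDeriv v L).map fun M => (M.map σ).prod).sum =
      D (L.map σ).prod := by
    intro L
    induction L with
    | nil => simp [monoDeriv]
    | cons x L ih =>
      rw [monoDeriv_cons, List.map_append, List.sum_append, List.map_map, List.map_cons,
        List.prod_cons, Derivation.leibniz, h, ← ih, smul_eq_mul, smul_eq_mul, add_comm,
        ← List.sum_map_mul_left]
      congr 1
      by_cases hx : x = v
      · simp [hx]
      · simp [hx, show (x == v) = false from by simpa using hx]
  induction Q with
  | nil => simp [polyVal, polyDeriv]
  | cons x Q ih =>
    have e : polyDeriv v (x :: Q) =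
        (monoDeriv v x.2).map (fun L => (x.1, L)) ++ polyDeriv v Q := rfl
    rw [e, polyVal_append, ih, polyVal_cons, map_add]
    congr 1
    rw [polyVal, List.map_map]
    have e2 : D ((bif x.1 then 1 else -1) * (x.2.map σ).prod) =
        (bif x.1 then 1 else -1) * D (x.2.map σ).prod := by
      cases x.1 <;> simp
    rw [e2, ← hm, ← List.sum_map_mul_left]
    rfl

theorem pderiv_polyVal {τ F : Type*} [CommRing F] (c : ℕ → F) {ν : τ → ℕ}
    (hν : Function.Injective ν) (hν0 : ∀ v, (ν v).unpair.1 ≠ 0) (v : τ) (Q : PolyL) :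
    polyVal (polyVar c ν) (polyDeriv (ν v) Q) =
      MvPolynomial.pderiv v (polyVal (polyVar c ν) Q) := by
  classical
  refine polyVal_polyDeriv (MvPolynomial.pderiv v) (fun i => ?_) Q
  obtain ⟨t, j, rfl⟩ : ∃ t j, i = Nat.pair t j := ⟨_, _, (Nat.pair_unpair i).symm⟩
  by_cases ht : t = 0
  · subst ht
    rw [polyVar_pair_zero, MvPolynomial.pderiv_C, if_neg]
    intro h
    exact hν0 v (by rw [← h]; simp)
  · by_cases hw : ∃ w, ν w = Nat.pair t j
    · obtain ⟨w, hw⟩ := hw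
      rw [← hw, polyVar_apply c hν hν0, MvPolynomial.pderiv_X]
      by_cases h : w = v
      · simp [h]
      · rw [if_neg (fun e => h (hν e)), Pi.single_apply, if_neg h]
    · push Not at hw
      rw [polyVar_of_forall_ne c ht hw, map_zero, if_neg (fun e => hw v e.symm)]

/-! ### Clearing denominators in the code of a rational polynomial -/

/-- The list of indeterminates of a monomial, with repetitions. -/
def monoList (k n l : ℕ) (L : List ℕ) : List ℕ :=
  ((List.range (k * n)).flatMap fun i => List.replicate (L.getD i 0) (Nat.pair 1 i)) ++
    (List.range l).flatMap fun j => List.replicate (L.getD (k * n + j) 0) (Nat.pair 0 j)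

/-- The product of the denominators of the coefficients. -/
def denProd (c : PolyCode) : ℕ := (c.map fun x => x.1.den).prod

/-- The integer polynomial obtained by clearing denominators. -/
def intPoly (k n l : ℕ) (c : PolyCode) : PolyL :=
  c.flatMap fun x => List.replicate (x.1.num.natAbs * (denProd c / x.1.den))
    (decide (0 ≤ x.1.num), monoList k n l x.2)

theorem denProd_ne_zero (c : PolyCode) : denProd c ≠ 0 := by
  intro h
  rw [denProd, List.prod_eq_zero_iff] at h
  obtain ⟨x, -, hx⟩ := List.mem_map.1 h
  exact x.1.den_nz hx

theorem prod_map_flatMap_replicate {S : Type*} [CommRing S] (σ : ℕ → S) (f g : ℕ → ℕ) (m : ℕ) :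
    (((List.range m).flatMap fun i => List.replicate (f i) (g i)).map σ).prod =
      ∏ i : Fin m, σ (g i) ^ f i := by
  induction m with
  | zero => simp
  | succ m ih =>
    rw [List.range_succ, List.flatMap_append, List.map_append, List.prod_append, ih,
      Fin.prod_univ_castSucc]
    simp

theorem prod_map_monoList {S : Type*} [CommRing S] (σ : ℕ → S) (k n l : ℕ) (L : List ℕ) :
    ((monoList k n l L).map σ).prod = ∏ v : (Fin k × Fin n) ⊕ Fin l,
      Sum.elim (fun w : Fin k × Fin n => σ (Nat.pair 1 (w.1 * n + w.2)))
        (fun j : Fin l => σ (Nat.pair 0 j)) v ^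
        (L.getD (Sum.elim (fun w => w.1.1 * n + w.2.1) (fun j => k * n + j.1) v) 0) := by
  rw [monoList, List.map_append, List.prod_append, prod_map_flatMap_replicate,
    prod_map_flatMap_replicate, Fintype.prod_sum_type]
  congr 1
  rw [← finProdFinEquiv.prod_comp]
  refine Finset.prod_congr rfl fun w _ => ?_
  have : ((finProdFinEquiv w : Fin (k * n)) : ℕ) = w.1 * n + w.2 := by
    simp [finProdFinEquiv, add_comm, mul_comm]
  simp only [this, Sum.elim_inl]

theorem polyVal_intPoly {S : Type*} [CommRing S] [Algebra ℚ S] (σ : ℕ → S) (k n l : ℕ)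
    (c : PolyCode) :
    polyVal σ (intPoly k n l c) = (denProd c : S) * MvPolynomial.aeval
      (Sum.elim (fun w : Fin k × Fin n => σ (Nat.pair 1 (w.1 * n + w.2)))
        (fun j : Fin l => σ (Nat.pair 0 j))) (decodePolyP k n l c) := by
  rw [decodePolyP, intPoly]
  have hd : ∀ x ∈ c, x.1.den ∣ denProd c := fun x hx =>
    List.dvd_prod (List.mem_map_of_mem hx)
  generalize denProd c = D at *
  induction c with
  | nil => simp [polyVal]
  | cons x c ih =>
    rw [List.flatMap_cons, polyVal_append, ih fun y hy => hd y (List.mem_cons_of_mem _ hy),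
      List.map_cons, List.sum_cons, map_add, mul_add]
    congr 1
    rw [map_mul, map_prod, MvPolynomial.aeval_C]
    simp only [map_pow, MvPolynomial.aeval_X]
    rw [← prod_map_monoList, polyVal, List.map_replicate, List.sum_replicate, ← mul_assoc,
      nsmul_eq_mul, ← mul_assoc]
    congr 1
    obtain ⟨b, hb⟩ := hd x List.mem_cons_self
    rw [hb, Nat.mul_div_cancel_left _ x.1.den_pos]
    have h1 : (x.1.den : ℚ) * x.1 = x.1.num := by
      rw [mul_comm]; exact Rat.mul_den_eq_num x.1
    have h2 : (x.1.den : S) * algebraMap ℚ S x.1 = x.1.num := by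
      rw [← map_natCast (algebraMap ℚ S), ← map_mul, h1, map_intCast]
    have h3 : ((x.1.num.natAbs : ℕ) : S) * (bif decide (0 ≤ x.1.num) then 1 else -1) =
        x.1.num := by
      by_cases h : 0 ≤ x.1.num
      · obtain ⟨m, hm⟩ := Int.eq_ofNat_of_zero_le h
        simp [hm]
      · obtain ⟨m, hm⟩ := Int.eq_ofNat_of_zero_le (show 0 ≤ -x.1.num by omega)
        have hm' : x.1.num = -(m : ℤ) := by omega
        rw [decide_eq_false h]
        simp [hm']
    push_cast
    linear_combination (b : S) * h3 - (b : S) * h2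

theorem card_support_polyVal_le {τ F : Type*} [CommRing F] (c : ℕ → F) (ν : τ → ℕ) (Q : PolyL) :
    (polyVal (polyVar c ν) Q).support.card ≤ Q.length := by
  classical
  have hv : ∀ i, ∃ s a, polyVar c ν i = MvPolynomial.monomial s a := by
    intro i
    rw [polyVar]
    split_ifs with h1 h2
    · exact ⟨0, _, rfl⟩
    · exact ⟨_, 1, rfl⟩
    · exact ⟨0, 0, by simp⟩
  have hm : ∀ L : List ℕ, ∃ s a, (L.map (polyVar c ν)).prod = MvPolynomial.monomial s a := by
    intro L
    induction L with
    | nil => exact ⟨0, 1, by simp⟩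
    | cons i L ih =>
      obtain ⟨s, a, h⟩ := ih
      obtain ⟨s', a', h'⟩ := hv i
      exact ⟨s' + s, a' * a, by
        rw [List.map_cons, List.prod_cons, h, h', MvPolynomial.monomial_mul]⟩
  induction Q with
  | nil => simp [polyVal]
  | cons x Q ih =>
    rw [polyVal_cons, List.length_cons, add_comm]
    refine (Finset.card_le_card MvPolynomial.support_add).trans
      ((Finset.card_union_le _ _).trans (add_le_add ih ?_))
    obtain ⟨s, a, h⟩ := hm x.2
    obtain ⟨b, hb⟩ : ∃ b, (bif x.1 then 1 else -1) * (x.2.map (polyVar c ν)).prod =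
        MvPolynomial.monomial s b := by
      cases x.1 with
      | true => exact ⟨a, by simp [h]⟩
      | false => exact ⟨-a, by simp [h]⟩
    rw [hb]
    exact (Finset.card_le_card MvPolynomial.support_monomial_subset).trans (by simp)

/-! ### Coded certificates -/

/-- The substitution sending `Nat.pair 0 j` to the `j`-th parameter (`j < l`), and
`Nat.pair 1 j`, `Nat.pair 2 j` to `X j` (`j < A`) and `Y j` (`j < B`). -/
def termSub (l A B : ℕ) (X Y : ℕ → ℕ) (i : ℕ) : ℕ :=
  bif i.unpair.1 == 0 then bif decide (i.unpair.2 < l) then tvar i.unpair.2 else tzero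
  else bif i.unpair.1 == 1 then bif decide (i.unpair.2 < A) then X i.unpair.2 else tzero
  else bif i.unpair.1 == 2 then bif decide (i.unpair.2 < B) then Y i.unpair.2 else tzero
  else tzero

theorem termSub_zero (l A B : ℕ) (X Y : ℕ → ℕ) (j : ℕ) :
    termSub l A B X Y (Nat.pair 0 j) = if j < l then tvar j else tzero := by
  simp [termSub, cond_eq_ite]

theorem termSub_one (l A B : ℕ) (X Y : ℕ → ℕ) (j : ℕ) :
    termSub l A B X Y (Nat.pair 1 j) = if j < A then X j else tzero := by
  simp [termSub, cond_eq_ite]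

theorem termSub_two (l A B : ℕ) (X Y : ℕ → ℕ) (j : ℕ) :
    termSub l A B X Y (Nat.pair 2 j) = if j < B then Y j else tzero := by
  simp [termSub, cond_eq_ite]

theorem termSub_of_two_lt (l A B : ℕ) (X Y : ℕ → ℕ) (t j : ℕ) (ht : 2 < t) :
    termSub l A B X Y (Nat.pair t j) = tzero := by
  have h0 : (t == 0) = false := by simp; omega
  have h1 : (t == 1) = false := by simp; omega
  have h2 : (t == 2) = false := by simp; omega
  simp [termSub, h0, h1, h2]

theorem TermHom.polyTerm_termSub {S τ F : Type*} [CommRing S] [CommRing F] [Algebra F S]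
    {h : ℕ → S} (hh : TermHom h) {c : ℕ → F} {ν : τ → ℕ} (hν : Function.Injective ν)
    {l A B : ℕ} {X Y : ℕ → ℕ} {w : τ → S}
    (hc : ∀ j, h (if j < l then tvar j else tzero) = algebraMap F S (c j))
    (hw : ∀ v, (∃ j < A, ν v = Nat.pair 1 j ∧ h (X j) = w v) ∨
      ∃ j < B, ν v = Nat.pair 2 j ∧ h (Y j) = w v)
    (hA : ∀ j < A, ∃ v, ν v = Nat.pair 1 j) (hB : ∀ j < B, ∃ v, ν v = Nat.pair 2 j)
    (Q : PolyL) :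
    h (_root_.polyTerm (termSub l A B X Y) Q) = MvPolynomial.aeval w (polyVal (polyVar c ν) Q) := by
  refine hh.polyTerm_eq_aeval hν (fun v => ?_) (fun j => ?_) (fun v => ?_)
    (fun t j ht hj => ?_) Q
  · rcases hw v with ⟨j, -, h1, -⟩ | ⟨j, -, h1, -⟩ <;> simp [h1]
  · rw [termSub_zero, hc]
  · rcases hw v with ⟨j, hj, h1, h2⟩ | ⟨j, hj, h1, h2⟩
    · rw [h1, termSub_one, if_pos hj, h2]
    · rw [h1, termSub_two, if_pos hj, h2]
  · rcases Nat.lt_or_ge 2 t with h2 | h2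
    · rw [termSub_of_two_lt _ _ _ _ _ _ _ h2, hh.zero]
    · obtain rfl | rfl : t = 1 ∨ t = 2 := by omega
      · rw [termSub_one, if_neg, hh.zero]
        intro hlt
        obtain ⟨v, hv⟩ := hA j hlt
        exact hj v hv
      · rw [termSub_two, if_neg, hh.zero]
        intro hlt
        obtain ⟨v, hv⟩ := hB j hlt
        exact hj v hv

/-- The `d`-th digit of `a` in base `K`. -/
def dig (K a d : ℕ) : ℕ := a / K ^ d % K

/-- The number with the digits `f 0, …, f (e - 1)` in base `K`. -/
def enc (e K : ℕ) (f : ℕ → ℕ) : ℕ := ((List.range e).map fun d => f d * K ^ d).sum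

/-- The number of a point of a finite grid. -/
def gcode {e K : ℕ} (a : Fin e → Fin K) : ℕ := finFunctionFinEquiv a

theorem gcode_lt {e K : ℕ} (a : Fin e → Fin K) : gcode a < K ^ e := Fin.is_lt _

theorem gcode_injective {e K : ℕ} : Function.Injective (gcode : (Fin e → Fin K) → ℕ) :=
  Fin.val_injective.comp finFunctionFinEquiv.injective

theorem exists_gcode_eq {e K a : ℕ} (h : a < K ^ e) : ∃ b : Fin e → Fin K, gcode b = a :=
  ⟨finFunctionFinEquiv.symm ⟨a, h⟩, by simp [gcode]⟩

theorem dig_gcode {e K : ℕ} (a : Fin e → Fin K) (d : Fin e) : dig K (gcode a) d = a d := by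
  have h := finFunctionFinEquiv_symm_apply_val (finFunctionFinEquiv a) d
  rw [Equiv.symm_apply_apply] at h
  exact h.symm

theorem sum_map_range (f : ℕ → ℕ) (m : ℕ) : ((List.range m).map f).sum = ∑ i : Fin m, f i := by
  induction m with
  | zero => simp
  | succ m ih =>
    rw [List.range_succ, List.map_append, List.sum_append, ih, Fin.sum_univ_castSucc]
    simp

theorem enc_eq_gcode {e K : ℕ} {f : ℕ → ℕ} {a : Fin e → Fin K} (h : ∀ d : Fin e, f d = a d) :
    enc e K f = gcode a := by
  rw [gcode, finFunctionFinEquiv_apply, enc, sum_map_range]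
  exact Finset.sum_congr rfl fun d _ => by rw [h d]

/-- The indeterminates of an annihilating polynomial. -/
def annVar {r : ℕ} (o : Option (Fin r)) : ℕ := o.elim (Nat.pair 1 0) fun i => Nat.pair 2 i

/-- The indeterminates of a polynomial in the coordinates of a grid. -/
def gridVar {e K n r : ℕ} : ((Fin e → Fin K) × Fin n) ⊕ (Fin r × (Fin e → Fin K)) → ℕ :=
  Sum.elim (fun v => Nat.pair 1 (gcode v.1 * n + v.2)) fun v => Nat.pair 2 (v.1 * K ^ e + gcode v.2)

/-- The indeterminates of the given polynomial. -/
def edgeVar {k n : ℕ} (v : Fin k × Fin n) : ℕ := Nat.pair 1 (v.1 * n + v.2)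

theorem mul_add_lt {a b m n : ℕ} (ha : a < m) (hb : b < n) : a * n + b < m * n := by
  calc a * n + b < a * n + n := by omega
    _ = (a + 1) * n := by ring
    _ ≤ m * n := Nat.mul_le_mul_right n ha

theorem mul_add_inj {a b a' b' n : ℕ} (hb : b < n) (hb' : b' < n)
    (h : a * n + b = a' * n + b') : a = a' ∧ b = b' := by
  have hn : 0 < n := by omega
  have h1 : (a * n + b) / n = a := by
    rw [mul_comm, Nat.mul_add_div hn, Nat.div_eq_of_lt hb, add_zero]
  have h2 : (a' * n + b') / n = a' := by
    rw [mul_comm, Nat.mul_add_div hn, Nat.div_eq_of_lt hb', add_zero]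
  have h3 : a = a' := by rw [← h1, h, h2]
  subst h3
  exact ⟨rfl, by omega⟩

theorem exists_mul_add {i m n : ℕ} (h : i < m * n) : ∃ a < m, ∃ b < n, i = a * n + b := by
  have hn : 0 < n := Nat.pos_of_ne_zero (by rintro rfl; simp at h)
  exact ⟨i / n, (Nat.div_lt_iff_lt_mul hn).2 h, i % n, Nat.mod_lt _ hn,
    (Nat.div_add_mod' i n).symm⟩

theorem annVar_injective {r : ℕ} : Function.Injective (annVar (r := r)) := by
  rintro (_ | a) (_ | b) h
  · rfl
  · simp [annVar, Nat.pair_eq_pair] at h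
  · simp [annVar, Nat.pair_eq_pair] at h
  · simpa [annVar, Nat.pair_eq_pair, Fin.ext_iff] using h

theorem gridVar_injective {e K n r : ℕ} : Function.Injective (gridVar (e := e) (K := K) (n := n)
    (r := r)) := by
  rintro (⟨a, l⟩ | ⟨i, a⟩) (⟨b, l'⟩ | ⟨j, b⟩) h
  · simp only [gridVar, Sum.elim_inl, Nat.pair_eq_pair, true_and] at h
    obtain ⟨h1, h2⟩ := mul_add_inj l.2 l'.2 h
    rw [gcode_injective h1, Fin.ext h2]
  · simp [gridVar, Nat.pair_eq_pair] at h
  · simp [gridVar, Nat.pair_eq_pair] at h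
  · simp only [gridVar, Sum.elim_inr, Nat.pair_eq_pair, true_and] at h
    obtain ⟨h1, h2⟩ := mul_add_inj (gcode_lt a) (gcode_lt b) h
    rw [gcode_injective h2, Fin.ext h1]

theorem edgeVar_injective {k n : ℕ} : Function.Injective (edgeVar (k := k) (n := n)) := by
  rintro ⟨a, l⟩ ⟨b, l'⟩ h
  simp only [edgeVar, Nat.pair_eq_pair, true_and] at h
  obtain ⟨h1, h2⟩ := mul_add_inj l.2 l'.2 h
  rw [Fin.ext h1, Fin.ext h2]

section Eval

variable {S F : Type*} [CommRing S] [CommRing F] [Algebra F S] {h : ℕ → S} {c : ℕ → F} {l : ℕ}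

theorem TermHom.polyTerm_annVar (hh : TermHom h)
    (hc : ∀ j, h (if j < l then tvar j else tzero) = algebraMap F S (c j)) (r : ℕ)
    (X Y : ℕ → ℕ) (Q : PolyL) : h (_root_.polyTerm (termSub l 1 r X Y) Q) =
      MvPolynomial.aeval (fun o : Option (Fin r) => o.elim (h (X 0)) fun i => h (Y i))
        (polyVal (polyVar c annVar) Q) := by
  refine hh.polyTerm_termSub annVar_injective hc ?_ ?_ ?_ Q
  · rintro (_ | i)
    · exact Or.inl ⟨0, one_pos, rfl, rfl⟩
    · exact Or.inr ⟨i, i.2, rfl, rfl⟩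
  · intro j hj
    obtain rfl : j = 0 := by omega
    exact ⟨none, rfl⟩
  · exact fun j hj => ⟨some ⟨j, hj⟩, rfl⟩

theorem TermHom.polyTerm_gridVar (hh : TermHom h)
    (hc : ∀ j, h (if j < l then tvar j else tzero) = algebraMap F S (c j)) (e K n r : ℕ)
    (X Y : ℕ → ℕ) (Q : PolyL) : h (_root_.polyTerm (termSub l (K ^ e * n) (r * K ^ e) X Y) Q) =
      MvPolynomial.aeval (Sum.elim (fun v : (Fin e → Fin K) × Fin n => h (X (gcode v.1 * n + v.2)))
          fun v : Fin r × (Fin e → Fin K) => h (Y (v.1 * K ^ e + gcode v.2)))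
        (polyVal (polyVar c gridVar) Q) := by
  refine hh.polyTerm_termSub gridVar_injective hc ?_ ?_ ?_ Q
  · rintro (v | v)
    · exact Or.inl ⟨_, mul_add_lt (gcode_lt v.1) v.2.2, rfl, rfl⟩
    · exact Or.inr ⟨_, mul_add_lt v.1.2 (gcode_lt v.2), rfl, rfl⟩
  · intro j hj
    obtain ⟨a, ha, b, hb, rfl⟩ := exists_mul_add hj
    obtain ⟨a, rfl⟩ := exists_gcode_eq ha
    exact ⟨Sum.inl (a, ⟨b, hb⟩), rfl⟩
  · intro j hj
    obtain ⟨a, ha, b, hb, rfl⟩ := exists_mul_add hj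
    obtain ⟨b, rfl⟩ := exists_gcode_eq hb
    exact ⟨Sum.inr (⟨a, ha⟩, b), rfl⟩

theorem TermHom.polyTerm_edgeVar (hh : TermHom h)
    (hc : ∀ j, h (if j < l then tvar j else tzero) = algebraMap F S (c j)) (k n : ℕ)
    (X Y : ℕ → ℕ) (Q : PolyL) : h (_root_.polyTerm (termSub l (k * n) 0 X Y) Q) =
      MvPolynomial.aeval (fun v : Fin k × Fin n => h (X (v.1 * n + v.2)))
        (polyVal (polyVar c edgeVar) Q) := by
  refine hh.polyTerm_termSub edgeVar_injective hc ?_ ?_ (by simp) Q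
  · exact fun v => Or.inl ⟨_, mul_add_lt v.1.2 v.2.2, rfl, rfl⟩
  · intro j hj
    obtain ⟨a, ha, b, hb, rfl⟩ := exists_mul_add hj
    exact ⟨(⟨a, ha⟩, ⟨b, hb⟩), rfl⟩

end Eval

/-- The number of the grid point `fun d => β d (P j d)`, for `β` and `P` given by numbers. -/
def edgePoint (k e K P b j : ℕ) : ℕ :=
  enc e K fun d => dig K (dig (K ^ k) b d) (dig k (dig (k ^ e) P j) d)

/-- The number of the grid point obtained from the `a`-th one by erasing the coordinates `d`
for which `Nat.pair i d` is not in `J`. -/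
def maskNum (e K : ℕ) (J : List ℕ) (i a : ℕ) : ℕ :=
  enc e K fun d => bif J.contains (Nat.pair i d) then dig K a d else 0

/-- The term for a polynomial in one point coordinate `x` and `r` parameters `Y`. -/
def annTerm (l r : ℕ) (x : ℕ) (Y : ℕ → ℕ) (Q : PolyL) : ℕ :=
  polyTerm (termSub l 1 r (fun _ => x) Y) Q

/-- The variables standing for the coordinates of grid points. -/
def tvarX (l i : ℕ) : ℕ := tvar (l + Nat.pair 1 (Nat.pair 0 i))

/-- The variables standing for the parameters of grid points. -/
def tvarY (l i : ℕ) : ℕ := tvar (l + Nat.pair 1 (Nat.pair 1 i))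

/-- The variables standing for the coordinates of the points of the `q`-th grid. -/
def tvarG (l q i : ℕ) : ℕ := tvar (l + Nat.pair 0 (Nat.pair q i))

/-- The term for the polynomial `p` at the vertices of the edge number `b`. -/
def edgeTerm (k n l e K P : ℕ) (p : PolyL) (X : ℕ → ℕ) (b : ℕ) : ℕ :=
  polyTerm (termSub l (k * n) 0 (fun i => X (edgePoint k e K P b (i / n) * n + i % n))
    fun _ => 0) p

/-- The power of a term. -/
def tpow (t m : ℕ) : ℕ := m.rec tone fun _ s => tmul t s

/-- The sum of a list of terms. -/
def tsumL (L : List ℕ) : ℕ := L.foldr tadd tzero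

theorem TermHom.pow {S : Type*} [CommRing S] {h : ℕ → S} (hh : TermHom h) (t m : ℕ) :
    h (tpow t m) = h t ^ m := by
  induction m with
  | zero => simpa [tpow] using hh.one
  | succ m ih =>
    rw [pow_succ', ← ih]
    exact hh.mul _ _

theorem TermHom.sumL {S : Type*} [CommRing S] {h : ℕ → S} (hh : TermHom h) (L : List ℕ) :
    h (tsumL L) = (L.map h).sum := by
  induction L with
  | nil => simpa [tsumL] using hh.zero
  | cons t L ih =>
    rw [List.map_cons, List.sum_cons, ← ih]
    exact hh.add _ _

/-- Codes of certificates: the number of parameters, the coordinates they depend on, the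
annihilating polynomials, terms for the points and the parameters of the grid, terms witnessing
the dependence on the parameters, and for each edge the data of an ideal membership. -/
abbrev CertData : Type :=
  ℕ × List ℕ × List PolyL × List ℕ × List ℕ × List ℕ × List (ℕ × PolyL × List PolyL)

section Literals

variable (k n l e K P : ℕ) (p : PolyL) (D : CertData)

/-- The term for the `i`-th parameter at the `a`-th grid point. -/
def certY (a i : ℕ) : ℕ := D.2.2.2.2.1.getD (i * K ^ e + maskNum e K D.2.1 i a) 0

/-- The term for the `s`-th coordinate at the `a`-th grid point. -/
def certX (a s : ℕ) : ℕ := D.2.2.2.1.getD (a * n + s) 0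

/-- The data attached to the edge number `b`. -/
def certE (b : ℕ) : ℕ × PolyL × List PolyL := D.2.2.2.2.2.2.getD b (0, [], [])

/-- The terms which vanish according to a certificate. -/
def certZero : List ℕ :=
  [bif (List.range e).all fun d => (List.range D.1).any fun i => D.2.1.contains (Nat.pair i d)
    then tzero else tone] ++
  ((List.range (K ^ e)).flatMap fun a => (List.range n).map fun s =>
    annTerm l D.1 (certX n D a s) (certY e K D a) (D.2.2.1.getD s [])) ++
  (List.range ((K ^ k) ^ e)).map fun b =>
    tadd (tmul (tpow (edgeTerm k n l e K P p (tvarX l) b) (certE D b).1)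
        (polyTerm (termSub l (K ^ e * n) (D.1 * K ^ e) (tvarX l) (tvarY l)) (certE D b).2.1))
      (tneg (tsumL ((List.range (K ^ e * n)).map fun i => tmul
        (polyTerm (termSub l (K ^ e * n) (D.1 * K ^ e) (tvarX l) (tvarY l))
          ((certE D b).2.2.getD i []))
        (annTerm l D.1 (tvarX l i) (fun j => tvarY l (j * K ^ e + maskNum e K D.2.1 j (i / n)))
          (D.2.2.1.getD (i % n) [])))))

/-- The coordinate of which the dependence on the `i`-th parameter at the `a`-th grid point is
witnessed. -/
def certS (a i : ℕ) : ℕ := (D.2.2.2.2.2.1.getD (a * D.1 + i) 0).unpair.1 % n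

/-- The terms which do not vanish according to a certificate. -/
def certNe : List ℕ :=
  ((List.range (K ^ e)).flatMap fun a => (List.range n).map fun s =>
    annTerm l D.1 (certX n D a s) (certY e K D a)
      (polyDeriv (Nat.pair 1 0) (D.2.2.1.getD s []))) ++
  ((List.range (K ^ e)).flatMap fun a => (List.range D.1).map fun i =>
    annTerm l D.1 (certX n D a (certS n D a i)) (fun j => bif j == i then
      (D.2.2.2.2.2.1.getD (a * D.1 + i) 0).unpair.2 else certY e K D a j)
      (D.2.2.1.getD (certS n D a i) [])) ++
  (List.range ((K ^ k) ^ e)).map fun b =>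
    polyTerm (termSub l (K ^ e * n) (D.1 * K ^ e) (fun i => D.2.2.2.1.getD i 0)
      fun i => certY e K D (i % K ^ e) (i / K ^ e)) (certE D b).2.1

end Literals

section Facts

variable {k e K : ℕ}

/-- The number of a family of colours of grid coordinates. -/
def betaNum (β : Fin e → Fin k → Fin K) : ℕ :=
  gcode (fun d => (finFunctionFinEquiv (β d) : Fin (K ^ k)))

theorem betaNum_lt (β : Fin e → Fin k → Fin K) : betaNum β < (K ^ k) ^ e := gcode_lt _

theorem betaNum_injective :
    Function.Injective (betaNum : (Fin e → Fin k → Fin K) → ℕ) := fun _ _ h =>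
  funext fun d => finFunctionFinEquiv.injective (congrFun (gcode_injective h) d)

theorem exists_betaNum_eq {b : ℕ} (hb : b < (K ^ k) ^ e) :
    ∃ β : Fin e → Fin k → Fin K, betaNum β = b := by
  obtain ⟨f, hf⟩ := exists_gcode_eq hb
  exact ⟨fun d => finFunctionFinEquiv.symm (f d), by simp [betaNum, hf]⟩

theorem dig_dig_betaNum (β : Fin e → Fin k → Fin K) (d : Fin e) (c : Fin k) :
    dig K (dig (K ^ k) (betaNum β) d) c = β d c := by
  rw [betaNum, dig_gcode]
  exact dig_gcode (β d) c

theorem edgePoint_eq {Pc : ℕ} {P : Fin k → Fin e → Fin k}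
    (hP : ∀ (j : Fin k) (d : Fin e), dig k (dig (k ^ e) Pc j) d = P j d)
    (β : Fin e → Fin k → Fin K) (j : Fin k) :
    edgePoint k e K Pc (betaNum β) j = gcode fun d => β d (P j d) :=
  enc_eq_gcode fun d => by rw [hP, dig_dig_betaNum]

theorem maskNum_eq {r : ℕ} {L : List ℕ} {J : Fin r → Finset (Fin e)}
    (hJ : ∀ i d, d ∈ J i ↔ Nat.pair i d ∈ L) (i : Fin r) (a : Fin e → Fin K) :
    maskNum e K L i (gcode a) = gcode (maskFun (J i) a) := by
  refine enc_eq_gcode fun d => ?_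
  by_cases h : d ∈ J i
  · have := (hJ i d).1 h
    simp [this, maskFun, h, dig_gcode]
  · have : ¬ Nat.pair i d ∈ L := fun h' => h ((hJ i d).2 h')
    simp [this, maskFun, h]

end Facts

theorem mul_add_mod_of_lt {a b n : ℕ} (hb : b < n) : (a * n + b) % n = b := by
  rw [mul_comm, Nat.mul_add_mod, Nat.mod_eq_of_lt hb]

theorem mul_add_div_of_lt {a b n : ℕ} (hb : b < n) : (a * n + b) / n = a := by
  rw [mul_comm, Nat.mul_add_div (by omega), Nat.div_eq_of_lt hb, add_zero]

theorem TermHom.edgeTerm {S F : Type*} [CommRing S] [CommRing F] [Algebra F S] {h : ℕ → S}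
    (hh : TermHom h) {c : ℕ → F} {l : ℕ}
    (hc : ∀ j, h (if j < l then tvar j else tzero) = algebraMap F S (c j)) {k n e K Pc : ℕ}
    {P : Fin k → Fin e → Fin k}
    (hPc : ∀ (j : Fin k) (d : Fin e), dig k (dig (k ^ e) Pc j) d = P j d) (p : PolyL) (X : ℕ → ℕ)
    (β : Fin e → Fin k → Fin K) : h (_root_.edgeTerm k n l e K Pc p X (betaNum β)) =
      MvPolynomial.aeval (fun v : Fin k × Fin n => h (X (gcode (fun d => β d (P v.1 d)) * n + v.2)))
        (polyVal (polyVar c edgeVar) p) := by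
  rw [_root_.edgeTerm, hh.polyTerm_edgeVar hc]
  refine congrArg (fun w : Fin k × Fin n → S =>
    MvPolynomial.aeval w (polyVal (polyVar c edgeVar) p)) (funext fun v => ?_)
  rw [mul_add_mod_of_lt v.2.2, mul_add_div_of_lt v.2.2, edgePoint_eq hPc]

theorem gridBound_le_gridBound (e k : ℕ) {B B' : ℕ} (h : B ≤ B') (j : ℕ) :
    gridBound e k B j ≤ gridBound e k B' j := by
  induction j with
  | zero => simp [gridBound]
  | succ j ih =>
    simp only [gridBound]
    gcongr

/-- The variables of grid coordinates are interpreted as algebraically independent elements. -/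
theorem algebraicIndependent_gridVars {F S : Type} [Field F] [CommRing S] [Algebra F S] {h : ℕ → S}
    {l : ℕ} (hz : AlgebraicIndependent F fun i => h (tvar (l + Nat.pair 1 i))) (e K n r : ℕ) :
    AlgebraicIndependent F (Sum.elim
      (fun v : (Fin e → Fin K) × Fin n => h (tvarX l (gcode v.1 * n + v.2)))
      fun v : Fin r × (Fin e → Fin K) => h (tvarY l (v.1 * K ^ e + gcode v.2))) := by
  obtain ⟨g, hg⟩ : ∃ g : ((Fin e → Fin K) × Fin n) ⊕ (Fin r × (Fin e → Fin K)) → ℕ,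
      ∀ v, g v = Sum.elim (fun v => Nat.pair 0 (gcode v.1 * n + v.2))
        (fun v => Nat.pair 1 (v.1 * K ^ e + gcode v.2)) v := ⟨_, fun _ => rfl⟩
  have hgi : Function.Injective g := by
    intro v w hvw
    rw [hg, hg] at hvw
    apply gridVar_injective
    rcases v with v | v <;> rcases w with w | w
    · simpa [gridVar, Nat.pair_eq_pair] using hvw
    · simp [Nat.pair_eq_pair] at hvw
    · simp [Nat.pair_eq_pair] at hvw
    · simpa [gridVar, Nat.pair_eq_pair] using hvw
  have h1 := hz.comp g hgi
  convert h1 using 1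
  funext v
  rw [Function.comp_apply, hg]
  rcases v with v | v <;> rfl

theorem exists_aeval_eq_sumL {F S τ : Type} [Field F] [CommRing S] [Algebra F S] {h : ℕ → S}
    (hh : TermHom h) {w : τ → S} {Z : Set (τ → S)} (L : List ℕ)
    (hL : ∀ t ∈ L, ∃ N : MvPolynomial τ F, h t = MvPolynomial.aeval w N ∧
      ∀ w' ∈ Z, MvPolynomial.aeval w' N = 0) :
    ∃ N : MvPolynomial τ F, h (tsumL L) = MvPolynomial.aeval w N ∧
      ∀ w' ∈ Z, MvPolynomial.aeval w' N = 0 := by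
  induction L with
  | nil => exact ⟨0, by rw [map_zero]; exact hh.zero, fun _ _ => map_zero _⟩
  | cons t L ih =>
    obtain ⟨N, hN, hN'⟩ := hL t List.mem_cons_self
    obtain ⟨M, hM, hM'⟩ := ih fun t ht => hL t (List.mem_cons_of_mem _ ht)
    refine ⟨N + M, ?_, fun w' hw' => ?_⟩
    · rw [map_add, ← hN, ← hM]
      exact hh.add _ _
    · rw [map_add, hN' w' hw', hM' w' hw', add_zero]

/-- Interpretations of the variables making a certificate true yield that the given
polynomial relation holds on good arrangements. -/
theorem goodArr_of_cert {F : Type} [Field F] [Algebra F ℝ] {h : ℕ → ℝ} (hh : TermHom h)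
    {c : ℕ → F} {l : ℕ} (hc : ∀ j, h (if j < l then tvar j else tzero) = algebraMap F ℝ (c j))
    (hz : AlgebraicIndependent F fun i => h (tvar (l + Nat.pair 1 i))) {k n e K Pc : ℕ}
    (hn : 0 < n) {P : Fin k → Fin e → Fin k} (hP : Function.Injective P)
    (hPc : ∀ (j : Fin k) (d : Fin e), dig k (dig (k ^ e) Pc j) d = P j d) {p : PolyL}
    (hK : gridBound e k (k * p.length) e ≤ K) {D : CertData}
    (h0 : ∀ t ∈ certZero k n l e K Pc p D, h t = 0) (h1 : ∀ t ∈ certNe k n l e K D, h t ≠ 0) :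
    GoodArr (polyRel (R := ℝ) (polyVal (polyVar c (edgeVar (k := k) (n := n))) p)) e := by
  classical
  simp only [certZero, List.mem_append, List.mem_flatMap, List.mem_map, List.mem_range,
    List.mem_singleton] at h0
  simp only [certNe, List.mem_append, List.mem_flatMap, List.mem_map, List.mem_range] at h1
  let r := D.1
  let J : Fin r → Finset (Fin e) := fun i => Finset.univ.filter fun d => Nat.pair i d ∈ D.2.1
  have hJ : ∀ i d, d ∈ J i ↔ Nat.pair i d ∈ D.2.1 := fun i d => by simp [J]
  let m : Fin n → MvPolynomial (Option (Fin r)) F := fun s =>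
    polyVal (polyVar c annVar) (D.2.2.1.getD s [])
  let X : (Fin e → Fin K) → Fin n → ℝ := fun a s => h (certX n D (gcode a) s)
  let Y : Fin r → (Fin e → Fin K) → ℝ := fun i a => h (certY e K D (gcode a) i)
  have hJc : ∀ d, ∃ i, d ∈ J i := by
    have h2 := h0 _ (Or.inl (Or.inl rfl))
    intro d
    by_contra hcon
    rw [Bool.cond_eq_ite, if_neg, hh.one] at h2
    · exact one_ne_zero h2
    · intro h3
      rw [List.all_eq_true] at h3
      obtain ⟨i, hi, h4⟩ := List.any_eq_true.1 (h3 d (List.mem_range.2 d.2))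
      exact hcon ⟨⟨i, List.mem_range.1 hi⟩, (hJ _ _).2 (by simpa using h4)⟩
  have hY : DependsOnCoords J Y := by
    intro i a a' haa
    simp only [Y, certY, maskNum_eq hJ, maskFun_eq_iff.2 haa]
  refine GoodArr.of_certGrid hP hJc (m := m) (X := X) hY ?_ ?_ ?_ (le_trans ?_ hK) ?_
  · intro a s
    have h2 := h0 _ (Or.inl (Or.inr ⟨_, gcode_lt a, s, s.2, rfl⟩))
    rwa [annTerm, hh.polyTerm_annVar hc] at h2
  · intro a s
    have h2 := h1 _ (Or.inl (Or.inl ⟨_, gcode_lt a, s, s.2, rfl⟩))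
    rw [annTerm, hh.polyTerm_annVar hc] at h2
    rwa [← pderiv_polyVal c annVar_injective (fun v => by cases v <;> simp [annVar])]
  · intro a i
    have h2 := h1 _ (Or.inl (Or.inr ⟨_, gcode_lt a, i, i.2, rfl⟩))
    rw [annTerm, hh.polyTerm_annVar hc] at h2
    refine ⟨⟨certS n D (gcode a) i, Nat.mod_lt _ hn⟩,
      h (D.2.2.2.2.2.1.getD (gcode a * D.1 + i) 0).unpair.2, ?_⟩
    intro hcon
    refine h2 ((congrArg (fun w : Option (Fin r) → ℝ => MvPolynomial.aeval w
      (polyVal (polyVar c annVar) (D.2.2.1.getD (certS n D (gcode a) i) []))) ?_).trans hcon)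
    funext o
    cases o with
    | none => rfl
    | some j =>
      simp only [Option.elim_some, Function.update_apply, Fin.ext_iff, Bool.cond_eq_ite, beq_iff_eq]
      split_ifs <;> rfl
  · exact gridBound_le_gridBound e k (Nat.mul_le_mul_left k (card_support_polyVal_le c _ p)) e
  · intro β _
    refine ⟨polyVal (polyVar c gridVar) (certE D (betaNum β)).2.1, ?_, ?_⟩
    · have h2 := h1 _ (Or.inr ⟨_, betaNum_lt β, rfl⟩)
      rw [hh.polyTerm_gridVar hc] at h2
      intro hcon
      refine h2 ((congrArg (fun w : _ → ℝ => MvPolynomial.aeval w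
        (polyVal (polyVar c gridVar) (certE D (betaNum β)).2.1)) ?_).trans hcon)
      funext v
      rcases v with v | v
      · rfl
      · simp only [Sum.elim_inr, Y]
        rw [mul_add_mod_of_lt (gcode_lt _), mul_add_div_of_lt (gcode_lt _)]
    · intro X' Y' hY' hm hq
      have h2 := h0 _ (Or.inr ⟨_, betaNum_lt β, rfl⟩)
      obtain ⟨N, hN, hN'⟩ := exists_aeval_eq_sumL (F := F) hh
        (w := Sum.elim (fun v : (Fin e → Fin K) × Fin n => h (tvarX l (gcode v.1 * n + v.2)))
          fun v : Fin r × (Fin e → Fin K) => h (tvarY l (v.1 * K ^ e + gcode v.2)))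
        (Z := {Sum.elim (fun v => X' v.1 v.2) fun v => Y' v.1 v.2})
        ((List.range (K ^ e * n)).map fun i => tmul
          (polyTerm (termSub l (K ^ e * n) (D.1 * K ^ e) (tvarX l) (tvarY l))
            ((certE D (betaNum β)).2.2.getD i []))
          (annTerm l D.1 (tvarX l i) (fun j => tvarY l (j * K ^ e + maskNum e K D.2.1 j (i / n)))
            (D.2.2.1.getD (i % n) []))) (by
          intro t ht
          obtain ⟨i, hi, rfl⟩ := List.mem_map.1 ht
          obtain ⟨a, ha, s, hs, rfl⟩ := exists_mul_add (List.mem_range.1 hi)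
          obtain ⟨a, rfl⟩ := exists_gcode_eq ha
          refine ⟨polyVal (polyVar c gridVar)
            ((certE D (betaNum β)).2.2.getD (gcode a * n + s) []) *
            MvPolynomial.rename (fun o : Option (Fin r) =>
              o.elim (Sum.inl (a, ⟨s, hs⟩)) fun i => Sum.inr (i, maskFun (J i) a)) (m ⟨s, hs⟩),
            ?_, ?_⟩
          · rw [hh.mul, hh.polyTerm_gridVar hc, annTerm, hh.polyTerm_annVar hc, map_mul,
              MvPolynomial.aeval_rename, mul_add_mod_of_lt hs, mul_add_div_of_lt hs]
            refine congrArg₂ (· * ·) rfl (congrArg (fun w : Option (Fin r) → ℝ =>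
              MvPolynomial.aeval w (m ⟨s, hs⟩)) ?_)
            funext o
            cases o with
            | none => rfl
            | some j =>
              simp only [Option.elim_some, Function.comp_apply, Sum.elim_inr]
              rw [maskNum_eq hJ]
          · rintro w' rfl
            rw [map_mul, MvPolynomial.aeval_rename]
            refine mul_eq_zero_of_right _ ((congrArg (fun w : Option (Fin r) → ℝ =>
              MvPolynomial.aeval w (m ⟨s, hs⟩)) ?_).trans (hm a ⟨s, hs⟩))
            funext o
            cases o with
            | none => rfl
            | some j =>
              exact hY' j _ _ (maskFun_eq_iff.1 (maskFun_maskFun (J j) a)))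
      rw [hh.add, hh.mul, hh.pow, hh.neg, hN, hh.edgeTerm hc hPc, hh.polyTerm_gridVar hc] at h2
      have h3 : MvPolynomial.aeval (fun v : Fin k × Fin n => h (tvarX l
          (gcode (fun d => β d (P v.1 d)) * n + v.2)))
          (polyVal (polyVar c edgeVar) p) = MvPolynomial.aeval (Sum.elim
            (fun v : (Fin e → Fin K) × Fin n => h (tvarX l (gcode v.1 * n + v.2)))
            fun v : Fin r × (Fin e → Fin K) => h (tvarY l (v.1 * K ^ e + gcode v.2)))
          (gridPoly r (polyVal (polyVar c edgeVar) p) fun j d => β d (P j d)) := by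
        rw [gridPoly, MvPolynomial.aeval_rename]
        rfl
      rw [h3, ← map_pow, ← map_mul, ← sub_eq_add_neg, ← map_sub] at h2
      have h4 := (algebraicIndependent_gridVars hz e K n r).eq_zero_of_aeval_eq_zero _ h2
      have h5 := congrArg (MvPolynomial.aeval
        (Sum.elim (fun v => X' v.1 v.2) fun v => Y' v.1 v.2)) h4
      rw [map_sub, map_mul, map_pow, hN' _ rfl, sub_zero, map_zero] at h5
      have h6 := eq_zero_of_pow_eq_zero ((mul_eq_zero.1 h5).resolve_right hq)
      rwa [gridPoly, MvPolynomial.aeval_rename] at h6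

theorem exists_list_getD {τ α : Type*} [Finite τ] {ν : τ → ℕ} (hν : Function.Injective ν)
    (f : τ → α) (d : α) : ∃ L : List α, ∀ v, L.getD (ν v) d = f v := by
  classical
  obtain ⟨N, hN⟩ := (Set.finite_range ν).bddAbove
  refine ⟨(List.range (N + 1)).map fun i => if h : ∃ v, ν v = i then f h.choose else d,
    fun v => ?_⟩
  have h1 : ν v < N + 1 := Nat.lt_succ_of_le (hN ⟨v, rfl⟩)
  have h2 : ∃ w, ν w = ν v := ⟨v, rfl⟩
  rw [List.getD_eq_getElem _ _ (by simpa using h1)]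
  simp only [List.getElem_map, List.getElem_range]
  rw [dif_pos h2, hν h2.choose_spec]

theorem sum_map_range_gcode {S : Type*} [CommRing S] (e K n : ℕ) (f : ℕ → S) :
    ((List.range (K ^ e * n)).map f).sum =
      ∑ v : (Fin e → Fin K) × Fin n, f (gcode v.1 * n + v.2) := by
  have h1 : ((List.range (K ^ e * n)).map f).sum = ∑ i : Fin (K ^ e * n), f i := by
    rw [← List.sum_ofFn, List.ofFn_eq_map, ← List.map_coe_finRange_eq_range, List.map_map]
    rfl
  rw [h1]
  refine (Fintype.sum_equiv ((finFunctionFinEquiv.prodCongr (Equiv.refl (Fin n))).trans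
    finProdFinEquiv) _ _ fun v => ?_).symm
  simp only [Equiv.trans_apply, finProdFinEquiv_apply_val, Equiv.prodCongr_apply, Prod.map_fst,
    Prod.map_snd, Equiv.refl_apply]
  exact congrArg f (by rw [gcode, add_comm, mul_comm])

/-- Grids of all sizes satisfying the given polynomial relation yield a certificate. -/
theorem exists_cert_of_grids {R : Type} [Field R] [CharZero R] [Countable R] {h : ℕ → R}
    (hh : TermHom h) {k n l e Pc : ℕ} (hk : 0 < k)
    (hle : Order.succ^[e] ℵ₀ ≤ (𝔠 : Cardinal.{0})) {P : Fin k → Fin e → Fin k}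
    (hPc : ∀ (j : Fin k) (d : Fin e), dig k (dig (k ^ e) Pc j) d = P j d) {p : PolyL}
    (hinj : ∀ q (a a' : Fin e → Fin q), (∀ s : Fin n,
      h (tvarG l q (gcode a * n + s)) = h (tvarG l q (gcode a' * n + s))) → a = a')
    (hrel : ∀ q, ∀ b < (q ^ k) ^ e, h (edgeTerm k n l e q Pc p (tvarG l q) b) = 0) (K : ℕ) :
    ∃ D : CertData, (∀ t ∈ certZero k n l e K Pc p D, h t = 0) ∧
      ∀ t ∈ certNe k n l e K D, h t ≠ 0 := by
  classical
  obtain ⟨c, hc⟩ : ∃ c : ℕ → R, ∀ j, c j = h (if j < l then tvar j else tzero) :=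
    ⟨_, fun _ => rfl⟩
  obtain ⟨F, hF⟩ : ∃ F, F = Subfield.closure (Set.range c) := ⟨_, rfl⟩
  obtain ⟨c', hc'⟩ : ∃ c' : ℕ → F, ∀ j, (c' j : R) = c j :=
    ⟨fun j => ⟨c j, hF ▸ Subfield.subset_closure ⟨j, rfl⟩⟩, fun _ => rfl⟩
  have hca : ∀ j, h (if j < l then tvar j else tzero) = algebraMap F R (c' j) := fun j =>
    ((hc' j).trans (hc j)).symm
  obtain ⟨x, hx⟩ : ∃ x : ∀ q, (Fin e → Fin q) → Fin n → R,
      ∀ q a s, x q a s = h (tvarG l q (gcode a * n + s)) := ⟨_, fun _ _ _ => rfl⟩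
  obtain ⟨q, r, J, m, bX, bY, hJ, hbY, hm0, hm1, hm2, hm3⟩ :=
    exists_cert_grid_of_forall_grid (F := F) (n := n) hk hle
    (p := polyVal (polyVar c' edgeVar) p) (P := P) (x := x)
    (fun q a a' haa => hinj q a a' fun s => by rw [← hx, ← hx, haa])
    (fun q β => by
      have h1 := hrel q _ (betaNum_lt β)
      rw [hh.edgeTerm hca hPc] at h1
      simpa only [polyRel, hx] using h1) K
  have hann0 : ∀ v : Option (Fin r), (annVar v).unpair.1 ≠ 0 := fun v => by
    cases v <;> simp [annVar]
  have hgrid0 : ∀ v, (gridVar (e := e) (K := K) (n := n) (r := r) v).unpair.1 ≠ 0 := fun v => by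
    rcases v with v | v <;> simp [gridVar]
  obtain ⟨d, hd, hpm⟩ := exists_forall_polyVal_eq_C_mul hF c' hc' annVar_injective hann0 m
  choose pm hpm using hpm
  choose sl z hz using hm2
  choose Q ι hQ hmem using hm3
  have hmem' : ∀ β, ∃ (d' : F) (QL : PolyL) (H : (Fin e → Fin K) × Fin n → PolyL), d' ≠ 0 ∧
      polyVal (polyVar c' gridVar) QL = MvPolynomial.C d' * Q β ∧
      gridPoly r (polyVal (polyVar c' edgeVar) p) (fun j d => β d (P j d)) ^ ι β *
        polyVal (polyVar c' gridVar) QL = ∑ v, polyVal (polyVar c' gridVar) (H v) *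
          MvPolynomial.rename (fun o : Option (Fin r) =>
            o.elim (Sum.inl v) fun i => Sum.inr (i, maskFun (J i) v.1))
            (polyVal (polyVar c' annVar) (pm v.2)) := by
    intro β
    obtain ⟨H, hH⟩ := Ideal.mem_span_range_iff_exists_fun.1 (hmem β)
    obtain ⟨d', hd', hL⟩ := exists_forall_polyVal_eq_C_mul hF c' hc' gridVar_injective hgrid0
      (fun o : Option ((Fin e → Fin K) × Fin n) => o.elim (Q β) fun v => MvPolynomial.C d⁻¹ * H v)
    choose L hL using hL
    refine ⟨d', L none, fun v => L (some v), hd', hL none, ?_⟩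
    rw [hL none, Option.elim_none, mul_left_comm, ← hH, Finset.mul_sum]
    refine Finset.sum_congr rfl fun v _ => ?_
    rw [hL (some v), Option.elim_some, hpm, map_mul, MvPolynomial.rename_C]
    have : (MvPolynomial.C d⁻¹ * MvPolynomial.C d :
        MvPolynomial (((Fin e → Fin K) × Fin n) ⊕ (Fin r × (Fin e → Fin K))) F) = 1 := by
      rw [← map_mul, inv_mul_cancel₀ hd, map_one]
    linear_combination (-(MvPolynomial.C d' * H v * MvPolynomial.rename (fun o : Option (Fin r) =>
            o.elim (Sum.inl v) fun i => Sum.inr (i, maskFun (J i) v.1)) (m v.2))) * this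
  choose d' QL H hd' hQL hid using hmem'
  have hmi : Function.Injective fun v : (Fin e → Fin K) × Fin n => gcode v.1 * n + v.2 := by
    intro v w hvw
    obtain ⟨h1, h2⟩ := mul_add_inj v.2.2 w.2.2 hvw
    exact Prod.ext (gcode_injective h1) (Fin.ext h2)
  have hyi : Function.Injective fun v : Fin r × (Fin e → Fin K) => v.1 * K ^ e + gcode v.2 := by
    intro v w hvw
    obtain ⟨h1, h2⟩ := mul_add_inj (gcode_lt _) (gcode_lt _) hvw
    exact Prod.ext (Fin.ext h1) (gcode_injective h2)
  have hui : Function.Injective fun v : (Fin e → Fin K) × Fin r => gcode v.1 * r + v.2 := by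
    intro v w hvw
    obtain ⟨h1, h2⟩ := mul_add_inj v.2.2 w.2.2 hvw
    exact Prod.ext (gcode_injective h1) (Fin.ext h2)
  obtain ⟨Lm, hLm⟩ := exists_list_getD (τ := Fin n) Fin.val_injective pm []
  obtain ⟨LX, hLX⟩ := exists_list_getD hmi (fun v => tvarG l q (gcode (bX v.1) * n + v.2)) 0
  obtain ⟨LY, hLY⟩ := exists_list_getD hyi
    (fun v => tvarG l q (gcode (bY v.1 v.2).1 * n + (bY v.1 v.2).2)) 0
  obtain ⟨LU, hLU⟩ := exists_list_getD hui (fun v => Nat.pair (sl v.1 v.2) (tnum (z v.1 v.2))) 0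
  have hLH := fun β => exists_list_getD hmi (H β) []
  choose LH hLH using hLH
  obtain ⟨LE, hLE⟩ := exists_list_getD (betaNum_injective (k := k) (e := e) (K := K))
    (fun β => (ι β, QL β, LH β)) (0, [], [])
  obtain ⟨LJ, hLJ⟩ : ∃ LJ : List ℕ, ∀ (i : Fin r) (d : Fin e), d ∈ J i ↔ Nat.pair i d ∈ LJ := by
    refine ⟨((Finset.univ.filter fun v : Fin r × Fin e => v.2 ∈ J v.1).toList.map
      fun v => Nat.pair v.1 v.2), fun i d => ?_⟩
    simp only [List.mem_map, Finset.mem_toList, Finset.mem_filter, Finset.mem_univ, true_and,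
      Nat.pair_eq_pair, Prod.exists]
    refine ⟨fun h => ⟨i, d, h, rfl, rfl⟩, ?_⟩
    rintro ⟨i', d', h, h1, h2⟩
    rwa [← Fin.ext h1, ← Fin.ext h2]
  obtain ⟨D, hD⟩ : ∃ D : CertData, D = (r, LJ, Lm, LX, LY, LU, LE) := ⟨_, rfl⟩
  have hDX : ∀ a (s : Fin n), h (certX n D (gcode a) s) = x q (bX a) s := by
    intro a s
    rw [certX, hD, hx]
    exact congrArg h (hLX (a, s))
  have hDY : ∀ a (i : Fin r), h (certY e K D (gcode a) i) = x q (bY i a).1 (bY i a).2 := by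
    intro a i
    rw [certY, hD]
    simp only
    rw [maskNum_eq hLJ, hx, hbY i a (maskFun (J i) a) fun d hd => by simp [maskFun, hd]]
    exact congrArg h (hLY (i, maskFun (J i) a))
  have hDE : ∀ β : Fin e → Fin k → Fin K, certE D (betaNum β) = (ι β, QL β, LH β) := by
    intro β
    rw [certE, hD]
    exact hLE β
  have hDr : D.1 = r := by rw [hD]
  have hJc : ((List.range e).all fun d => (List.range D.1).any fun i =>
      D.2.1.contains (Nat.pair i d)) = true := by
    rw [List.all_eq_true]
    intro t ht
    obtain ⟨i, hi⟩ := hJ ⟨t, List.mem_range.1 ht⟩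
    rw [hDr, List.any_eq_true]
    refine ⟨i, List.mem_range.2 i.2, ?_⟩
    rw [hD]
    simpa using (hLJ _ _).1 hi
  have hann : ∀ a (s : Fin n) (Q : PolyL) (X : ℕ) (Y : ℕ → ℕ) (w : Fin r → R),
      h X = x q (bX a) s → (∀ i : Fin r, h (Y i) = w i) → h (annTerm l D.1 X Y Q) =
        MvPolynomial.aeval (fun o : Option (Fin r) => o.elim (x q (bX a) s) w)
          (polyVal (polyVar c' annVar) Q) := by
    intro a s Q X Y w hX hY
    rw [annTerm, hDr, hh.polyTerm_annVar hca]
    refine congrArg (fun w : Option (Fin r) → R => MvPolynomial.aeval w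
      (polyVal (polyVar c' annVar) Q)) (funext fun o => ?_)
    cases o with
    | none => exact hX
    | some i => exact hY i
  have hpm' : ∀ s : Fin n, D.2.2.1.getD s [] = pm s := fun s => by
    rw [hD]
    exact hLm s
  have hdR : algebraMap F R d ≠ 0 := by simpa using hd
  refine ⟨D, ?_, ?_⟩
  · simp only [certZero, List.mem_append, List.mem_flatMap, List.mem_map, List.mem_range,
      List.mem_singleton]
    rintro t ((rfl | ⟨a, ha, s, hs, rfl⟩) | ⟨b, hb, rfl⟩)
    · rw [hJc]
      exact hh.zero
    · obtain ⟨a, rfl⟩ := exists_gcode_eq ha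
      lift s to Fin n using hs
      rw [hann a s _ _ _ _ (hDX a s) (hDY a), hpm', hpm, map_mul, hm0, mul_zero]
    · obtain ⟨β, rfl⟩ := exists_betaNum_eq hb
      have h2 := congrArg (MvPolynomial.aeval (Sum.elim
          (fun v : (Fin e → Fin K) × Fin n => h (tvarX l (gcode v.1 * n + v.2)))
          fun v : Fin r × (Fin e → Fin K) => h (tvarY l (v.1 * K ^ e + gcode v.2)))) (hid β)
      rw [map_mul, map_pow, map_sum] at h2
      rw [hh.add, hh.mul, hh.pow, hh.neg, hh.sumL, hh.edgeTerm hca hPc, hDr,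
        hh.polyTerm_gridVar hca, List.map_map, sum_map_range_gcode, hDE, add_neg_eq_zero]
      refine Eq.trans (congrArg₂ (· * ·) (congrArg₂ (· ^ ·) ?_ rfl) rfl) (h2.trans ?_)
      · rw [gridPoly, MvPolynomial.aeval_rename]
        rfl
      · refine Finset.sum_congr rfl fun v _ => ?_
        rw [Function.comp_apply, hh.mul, hh.polyTerm_gridVar hca, hLH, map_mul,
          MvPolynomial.aeval_rename, mul_add_mod_of_lt v.2.2, mul_add_div_of_lt v.2.2, annTerm,
          hh.polyTerm_annVar hca, hpm']
        refine congrArg₂ (· * ·) rfl (congrArg (fun w : Option (Fin r) → R =>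
          MvPolynomial.aeval w (polyVal (polyVar c' annVar) (pm v.2))) ?_)
        funext o
        cases o with
        | none => rfl
        | some j =>
          simp only [Option.elim_some, Function.comp_apply, Sum.elim_inr]
          rw [hD, maskNum_eq hLJ]
  · simp only [certNe, List.mem_append, List.mem_flatMap, List.mem_map, List.mem_range]
    rintro t ((⟨a, ha, s, hs, rfl⟩ | ⟨a, ha, i, hi, rfl⟩) | ⟨b, hb, rfl⟩)
    · obtain ⟨a, rfl⟩ := exists_gcode_eq ha
      lift s to Fin n using hs
      rw [hann a s _ _ _ _ (hDX a s) (hDY a), hpm',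
        ← show annVar (r := r) none = Nat.pair 1 0 from rfl,
          pderiv_polyVal c' annVar_injective hann0, hpm, MvPolynomial.pderiv_C_mul, map_mul,
        MvPolynomial.aeval_C]
      exact mul_ne_zero hdR (hm1 a s)
    · obtain ⟨a, rfl⟩ := exists_gcode_eq ha
      rw [hDr] at hi
      lift i to Fin r using hi
      have hU : D.2.2.2.2.2.1.getD (gcode a * D.1 + i) 0 =
          Nat.pair (sl a i) (tnum (z a i)) := by
        rw [hDr, hD]
        exact hLU (a, i)
      have hS : certS n D (gcode a) i = sl a i := by
        rw [certS, hU, Nat.unpair_pair]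
        exact Nat.mod_eq_of_lt (sl a i).2
      rw [hS, hU, Nat.unpair_pair, hann a (sl a i) _ _ _
        (Function.update (fun i => x q (bY i a).1 (bY i a).2) i (z a i : R)) (hDX a _), hpm', hpm,
        map_mul, MvPolynomial.aeval_C]
      · exact mul_ne_zero hdR (hz a i)
      · intro j
        rw [Bool.cond_eq_ite, Function.update_apply]
        by_cases hji : j = i
        · simp [hji, hh.num]
        · have : (j : ℕ) ≠ i := fun h => hji (Fin.ext h)
          simp [hji, this, hDY]
    · obtain ⟨β, rfl⟩ := exists_betaNum_eq hb
      rw [hDr, hh.polyTerm_gridVar hca, hDE]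
      have h2 : MvPolynomial.aeval (Sum.elim (fun v => x q (bX v.1) v.2)
          fun v => x q (bY v.1 v.2).1 (bY v.1 v.2).2)
          (polyVal (polyVar c' gridVar) (QL β)) ≠ 0 := by
        rw [hQL, map_mul, MvPolynomial.aeval_C]
        exact mul_ne_zero (by simpa using hd' β) (hQ β)
      intro hcon
      refine h2 ((congrArg (fun w : _ → R => MvPolynomial.aeval w
        (polyVal (polyVar c' gridVar) (QL β))) ?_).trans hcon)
      funext v
      rcases v with v | v
      · exact (hDX v.1 v.2).symm
      · simp only [Sum.elim_inr]
        rw [mul_add_mod_of_lt (gcode_lt _), mul_add_div_of_lt (gcode_lt _), hDY]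

/-- The axioms of commutative rings, as equations between terms. -/
def ringEqs (s t u : ℕ) : List ℕ :=
  [Nat.pair (tadd (tadd s t) u) (tadd s (tadd t u)), Nat.pair (tadd tzero s) s,
    Nat.pair (tadd (tneg s) s) tzero, Nat.pair (tmul (tmul s t) u) (tmul s (tmul t u)),
    Nat.pair (tmul s t) (tmul t s), Nat.pair (tmul tone s) s,
    Nat.pair (tmul s (tadd t u)) (tadd (tmul s t) (tmul s u))]

/-- The clauses stating that a relation between terms is the equality in a commutative ring
without zero divisors of characteristic zero. A literal is an equation `Nat.pair s t` together
with a truth value. -/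
def domainClauses (s t u v : ℕ) : List (List (ℕ × Bool)) :=
  [[(Nat.pair s s, true)],
    [(Nat.pair s t, false), (Nat.pair s u, false), (Nat.pair t u, true)],
    [(Nat.pair s t, false), (Nat.pair u v, false), (Nat.pair (tadd s u) (tadd t v), true)],
    [(Nat.pair s t, false), (Nat.pair u v, false), (Nat.pair (tmul s u) (tmul t v), true)],
    [(Nat.pair s t, false), (Nat.pair (tneg s) (tneg t), true)],
    [(Nat.pair (tmul s t) tzero, false), (Nat.pair s tzero, true), (Nat.pair t tzero, true)],
    [(Nat.pair (tnum (s + 1)) tzero, false)]] ++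
  (ringEqs s t u).map fun a => [(a, true)]

/-- A clause is true if one of its literals has the prescribed truth value. -/
def ClauseTrue (T : ℕ → Prop) (L : List (ℕ × Bool)) : Prop := ∃ x ∈ L, (T x.1 ↔ x.2 = true)

/-- The truth values of equations under an interpretation of terms. -/
def EqTrue {S : Type*} (h : ℕ → S) (a : ℕ) : Prop := h a.unpair.1 = h a.unpair.2

@[simp]
theorem eqTrue_pair {S : Type*} (h : ℕ → S) (s t : ℕ) : EqTrue h (Nat.pair s t) ↔ h s = h t := by
  rw [EqTrue, Nat.unpair_pair]

theorem TermHom.clauseTrue_domainClauses {S : Type*} [CommRing S] [IsDomain S] [CharZero S]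
    {h : ℕ → S} (hh : TermHom h) {s t u v : ℕ} {L : List (ℕ × Bool)}
    (hL : L ∈ domainClauses s t u v) : ClauseTrue (EqTrue h) L := by
  have hn : (s : S) + 1 ≠ 0 := by exact_mod_cast Nat.succ_ne_zero s
  have hn' := hh.num (s + 1)
  push_cast at hn'
  simp only [domainClauses, ringEqs, List.map_cons, List.map_nil, List.cons_append,
    List.nil_append, List.mem_cons, List.not_mem_nil, or_false] at hL
  rcases hL with rfl | rfl | rfl | rfl | rfl | rfl | rfl | rfl | rfl | rfl | rfl | rfl |
    rfl | rfl <;>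
    simp [ClauseTrue, hh.add, hh.mul, hh.zero, hh.neg, hh.one, hn', hn, add_assoc,
      mul_comm, mul_add] <;> grind

/-- A relation between terms satisfying the clauses for domains is the equality in a countable
field of characteristic zero. -/
theorem exists_termHom_of_clauseTrue {T : ℕ → Prop}
    (hT : ∀ s t u v, ∀ L ∈ domainClauses s t u v, ClauseTrue T L) :
    ∃ (R : Type) (_ : Field R) (_ : CharZero R) (_ : Countable R) (h : ℕ → R),
      TermHom h ∧ ∀ s t, h s = h t ↔ T (Nat.pair s t) := by
  simp only [domainClauses, ringEqs, List.map_cons, List.map_nil, List.cons_append,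
    List.nil_append, List.forall_mem_cons, ClauseTrue, List.exists_mem_cons_iff] at hT
  simp only [List.not_mem_nil, false_and, exists_false, or_false, Bool.false_eq_true, iff_false,
    iff_true, IsEmpty.forall_iff, implies_true, and_true] at hT
  have hrefl : ∀ s, T (Nat.pair s s) := fun s => (hT s 0 0 0).1
  have heuc : ∀ s t u, T (Nat.pair s t) → T (Nat.pair s u) → T (Nat.pair t u) :=
    fun s t u h1 h2 => by have := (hT s t u 0).2.1; tauto
  let st : Setoid ℕ := ⟨fun s t => T (Nat.pair s t), hrefl,
    fun {s t} h => heuc s t s h (hrefl s),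
    fun {s t u} h1 h2 => heuc t s u (heuc s t s h1 (hrefl s)) h2⟩
  let add : Quotient st → Quotient st → Quotient st := Quotient.map₂ tadd fun s t h1 u v h2 => by
    have h3 := (hT s t u v).2.2.1
    have h1 : T (Nat.pair s t) := h1
    have h2 : T (Nat.pair u v) := h2
    change T _
    tauto
  let mul : Quotient st → Quotient st → Quotient st := Quotient.map₂ tmul fun s t h1 u v h2 => by
    have h3 := (hT s t u v).2.2.2.1
    have h1 : T (Nat.pair s t) := h1
    have h2 : T (Nat.pair u v) := h2
    change T _
    tauto
  let neg : Quotient st → Quotient st := Quotient.map tneg fun s t h1 => by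
    have h3 := (hT s t 0 0).2.2.2.2.1
    have h1 : T (Nat.pair s t) := h1
    change T _
    tauto
  let iA : Add (Quotient st) := ⟨add⟩
  let iM : Mul (Quotient st) := ⟨mul⟩
  let iN : Neg (Quotient st) := ⟨neg⟩
  let i0 : Zero (Quotient st) := ⟨⟦tzero⟧⟩
  let i1 : One (Quotient st) := ⟨⟦tone⟧⟩
  let iR : CommRing (Quotient st) := CommRing.ofMinimalAxioms
    (by
      rintro ⟨s⟩ ⟨t⟩ ⟨u⟩
      exact Quotient.sound (hT s t u 0).2.2.2.2.2.2.2.1)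
    (by
      rintro ⟨s⟩
      exact Quotient.sound (hT s 0 0 0).2.2.2.2.2.2.2.2.1)
    (by
      rintro ⟨s⟩
      exact Quotient.sound (hT s 0 0 0).2.2.2.2.2.2.2.2.2.1)
    (by
      rintro ⟨s⟩ ⟨t⟩ ⟨u⟩
      exact Quotient.sound (hT s t u 0).2.2.2.2.2.2.2.2.2.2.1)
    (by
      rintro ⟨s⟩ ⟨t⟩
      exact Quotient.sound (hT s t 0 0).2.2.2.2.2.2.2.2.2.2.2.1)
    (by
      rintro ⟨s⟩
      exact Quotient.sound (hT s 0 0 0).2.2.2.2.2.2.2.2.2.2.2.2.1)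
    (by
      rintro ⟨s⟩ ⟨t⟩ ⟨u⟩
      exact Quotient.sound (hT s t u 0).2.2.2.2.2.2.2.2.2.2.2.2.2)
  have hq : TermHom (fun s => (⟦s⟧ : Quotient st)) :=
    ⟨rfl, rfl, fun _ _ => rfl, fun _ _ => rfl, fun _ => rfl⟩
  have h0 : ∀ s, (⟦s⟧ : Quotient st) = 0 ↔ T (Nat.pair s tzero) := fun s => Quotient.eq
  have hcz : ∀ n : ℕ, ((n + 1 : ℕ) : Quotient st) ≠ 0 := by
    intro n hn
    rw [← hq.num, h0] at hn
    exact (hT n 0 0 0).2.2.2.2.2.2.1 hn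
  have hnt : Nontrivial (Quotient st) := ⟨1, 0, by simpa using hcz 0⟩
  have hnz : NoZeroDivisors (Quotient st) := ⟨by
    rintro ⟨s⟩ ⟨t⟩ hst
    have h1 : T (Nat.pair (tmul s t) tzero) := (h0 _).1 hst
    have h2 := (hT s t 0 0).2.2.2.2.2.1
    have h3 : T (Nat.pair s tzero) ∨ T (Nat.pair t tzero) := by tauto
    exact h3.imp (h0 s).2 (h0 t).2⟩
  have hdom : IsDomain (Quotient st) := NoZeroDivisors.to_isDomain _
  have hch : CharZero (Quotient st) := charZero_of_inj_zero fun n hn => by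
    cases n with
    | zero => rfl
    | succ n => exact absurd hn (hcz n)
  have hcount : Countable (FractionRing (Quotient st)) :=
    (IsLocalization.mk'_surjective (nonZeroDivisors (Quotient st))
      (S := FractionRing (Quotient st))).countable
  refine ⟨FractionRing (Quotient st), inferInstance,
    charZero_of_injective_algebraMap (IsFractionRing.injective (Quotient st) _), hcount,
    fun s => algebraMap (Quotient st) _ ⟦s⟧, hq.comp (algebraMap _ _), fun s t => ?_⟩
  rw [(IsFractionRing.injective (Quotient st) (FractionRing (Quotient st))).eq_iff]
  exact Quotient.eq

/-- If no initial segment of a sequence of clauses is refuted, then there is an assignment making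
all clauses true. -/
theorem exists_forall_clauseTrue {C : ℕ → List (ℕ × Bool)}
    (hC : ∀ N, ∃ T : ℕ → Prop, ∀ i < N, ∃ x ∈ C i, x.1 < N → (T x.1 ↔ x.2 = true)) :
    ∃ T : ℕ → Prop, ∀ i, ClauseTrue T (C i) := by
  choose T hT using hC
  refine ⟨fun a => ∀ᶠ N in Filter.hyperfilter ℕ, T N a, fun i => ?_⟩
  by_contra hcon
  simp only [ClauseTrue, not_exists, not_and] at hcon
  have h1 : ∀ x ∈ C i, ∀ᶠ N in (Filter.hyperfilter ℕ : Filter ℕ), ¬ (T N x.1 ↔ x.2 = true) := by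
    intro x hx
    have h2 := hcon x hx
    cases hx2 : x.2
    · simp only [hx2, Bool.false_eq_true, iff_false, not_not] at h2 ⊢
      exact h2
    · simp only [hx2, iff_true] at h2 ⊢
      exact Ultrafilter.eventually_not.2 h2
  have h3 : ∀ b : ℕ, ∀ᶠ N in (Filter.hyperfilter ℕ : Filter ℕ), b < N := fun b =>
    Nat.hyperfilter_le_atTop (Filter.eventually_gt_atTop b)
  have h4 : ∀ᶠ N in (Filter.hyperfilter ℕ : Filter ℕ), ∀ x ∈ C i,
      x.1 < N ∧ ¬ (T N x.1 ↔ x.2 = true) :=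
    ((List.finite_toSet (C i)).eventually_all).2 fun x hx => (h3 x.1).and (h1 x hx)
  obtain ⟨N, hN, hiN⟩ := (h4.and (h3 i)).exists
  obtain ⟨x, hx, hxN⟩ := hT N i hiN
  exact (hN x hx).2 (hxN (hN x hx).1)

/-- The equations and inequations which the points of the `q`-th grid have to satisfy. -/
def gridClauses (k n l e Pc : ℕ) (p : PolyL) (q a b : ℕ) : List (List (ℕ × Bool)) :=
  [bif decide (a < (q ^ k) ^ e) then
      [(Nat.pair (edgeTerm k n l e q Pc p (tvarG l q) a) tzero, true)] else [(Nat.pair 0 0, true)],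
    bif decide (a < q ^ e) && decide (b < q ^ e) && !(a == b) then (List.range n).map fun s =>
      (Nat.pair (tvarG l q (a * n + s)) (tvarG l q (b * n + s)), false)
      else [(Nat.pair 0 0, true)]]

/-- The enumeration of the clauses about grids. -/
def gridClause (k n l e Pc : ℕ) (p : PolyL) (i : ℕ) : List (ℕ × Bool) :=
  (gridClauses k n l e Pc p i.unpair.2.unpair.1 i.unpair.2.unpair.2.unpair.1
    i.unpair.2.unpair.2.unpair.2).getD i.unpair.1 [(Nat.pair 0 0, true)]

/-- The clause stating that a certificate fails. -/
def certClause (k n l e K Pc : ℕ) (p : PolyL) (D : CertData) : List (ℕ × Bool) :=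
  (certZero k n l e K Pc p D).map (fun t => (Nat.pair t tzero, false)) ++
    (certNe k n l e K D).map fun t => (Nat.pair t tzero, true)

/-- The enumeration of all clauses. -/
def allClause (k n l e K Pc : ℕ) (p : PolyL) (i : ℕ) : List (ℕ × Bool) :=
  bif i.unpair.1 == 0 then gridClause k n l e Pc p i.unpair.2
  else bif i.unpair.1 == 1 then
    certClause k n l e K Pc p ((Encodable.decode (α := CertData) i.unpair.2).getD default)
  else (domainClauses i.unpair.2.unpair.1 i.unpair.2.unpair.2.unpair.1
    i.unpair.2.unpair.2.unpair.2.unpair.1 i.unpair.2.unpair.2.unpair.2.unpair.2).getD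
      (i.unpair.1 - 2) [(Nat.pair 0 0, true)]

/-- Whether the first `N` clauses, restricted to the first `N` equations, are contradictory. -/
def refutes (k n l e K Pc : ℕ) (p : PolyL) (N : ℕ) : Bool :=
  (List.range (2 ^ N)).all fun w => (List.range N).any fun i =>
    (allClause k n l e K Pc p i).all fun x =>
      decide (x.1 < N) && !((dig 2 w x.1 == 1) == x.2)

theorem exists_dig_two_eq_one_iff (T : ℕ → Prop) (N : ℕ) :
    ∃ w < 2 ^ N, ∀ a < N, dig 2 w a = 1 ↔ T a := by
  classical
  refine ⟨gcode fun d : Fin N => if T d then (1 : Fin 2) else 0, gcode_lt _, fun a ha => ?_⟩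
  rw [dig_gcode (fun d : Fin N => if T d then (1 : Fin 2) else 0) ⟨a, ha⟩]
  by_cases h : T a <;> simp [h]

theorem not_forall_clauseTrue_of_refutes {k n l e K Pc : ℕ} {p : PolyL} {N : ℕ}
    (hN : refutes k n l e K Pc p N = true) (T : ℕ → Prop) :
    ∃ i < N, ¬ ClauseTrue T (allClause k n l e K Pc p i) := by
  obtain ⟨w, hw, hwT⟩ := exists_dig_two_eq_one_iff T N
  rw [refutes, List.all_eq_true] at hN
  obtain ⟨i, hi, h1⟩ := List.any_eq_true.1 (hN w (List.mem_range.2 hw))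
  refine ⟨i, List.mem_range.1 hi, ?_⟩
  rintro ⟨x, hx, hxT⟩
  have h2 := List.all_eq_true.1 h1 x hx
  simp only [Bool.and_eq_true, decide_eq_true_eq, Bool.not_eq_true', beq_eq_false_iff_ne] at h2
  have h3 := hwT _ h2.1
  apply h2.2
  rw [Bool.eq_iff_iff, beq_iff_eq]
  exact h3.trans hxT

theorem gridClause_pair (k n l e Pc : ℕ) (p : PolyL) (f q a b : ℕ) :
    gridClause k n l e Pc p (Nat.pair f (Nat.pair q (Nat.pair a b))) =
      (gridClauses k n l e Pc p q a b).getD f [(Nat.pair 0 0, true)] := by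
  simp [gridClause]

theorem allClause_pair_zero (k n l e K Pc : ℕ) (p : PolyL) (j : ℕ) :
    allClause k n l e K Pc p (Nat.pair 0 j) = gridClause k n l e Pc p j := by
  simp [allClause]

theorem allClause_pair_one (k n l e K Pc : ℕ) (p : PolyL) (D : CertData) :
    allClause k n l e K Pc p (Nat.pair 1 (Encodable.encode D)) = certClause k n l e K Pc p D := by
  simp [allClause]

theorem allClause_pair_add_two (k n l e K Pc : ℕ) (p : PolyL) (i s t u v : ℕ) :
    allClause k n l e K Pc p
      (Nat.pair (i + 2) (Nat.pair s (Nat.pair t (Nat.pair u v)))) =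
      (domainClauses s t u v).getD i [(Nat.pair 0 0, true)] := by
  simp [allClause]

theorem clauseTrue_certClause {S : Type*} [CommRing S] {h : ℕ → S} (hh : TermHom h)
    {k n l e K Pc : ℕ} {p : PolyL} {D : CertData} :
    ¬ ClauseTrue (EqTrue h) (certClause k n l e K Pc p D) ↔
      (∀ t ∈ certZero k n l e K Pc p D, h t = 0) ∧ ∀ t ∈ certNe k n l e K D, h t ≠ 0 := by
  simp only [ClauseTrue, certClause, List.mem_append, or_and_right, exists_or, List.mem_map,
    not_or, not_exists, not_and]
  refine and_congr ⟨fun h1 t ht => ?_, fun h1 x => ?_⟩ ⟨fun h1 t ht h0 => ?_, fun h1 x => ?_⟩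
  · by_contra h0
    exact h1 _ ⟨t, ht, rfl⟩ (by simpa [hh.zero] using h0)
  · rintro ⟨t, ht, rfl⟩
    simpa [hh.zero] using h1 t ht
  · exact h1 _ ⟨t, ht, rfl⟩ (by simpa [hh.zero] using h0)
  · rintro ⟨t, ht, rfl⟩
    simpa [hh.zero] using h1 t ht

theorem clauseTrue_refl {T : ℕ → Prop} (h : T (Nat.pair 0 0)) :
    ClauseTrue T [(Nat.pair 0 0, true)] := ⟨_, List.mem_singleton.2 rfl, by simpa using h⟩

/-- Some initial segment of the clauses is refuted. -/
theorem exists_refutes {k n l e Pc : ℕ} (hk : 0 < k)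
    (hle : Order.succ^[e] ℵ₀ ≤ (𝔠 : Cardinal.{0})) {P : Fin k → Fin e → Fin k}
    (hPc : ∀ (j : Fin k) (d : Fin e), dig k (dig (k ^ e) Pc j) d = P j d) (p : PolyL) (K : ℕ) :
    ∃ N, refutes k n l e K Pc p N = true := by
  by_contra hcon
  have hC : ∀ N, ∃ T : ℕ → Prop, ∀ i < N, ∃ x ∈ allClause k n l e K Pc p i,
      x.1 < N → (T x.1 ↔ x.2 = true) := by
    intro N
    have h1 : ¬ refutes k n l e K Pc p N = true := fun h => hcon ⟨N, h⟩
    rw [refutes, List.all_eq_true] at h1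
    push Not at h1
    obtain ⟨w, -, hw⟩ := h1
    refine ⟨fun a => dig 2 w a = 1, fun i hi => ?_⟩
    rw [ne_eq, List.any_eq_true] at hw
    push Not at hw
    have h2 := hw i (List.mem_range.2 hi)
    rw [ne_eq, List.all_eq_true] at h2
    push Not at h2
    obtain ⟨x, hx, hx2⟩ := h2
    refine ⟨x, hx, fun hxN => ?_⟩
    simp only [hxN, decide_true, Bool.true_and, ne_eq, Bool.not_eq_true', Bool.not_eq_false,
      beq_iff_eq] at hx2
    rw [← hx2, beq_iff_eq]
  obtain ⟨T, hT⟩ := exists_forall_clauseTrue hC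
  obtain ⟨R, _, _, _, h, hh, hhT⟩ := exists_termHom_of_clauseTrue (T := T) (by
    intro s t u v L hL
    obtain ⟨i, hi, rfl⟩ := List.getElem_of_mem hL
    have h1 := hT (Nat.pair (i + 2) (Nat.pair s (Nat.pair t (Nat.pair u v))))
    rwa [allClause_pair_add_two, List.getD_eq_getElem _ _ hi] at h1)
  have hTE : T = EqTrue h := by
    funext a
    rw [EqTrue, hhT, Nat.pair_unpair]
  subst hTE
  have hG : ∀ f q a b, ClauseTrue (EqTrue h)
      ((gridClauses k n l e Pc p q a b).getD f [(Nat.pair 0 0, true)]) := by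
    intro f q a b
    rw [← gridClause_pair, ← allClause_pair_zero (K := K)]
    exact hT _
  obtain ⟨D, hD⟩ := exists_cert_of_grids hh (n := n) (l := l) hk hle hPc (p := p) (by
    intro q a a' haa
    by_contra hne
    obtain ⟨x, hx, hx2⟩ := hG 1 q (gcode a) (gcode a')
    have hb : (gcode a == gcode a') = false := by simpa using fun h => hne (gcode_injective h)
    simp only [gridClauses, List.getD_cons_succ, List.getD_cons_zero, gcode_lt, decide_true,
      Bool.and_self, hb, Bool.not_false, cond_true, List.mem_map, List.mem_range] at hx
    obtain ⟨s, hs, rfl⟩ := hx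
    rw [eqTrue_pair] at hx2
    exact Bool.false_ne_true (hx2.1 (haa ⟨s, hs⟩))) (by
    intro q b hb
    obtain ⟨x, hx, hx2⟩ := hG 0 q b 0
    simp only [gridClauses, List.getD_cons_zero, hb, decide_true, cond_true,
      List.mem_singleton] at hx
    subst hx
    rwa [eqTrue_pair, hh.zero, iff_true_right rfl] at hx2) K
  have h3 := hT (Nat.pair 1 (Encodable.encode D))
  rw [allClause_pair_one] at h3
  exact (clauseTrue_certClause hh).2 hD h3

/-- If a set of clauses is refuted and the clauses about grids hold in the real numbers, then
the given polynomial relation holds on good arrangements. -/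
theorem goodArr_of_refutes {F : Type} [Field F] [Algebra F ℝ] {h : ℕ → ℝ} (hh : TermHom h)
    {c : ℕ → F} {l : ℕ} (hc : ∀ j, h (if j < l then tvar j else tzero) = algebraMap F ℝ (c j))
    (hz : AlgebraicIndependent F fun i => h (tvar (l + Nat.pair 1 i))) {k n e K Pc : ℕ}
    (hn : 0 < n) {P : Fin k → Fin e → Fin k} (hP : Function.Injective P)
    (hPc : ∀ (j : Fin k) (d : Fin e), dig k (dig (k ^ e) Pc j) d = P j d) {p : PolyL}
    (hK : gridBound e k (k * p.length) e ≤ K) {N : ℕ} (hN : refutes k n l e K Pc p N = true)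
    (hg : ∀ i < N, ClauseTrue (EqTrue h) (gridClause k n l e Pc p i)) :
    GoodArr (polyRel (R := ℝ) (polyVal (polyVar c (edgeVar (k := k) (n := n))) p)) e := by
  obtain ⟨i, hi, hcl⟩ := not_forall_clauseTrue_of_refutes hN (EqTrue h)
  obtain ⟨f, j, rfl⟩ : ∃ f j, i = Nat.pair f j := ⟨_, _, (Nat.pair_unpair i).symm⟩
  rcases f with _ | _ | f
  · rw [allClause_pair_zero] at hcl
    exact absurd (hg j ((Nat.right_le_pair 0 j).trans_lt hi)) hcl
  · simp only [allClause, zero_add, Nat.unpair_pair, beq_self_eq_true,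
      cond_true, Nat.reduceBEq, cond_false] at hcl
    obtain ⟨h0, h1⟩ := (clauseTrue_certClause hh).1 hcl
    exact goodArr_of_cert hh hc hz hn hP hPc hK h0 h1
  · refine absurd ?_ hcl
    obtain ⟨s, t, u, v, rfl⟩ : ∃ s t u v, j = Nat.pair s (Nat.pair t (Nat.pair u v)) :=
      ⟨j.unpair.1, j.unpair.2.unpair.1, j.unpair.2.unpair.2.unpair.1,
        j.unpair.2.unpair.2.unpair.2, by simp⟩
    rw [allClause_pair_add_two]
    by_cases hf : f < (domainClauses s t u v).length
    · rw [List.getD_eq_getElem _ _ hf]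
      exact hh.clauseTrue_domainClauses (List.getElem_mem hf)
    · rw [List.getD_eq_default _ _ (not_lt.1 hf)]
      exact clauseTrue_refl ((eqTrue_pair h 0 0).2 rfl)

/-! ### Codes of formulas -/

theorem unpair_snd_lt {s : ℕ} (h : s.unpair.1 ≠ 0) : s.unpair.2 < s := by
  conv_rhs => rw [← Nat.pair_unpair s]
  exact (Nat.right_le_pair 0 _).trans_lt (Nat.pair_lt_pair_left _ (Nat.pos_of_ne_zero h))

/-- The value of a coded term. -/
noncomputable def codeEval (v : ℕ → ℝ) (s : ℕ) : ℝ :=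
  if _h0 : s.unpair.1 = 0 then v s.unpair.2
  else if s.unpair.1 = 1 then 0
  else if s.unpair.1 = 2 then 1
  else if s.unpair.1 = 3 then
    codeEval v s.unpair.2.unpair.1 + codeEval v s.unpair.2.unpair.2
  else if s.unpair.1 = 4 then
    codeEval v s.unpair.2.unpair.1 * codeEval v s.unpair.2.unpair.2
  else -codeEval v s.unpair.2
termination_by s
decreasing_by
  · exact (Nat.unpair_left_le _).trans_lt (unpair_snd_lt _h0)
  · exact (Nat.unpair_right_le _).trans_lt (unpair_snd_lt _h0)
  · exact (Nat.unpair_left_le _).trans_lt (unpair_snd_lt _h0)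
  · exact (Nat.unpair_right_le _).trans_lt (unpair_snd_lt _h0)
  · exact unpair_snd_lt _h0

theorem codeEval_tvar (v : ℕ → ℝ) (i : ℕ) : codeEval v (tvar i) = v i := by
  rw [codeEval]
  simp [tvar]

theorem termHom_codeEval (v : ℕ → ℝ) : TermHom (codeEval v) := by
  refine ⟨?_, ?_, fun s t => ?_, fun s t => ?_, fun t => ?_⟩
  · rw [codeEval]
    simp [tzero]
  · rw [codeEval]
    simp [tone]
  · rw [codeEval]
    simp [tadd]
  · rw [codeEval]
    simp [tmul]
  · rw [codeEval]
    simp [tneg]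

theorem codeEval_code (v : ℕ → ℝ) (t : OFTerm) : codeEval v t.code = t.eval v := by
  have hh := termHom_codeEval v
  induction t with
  | var i => exact codeEval_tvar v i
  | zero => exact hh.zero
  | one => exact hh.one
  | add s t hs ht => exact (hh.add _ _).trans (by rw [hs, ht]; rfl)
  | mul s t hs ht => exact (hh.mul _ _).trans (by rw [hs, ht]; rfl)
  | neg t ht => exact (hh.neg _).trans (by rw [ht]; rfl)

theorem OFTerm.eval_congr {v v' : ℕ → ℝ} (t : OFTerm) (h : ∀ i ∈ t.fv, v i = v' i) :
    t.eval v = t.eval v' := by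
  induction t with
  | var i => exact h i (by simp [OFTerm.fv])
  | zero => rfl
  | one => rfl
  | add s t hs ht =>
    exact congrArg₂ (· + ·) (hs fun i hi => h i (by simp [OFTerm.fv, hi]))
      (ht fun i hi => h i (by simp [OFTerm.fv, hi]))
  | mul s t hs ht =>
    exact congrArg₂ (· * ·) (hs fun i hi => h i (by simp [OFTerm.fv, hi]))
      (ht fun i hi => h i (by simp [OFTerm.fv, hi]))
  | neg t ht => exact congrArg (- ·) (ht h)

theorem OFFml.realize_congr {v v' : ℕ → ℝ} (φ : OFFml) (h : ∀ i ∈ φ.fv, v i = v' i) :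
    φ.Realize v ↔ φ.Realize v' := by
  induction φ generalizing v v' with
  | eq s t =>
    simp only [OFFml.Realize, s.eval_congr fun i hi => h i (by simp [OFFml.fv, hi]),
      t.eval_congr fun i hi => h i (by simp [OFFml.fv, hi])]
  | le s t =>
    simp only [OFFml.Realize, s.eval_congr fun i hi => h i (by simp [OFFml.fv, hi]),
      t.eval_congr fun i hi => h i (by simp [OFFml.fv, hi])]
  | not φ hφ => exact not_congr (hφ h)
  | and φ ψ hφ hψ =>
    exact and_congr (hφ fun i hi => h i (by simp [OFFml.fv, hi]))
      (hψ fun i hi => h i (by simp [OFFml.fv, hi]))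
  | ex j φ hφ =>
    refine exists_congr fun r => hφ fun i hi => ?_
    by_cases hij : i = j
    · simp [hij]
    · simpa [hij] using h i (by simp [OFFml.fv, hi, hij])

theorem OFTerm.le_code (t : OFTerm) : ∀ i ∈ t.fv, i ≤ t.code := by
  induction t with
  | var i => simpa [OFTerm.fv, OFTerm.code] using Nat.right_le_pair 0 i
  | zero => simp [OFTerm.fv]
  | one => simp [OFTerm.fv]
  | add s t hs ht =>
    intro i hi
    rcases Finset.mem_union.1 hi with hi | hi
    · exact (hs i hi).trans ((Nat.left_le_pair _ _).trans (Nat.right_le_pair _ _))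
    · exact (ht i hi).trans ((Nat.right_le_pair _ _).trans (Nat.right_le_pair _ _))
  | mul s t hs ht =>
    intro i hi
    rcases Finset.mem_union.1 hi with hi | hi
    · exact (hs i hi).trans ((Nat.left_le_pair _ _).trans (Nat.right_le_pair _ _))
    · exact (ht i hi).trans ((Nat.right_le_pair _ _).trans (Nat.right_le_pair _ _))
  | neg t ht => exact fun i hi => (ht i hi).trans (Nat.right_le_pair _ _)

theorem OFFml.le_code (φ : OFFml) : ∀ i ∈ φ.fv, i ≤ φ.code := by
  induction φ with
  | eq s t =>
    intro i hi
    rcases Finset.mem_union.1 hi with hi | hi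
    · exact (s.le_code i hi).trans ((Nat.left_le_pair _ _).trans (Nat.right_le_pair _ _))
    · exact (t.le_code i hi).trans ((Nat.right_le_pair _ _).trans (Nat.right_le_pair _ _))
  | le s t =>
    intro i hi
    rcases Finset.mem_union.1 hi with hi | hi
    · exact (s.le_code i hi).trans ((Nat.left_le_pair _ _).trans (Nat.right_le_pair _ _))
    · exact (t.le_code i hi).trans ((Nat.right_le_pair _ _).trans (Nat.right_le_pair _ _))
  | not φ hφ => exact fun i hi => (hφ i hi).trans (Nat.right_le_pair _ _)
  | and φ ψ hφ hψ =>
    intro i hi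
    rcases Finset.mem_union.1 hi with hi | hi
    · exact (hφ i hi).trans ((Nat.left_le_pair _ _).trans (Nat.right_le_pair _ _))
    · exact (hψ i hi).trans ((Nat.right_le_pair _ _).trans (Nat.right_le_pair _ _))
  | ex j φ hφ =>
    exact fun i hi => (hφ i (Finset.mem_of_mem_erase hi)).trans
      ((Nat.right_le_pair _ _).trans (Nat.right_le_pair _ _))

/-- `s` is the code of a term. -/
def IsTm (s : ℕ) : Prop := ∃ t : OFTerm, t.code = s

theorem isTm_tvar (i : ℕ) : IsTm (tvar i) := ⟨.var i, rfl⟩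

theorem isTm_tzero : IsTm tzero := ⟨.zero, rfl⟩

theorem isTm_tone : IsTm tone := ⟨.one, rfl⟩

theorem IsTm.add {s t : ℕ} : IsTm s → IsTm t → IsTm (tadd s t) := by
  rintro ⟨s, rfl⟩ ⟨t, rfl⟩
  exact ⟨.add s t, rfl⟩

theorem IsTm.mul {s t : ℕ} : IsTm s → IsTm t → IsTm (tmul s t) := by
  rintro ⟨s, rfl⟩ ⟨t, rfl⟩
  exact ⟨.mul s t, rfl⟩

theorem IsTm.neg {t : ℕ} : IsTm t → IsTm (tneg t) := by
  rintro ⟨t, rfl⟩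
  exact ⟨.neg t, rfl⟩

theorem isTm_polyTerm {σ : ℕ → ℕ} (hσ : ∀ i, IsTm (σ i)) (Q : PolyL) : IsTm (polyTerm σ Q) := by
  have hm : ∀ L : List ℕ, IsTm (L.foldr (fun i s => tmul (σ i) s) tone) := by
    intro L
    induction L with
    | nil => exact isTm_tone
    | cons i L ih => exact (hσ i).mul ih
  induction Q with
  | nil => exact isTm_tzero
  | cons x Q ih =>
    refine IsTm.add ?_ ih
    cases x.1
    · exact (hm x.2).neg
    · exact hm x.2

theorem isTm_edgeTerm (k n l e K P : ℕ) (p : PolyL) {X : ℕ → ℕ} (hX : ∀ i, IsTm (X i)) (b : ℕ) :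
    IsTm (edgeTerm k n l e K P p X b) := by
  refine isTm_polyTerm (fun i => ?_) p
  obtain ⟨t, j, rfl⟩ : ∃ t j, i = Nat.pair t j := ⟨_, _, (Nat.pair_unpair i).symm⟩
  rcases t with _ | _ | _ | t
  · rw [termSub_zero]
    split_ifs
    exacts [isTm_tvar _, isTm_tzero]
  · rw [termSub_one]
    split_ifs
    exacts [hX _, isTm_tzero]
  · rw [termSub_two, if_neg (by omega)]
    exact isTm_tzero
  · rw [termSub_of_two_lt _ _ _ _ _ _ _ (by omega)]
    exact isTm_tzero

/-- `s` is the code of a formula with free variables in `b` and with the given meaning. -/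
def IsFml (b : Set ℕ) (s : ℕ) (Q : (ℕ → ℝ) → Prop) : Prop :=
  ∃ θ : OFFml, θ.code = s ∧ (∀ i ∈ θ.fv, i ∈ b) ∧ ∀ v, θ.Realize v ↔ Q v

theorem IsFml.not {b : Set ℕ} {s : ℕ} {Q : (ℕ → ℝ) → Prop} :
    IsFml b s Q → IsFml b (Nat.pair 2 s) fun v => ¬ Q v := by
  rintro ⟨θ, rfl, h1, h2⟩
  exact ⟨.not θ, rfl, h1, fun v => not_congr (h2 v)⟩

theorem IsFml.and {b : Set ℕ} {s t : ℕ} {Q Q' : (ℕ → ℝ) → Prop} :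
    IsFml b s Q → IsFml b t Q' → IsFml b (Nat.pair 3 (Nat.pair s t)) fun v => Q v ∧ Q' v := by
  rintro ⟨θ, rfl, h1, h2⟩ ⟨θ', rfl, h1', h2'⟩
  exact ⟨.and θ θ', rfl, fun i hi => (Finset.mem_union.1 hi).elim (h1 i) (h1' i),
    fun v => and_congr (h2 v) (h2' v)⟩

theorem IsFml.congr {b : Set ℕ} {s : ℕ} {Q Q' : (ℕ → ℝ) → Prop}
    (h : IsFml b s Q) (hQ : ∀ v, Q v ↔ Q' v) :
    IsFml b s Q' := by
  obtain ⟨θ, h0, h1, h2⟩ := h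
  exact ⟨θ, h0, h1, fun v => (h2 v).trans (hQ v)⟩

/-- The conjunction of a list of formulas. -/
def conjFml (L : List ℕ) : ℕ :=
  L.foldr (fun s t => Nat.pair 3 (Nat.pair s t)) (Nat.pair 0 (Nat.pair tzero tzero))

/-- The disjunction of a list of formulas. -/
def disjFml (L : List ℕ) : ℕ := Nat.pair 2 (conjFml (L.map (Nat.pair 2)))

theorem isFml_conjFml {α : Type*} {b : Set ℕ} (L : List α) {f : α → ℕ} {Q : α → (ℕ → ℝ) → Prop}
    (h : ∀ x ∈ L, IsFml b (f x) (Q x)) : IsFml b (conjFml (L.map f)) fun v => ∀ x ∈ L, Q x v := by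
  induction L with
  | nil => exact ⟨.eq .zero .zero, rfl, by simp [OFFml.fv, OFTerm.fv],
      by simp [OFFml.Realize]⟩
  | cons x L ih =>
    refine ((h x List.mem_cons_self).and
      (ih fun y hy => h y (List.mem_cons_of_mem _ hy))).congr fun v => ?_
    rw [List.forall_mem_cons]

theorem isFml_disjFml {α : Type*} {b : Set ℕ} (L : List α) {f : α → ℕ} {Q : α → (ℕ → ℝ) → Prop}
    (h : ∀ x ∈ L, IsFml b (f x) (Q x)) : IsFml b (disjFml (L.map f)) fun v => ∃ x ∈ L, Q x v := by
  rw [disjFml, List.map_map]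
  refine (isFml_conjFml L fun x hx => (h x hx).not).not.congr fun v => ?_
  push Not
  rfl

/-- The existential closure with respect to `m` variables. -/
def exFml (l m s : ℕ) : ℕ := (List.range m).foldr (fun i t => Nat.pair 4 (Nat.pair (l + i) t)) s

theorem isFml_exFml {l m s : ℕ} {Q : (ℕ → ℝ) → Prop} (h : IsFml (Set.Iio (l + m)) s Q) :
    IsFml (Set.Iio l) (exFml l m s) fun v => ∃ v', (∀ i < l, v' i = v i) ∧ Q v' := by
  induction m generalizing s Q with
  | zero =>
    obtain ⟨θ, h0, h1, h2⟩ := h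
    refine ⟨θ, h0, h1, fun v => ⟨fun h => ⟨v, fun _ _ => rfl, (h2 v).1 h⟩, ?_⟩⟩
    rintro ⟨v', h3, h4⟩
    exact (θ.realize_congr fun i hi => h3 i (h1 i hi)).1 ((h2 v').2 h4)
  | succ m ih =>
    obtain ⟨θ, rfl, h1, h2⟩ := h
    have h3 : IsFml (Set.Iio (l + m)) (Nat.pair 4 (Nat.pair (l + m) θ.code))
        fun v => ∃ r, Q (Function.update v (l + m) r) := by
      refine ⟨.ex (l + m) θ, rfl, fun i hi => ?_, fun v => exists_congr fun r => h2 _⟩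
      have h4 : i < l + (m + 1) := h1 i (Finset.mem_of_mem_erase hi)
      have h5 := Finset.ne_of_mem_erase hi
      exact Set.mem_Iio.2 (by omega)
    have h4 := ih h3
    rw [exFml, List.range_succ, List.foldr_append]
    refine h4.congr fun v => ⟨?_, ?_⟩
    · rintro ⟨v', h5, r, h6⟩
      exact ⟨_, fun i hi => by rw [Function.update_of_ne (by omega), h5 i hi], h6⟩
    · rintro ⟨v', h5, h6⟩
      exact ⟨v', h5, v' (l + m), by rwa [Function.update_eq_self]⟩

theorem IsFml.exists_closure {b : Set ℕ} {s : ℕ} {Q : (ℕ → ℝ) → Prop} (h : IsFml b s Q) (l : ℕ) :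
    IsFml (Set.Iio l) (exFml l (s + 1) s) fun v => ∃ v', (∀ i < l, v' i = v i) ∧ Q v' := by
  obtain ⟨θ, rfl, -, h2⟩ := h
  refine isFml_exFml ⟨θ, rfl, fun i hi => ?_, h2⟩
  have := θ.le_code i hi
  exact Set.mem_Iio.2 (by omega)

/-- The formula for a clause. -/
def clauseFml (L : List (ℕ × Bool)) : ℕ :=
  disjFml (L.map fun x => bif x.2 then Nat.pair 0 x.1 else Nat.pair 2 (Nat.pair 0 x.1))

theorem isFml_eq {a : ℕ} (h1 : IsTm a.unpair.1) (h2 : IsTm a.unpair.2) :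
    IsFml Set.univ (Nat.pair 0 a) fun v => EqTrue (codeEval v) a := by
  obtain ⟨s, hs⟩ := h1
  obtain ⟨t, ht⟩ := h2
  refine ⟨.eq s t, ?_, fun _ _ => trivial, fun v => ?_⟩
  · rw [OFFml.code, hs, ht, Nat.pair_unpair]
  · simp only [EqTrue, ← hs, ← ht, codeEval_code]
    rfl

theorem isFml_clauseFml {L : List (ℕ × Bool)}
    (h : ∀ x ∈ L, IsTm x.1.unpair.1 ∧ IsTm x.1.unpair.2) :
    IsFml Set.univ (clauseFml L) fun v => ClauseTrue (EqTrue (codeEval v)) L := by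
  refine (isFml_disjFml L (Q := fun x v => (EqTrue (codeEval v) x.1 ↔ x.2 = true))
    fun x hx => ?_).congr fun v => Iff.rfl
  have h1 := isFml_eq (h x hx).1 (h x hx).2
  cases x.2
  · exact h1.not.congr fun v => by simp
  · exact h1.congr fun v => by simp

theorem isTm_gridClause (k n l e Pc : ℕ) (p : PolyL) (i : ℕ) :
    ∀ x ∈ gridClause k n l e Pc p i, IsTm x.1.unpair.1 ∧ IsTm x.1.unpair.2 := by
  have hr : ∀ x ∈ [(Nat.pair 0 0, true)], IsTm x.1.unpair.1 ∧ IsTm x.1.unpair.2 := by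
    intro x hx
    rw [List.mem_singleton.1 hx, Nat.unpair_pair]
    exact ⟨isTm_tvar 0, isTm_tvar 0⟩
  have hc : ∀ (b : Bool) (L L' : List (ℕ × Bool)),
      (∀ x ∈ L, IsTm x.1.unpair.1 ∧ IsTm x.1.unpair.2) →
      (∀ x ∈ L', IsTm x.1.unpair.1 ∧ IsTm x.1.unpair.2) →
      ∀ x ∈ (bif b then L else L'), IsTm x.1.unpair.1 ∧ IsTm x.1.unpair.2 := by
    intro b L L' h1 h2
    cases b
    exacts [h2, h1]
  have hL : ∀ q a b, ∀ L ∈ gridClauses k n l e Pc p q a b,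
      ∀ x ∈ L, IsTm x.1.unpair.1 ∧ IsTm x.1.unpair.2 := by
    intro q a b L hL
    rw [gridClauses, List.mem_cons, List.mem_singleton] at hL
    rcases hL with hL | hL
    · rw [hL]
      refine hc _ _ _ (fun x hx => ?_) hr
      rw [List.mem_singleton.1 hx, Nat.unpair_pair]
      exact ⟨isTm_edgeTerm k n l e q Pc p (X := tvarG l q) (fun _ => isTm_tvar _) a, isTm_tzero⟩
    · rw [hL]
      refine hc _ _ _ (fun x hx => ?_) hr
      obtain ⟨s, -, rfl⟩ := List.mem_map.1 hx
      rw [Nat.unpair_pair]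
      exact ⟨isTm_tvar _, isTm_tvar _⟩
  rw [gridClause]
  by_cases hf : i.unpair.1 < (gridClauses k n l e Pc p i.unpair.2.unpair.1
      i.unpair.2.unpair.2.unpair.1 i.unpair.2.unpair.2.unpair.2).length
  · rw [List.getD_eq_getElem _ _ hf]
    exact hL _ _ _ _ (List.getElem_mem hf)
  · rw [List.getD_eq_default _ _ (not_lt.1 hf)]
    exact hr

/-- The formula stating the existence of the grids mentioned in the first `N` clauses. -/
def gridFml (k n l e Pc : ℕ) (p : PolyL) (N : ℕ) : ℕ :=
  exFml l (conjFml ((List.range N).map fun i => clauseFml (gridClause k n l e Pc p i)) + 1)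
    (conjFml ((List.range N).map fun i => clauseFml (gridClause k n l e Pc p i)))

theorem isFml_gridFml (k n l e Pc : ℕ) (p : PolyL) (N : ℕ) :
    IsFml (Set.Iio l) (gridFml k n l e Pc p N) fun v => ∃ v', (∀ i < l, v' i = v i) ∧
      ∀ i < N, ClauseTrue (EqTrue (codeEval v')) (gridClause k n l e Pc p i) := by
  refine ((isFml_conjFml (List.range N) fun i _ =>
    isFml_clauseFml (isTm_gridClause k n l e Pc p i)).exists_closure l).congr fun v => ?_
  simp only [List.mem_range]

theorem clauseTrue_gridClause_iff {S : Type*} [CommRing S] {h : ℕ → S} (hh : TermHom h)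
    {k n l e Pc : ℕ} {p : PolyL} (f q a b : ℕ) :
    ClauseTrue (EqTrue h) (gridClause k n l e Pc p (Nat.pair f (Nat.pair q (Nat.pair a b)))) ↔
      (f = 0 → a < (q ^ k) ^ e → h (edgeTerm k n l e q Pc p (tvarG l q) a) = 0) ∧
      (f = 1 → a < q ^ e → b < q ^ e → a ≠ b →
        ∃ s < n, h (tvarG l q (a * n + s)) ≠ h (tvarG l q (b * n + s))) := by
  have hr : ClauseTrue (EqTrue h) [(Nat.pair 0 0, true)] :=
    clauseTrue_refl ((eqTrue_pair h 0 0).2 rfl)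
  rw [gridClause_pair, gridClauses]
  rcases f with _ | _ | f
  · rw [List.getD_cons_zero]
    by_cases ha : a < (q ^ k) ^ e
    · rw [decide_eq_true ha, cond_true]
      simp [ClauseTrue, eqTrue_pair, hh.zero, ha]
    · rw [decide_eq_false ha, cond_false]
      simp [hr, ha]
  · rw [List.getD_cons_succ, List.getD_cons_zero]
    by_cases ha : a < q ^ e ∧ b < q ^ e ∧ a ≠ b
    · obtain ⟨h1, h2, h3⟩ := ha
      have h4 : (a == b) = false := by simpa using h3
      rw [decide_eq_true h1, decide_eq_true h2, h4]
      simp [ClauseTrue, eqTrue_pair, h1, h2, h3]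
    · have h4 : (decide (a < q ^ e) && decide (b < q ^ e) && !(a == b)) = false := by
        rw [Bool.eq_false_iff]
        simpa [and_assoc] using ha
      rw [h4, cond_false]
      refine iff_of_true hr ⟨by simp, fun _ h1 h2 h3 => absurd ⟨h1, h2, h3⟩ ha⟩
  · simpa using hr

theorem exists_countable_field (v : ℕ → ℝ) : ∃ (F : Type) (_ : Field F) (_ : Algebra F ℝ)
    (c : ℕ → F) (z : ℕ → ℝ), CharZero F ∧ Countable F ∧ (∀ j, algebraMap F ℝ (c j) = v j) ∧
      AlgebraicIndependent F z := by
  have hF : #(Subfield.closure (Set.range v)) ≤ ℵ₀ :=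
    (Subfield.cardinalMk_closure_le_max _).trans (max_le
      (Cardinal.mk_range_le.trans (by simp)) le_rfl)
  obtain ⟨s, hs⟩ := exists_isTranscendenceBasis (Subfield.closure (Set.range v)) ℝ
  have hs0 : ℵ₀ ≤ #s := by
    by_contra hlt
    have h1 := hs.isAlgebraic
    have h2 := Algebra.IsAlgebraic.cardinalMk_le_max
      (Algebra.adjoin (Subfield.closure (Set.range v)) (Set.range ((↑) : s → ℝ))) ℝ
    have h3 : #(Algebra.adjoin (Subfield.closure (Set.range v)) (Set.range ((↑) : s → ℝ))) ≤
        ℵ₀ := by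
      rw [hs.1.aevalEquiv.symm.toEquiv.cardinal_eq]
      exact MvPolynomial.cardinalMk_le_max.trans (by simp [hF, (not_le.1 hlt).le])
    have h4 := h2.trans (max_le h3 le_rfl)
    rw [Cardinal.mk_real] at h4
    exact h4.not_gt Cardinal.aleph0_lt_continuum
  obtain ⟨g⟩ : Nonempty (ℕ ↪ s) := by
    rwa [← Cardinal.mk_nat, Cardinal.le_def] at hs0
  exact ⟨_, inferInstance, inferInstance,
    fun j => ⟨v j, Subfield.subset_closure ⟨j, rfl⟩⟩, fun i => g i, inferInstance,
    Cardinal.mk_le_aleph0_iff.1 hF, fun _ => rfl, hs.1.comp g g.injective⟩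

theorem polyRel_intPoly_iff {F : Type} [Field F] [Algebra F ℝ] {c : ℕ → F} {k n l : ℕ}
    {v : ℕ → ℝ} (hc : ∀ j, algebraMap F ℝ (c j) = v j) (cc : PolyCode) (a : Fin k → Fin n → ℝ) :
    polyRel (R := ℝ) (polyVal (polyVar c edgeVar) (intPoly k n l cc)) a ↔
      MvPolynomial.aeval (Sum.elim (fun w : Fin k × Fin n => a w.1 w.2) fun j : Fin l => v j)
        (decodePolyP k n l cc) = 0 := by
  have h1 : MvPolynomial.aeval (fun w : Fin k × Fin n => a w.1 w.2)
      (polyVal (polyVar c edgeVar) (intPoly k n l cc)) =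
      polyVal (fun i => MvPolynomial.aeval (fun w : Fin k × Fin n => a w.1 w.2)
        (polyVar c edgeVar i)) (intPoly k n l cc) :=
    map_polyVal (MvPolynomial.aeval (R := F) fun w : Fin k × Fin n => a w.1 w.2).toRingHom _ _
  have h2 : ∀ w : Fin k × Fin n, MvPolynomial.aeval (fun w : Fin k × Fin n => a w.1 w.2)
      (polyVar c (edgeVar (k := k) (n := n)) (Nat.pair 1 (w.1 * n + w.2))) = a w.1 w.2 := by
    intro w
    have := polyVar_apply c (ν := edgeVar (k := k) (n := n)) edgeVar_injective
      (fun w => by simp [edgeVar]) w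
    rw [edgeVar] at this
    rw [this, MvPolynomial.aeval_X]
  have h3 : ∀ j, MvPolynomial.aeval (fun w : Fin k × Fin n => a w.1 w.2)
      (polyVar c (edgeVar (k := k) (n := n)) (Nat.pair 0 j)) = v j := by
    intro j
    rw [polyVar_pair_zero, MvPolynomial.aeval_C, hc]
  rw [polyRel, h1, polyVal_intPoly, mul_eq_zero,
    or_iff_right (Nat.cast_ne_zero.2 (denProd_ne_zero cc))]
  simp only [h2, h3]

/-- The relation defining the zero hypergraph of a polynomial with parameters. -/
def zeroRel (k n l : ℕ) (cc : PolyCode) (v : ℕ → ℝ) (a : Fin k → Fin n → ℝ) : Prop :=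
  MvPolynomial.aeval (Sum.elim (fun w : Fin k × Fin n => a w.1 w.2) fun j : Fin l => v j)
    (decodePolyP k n l cc) = 0

theorem polyRel_intPoly {F : Type} [Field F] [Algebra F ℝ] {c : ℕ → F} {k n l : ℕ}
    {v : ℕ → ℝ} (hc : ∀ j, algebraMap F ℝ (c j) = v j) (cc : PolyCode) :
    polyRel (R := ℝ) (polyVal (polyVar c edgeVar) (intPoly k n l cc)) = zeroRel k n l cc v :=
  funext fun a => propext (polyRel_intPoly_iff hc cc a)

theorem goodArr_zeroRel_of_not_properlyColorable {k n l : ℕ} (hk : 0 < k) (cc : PolyCode)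
    (v : ℕ → ℝ) {κ : Cardinal.{0}} (hκ : ℵ₀ ≤ κ)
    (hnc : ¬ ProperlyColorable (relEdges (zeroRel k n l cc v)) κ) :
    GoodArr (zeroRel k n l cc v) (k * k) ∧
      ∀ e, 𝔠 ≤ Order.succ^[e] κ → GoodArr (zeroRel k n l cc v) e := by
  obtain ⟨F, _, _, c, z, _, _, hc, -⟩ := exists_countable_field v
  rw [← polyRel_intPoly hc] at hnc ⊢
  exact goodArr_of_not_properlyColorable hk _ hκ hnc

theorem goodArr_zeroRel_of_gridClauses {k n l e K Pc : ℕ} (hn : 0 < n) {P : Fin k → Fin e → Fin k}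
    (hP : Function.Injective P)
    (hPc : ∀ (j : Fin k) (d : Fin e), dig k (dig (k ^ e) Pc j) d = P j d) {cc : PolyCode}
    (hK : gridBound e k (k * (intPoly k n l cc).length) e ≤ K) {N : ℕ}
    (hN : refutes k n l e K Pc (intPoly k n l cc) N = true) {v v' : ℕ → ℝ}
    (hv : ∀ j, l ≤ j → v j = 0) (hv' : ∀ j < l, v' j = v j)
    (hg : ∀ i < N, ClauseTrue (EqTrue (codeEval v'))
      (gridClause k n l e Pc (intPoly k n l cc) i)) :
    GoodArr (zeroRel k n l cc v) e := by
  obtain ⟨F, _, _, c, z, _, _, hc, hz⟩ := exists_countable_field v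
  rw [← polyRel_intPoly hc]
  set w : ℕ → ℝ := fun j => if j < l then v j else
    if (j - l).unpair.1 = 0 then v' j else z (j - l).unpair.2 with hw
  have hcv : ∀ w : ℕ → ℝ, (∀ j < l, w j = v j) → ∀ j,
      codeEval w (if j < l then tvar j else tzero) = algebraMap F ℝ (c j) := by
    intro w hw j
    rw [hc]
    split_ifs with h
    · rw [codeEval_tvar, hw j h]
    · rw [(termHom_codeEval w).zero, hv j (not_lt.1 h)]
  have hG : ∀ q i, codeEval w (tvarG l q i) = codeEval v' (tvarG l q i) := by
    intro q i
    simp [tvarG, codeEval_tvar, hw]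
  have hwc := hcv w fun j hj => by simp [hw, hj]
  refine goodArr_of_refutes (termHom_codeEval w) hwc ?_ hn hP hPc hK hN fun i hi => ?_
  · have h1 : (fun i => codeEval w (tvar (l + Nat.pair 1 i))) = z := by
      funext i
      simp [codeEval_tvar, hw]
    rwa [h1]
  · obtain ⟨f, q, a, b, rfl⟩ : ∃ f q a b, i = Nat.pair f (Nat.pair q (Nat.pair a b)) :=
      ⟨i.unpair.1, i.unpair.2.unpair.1, i.unpair.2.unpair.2.unpair.1,
        i.unpair.2.unpair.2.unpair.2, by simp⟩
    have h1 := (clauseTrue_gridClause_iff (termHom_codeEval v') f q a b).1 (hg _ hi)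
    refine (clauseTrue_gridClause_iff (termHom_codeEval w) f q a b).2 ⟨fun hf ha => ?_, ?_⟩
    · have h2 := h1.1 hf ha
      obtain ⟨β, rfl⟩ := exists_betaNum_eq ha
      rw [(termHom_codeEval v').edgeTerm (hcv v' hv') hPc] at h2
      rw [(termHom_codeEval w).edgeTerm hwc hPc]
      simpa only [hG] using h2
    · simpa only [hG] using h1.2

theorem exists_gridClauses_of_hasGrid {k n l e Pc : ℕ} {P : Fin k → Fin e → Fin k}
    (hPc : ∀ (j : Fin k) (d : Fin e), dig k (dig (k ^ e) Pc j) d = P j d) {cc : PolyCode}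
    {v : ℕ → ℝ} (hv : ∀ j, l ≤ j → v j = 0) (hG : ∀ q, HasGrid (zeroRel k n l cc v) P q) :
    ∃ v' : ℕ → ℝ, (∀ j < l, v' j = v j) ∧ ∀ i, ClauseTrue (EqTrue (codeEval v'))
      (gridClause k n l e Pc (intPoly k n l cc) i) := by
  obtain ⟨F, _, _, c, z, _, _, hc, -⟩ := exists_countable_field v
  rw [← polyRel_intPoly hc] at hG
  choose x hx hxZ using hG
  have hy : ∀ q, ∃ y : ℕ → ℝ, ∀ a (s : Fin n), y (gcode a * n + s) = x q a s := by
    intro q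
    have hi : Function.Injective
        fun u : (Fin e → Fin q) × Fin n => (gcode u.1 * n + u.2 : ℕ) := by
      intro u u' h
      have h1 := congrArg (· / n) h
      have h2 := congrArg (· % n) h
      simp only [mul_add_mod_of_lt (Fin.is_lt _), mul_add_div_of_lt (Fin.is_lt _)] at h1 h2
      exact Prod.ext (gcode_injective h1) (Fin.ext h2)
    exact ⟨Function.extend _ (fun u : (Fin e → Fin q) × Fin n => x q u.1 u.2) 0,
      fun a s => hi.extend_apply _ _ (a, s)⟩
  choose y hy using hy
  set v' : ℕ → ℝ := fun j => if j < l then v j else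
    y (j - l).unpair.2.unpair.1 (j - l).unpair.2.unpair.2 with hv'
  have hcv : ∀ j, codeEval v' (if j < l then tvar j else tzero) = algebraMap F ℝ (c j) := by
    intro j
    rw [hc]
    split_ifs with h
    · rw [codeEval_tvar]
      simp [hv', h]
    · rw [(termHom_codeEval v').zero, hv j (not_lt.1 h)]
  have hG : ∀ q i, codeEval v' (tvarG l q i) = y q i := by
    intro q i
    simp [tvarG, codeEval_tvar, hv']
  refine ⟨v', fun j hj => by simp [hv', hj], fun i => ?_⟩
  obtain ⟨f, q, a, b, rfl⟩ : ∃ f q a b, i = Nat.pair f (Nat.pair q (Nat.pair a b)) :=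
    ⟨i.unpair.1, i.unpair.2.unpair.1, i.unpair.2.unpair.2.unpair.1,
      i.unpair.2.unpair.2.unpair.2, by simp⟩
  refine (clauseTrue_gridClause_iff (termHom_codeEval v') f q a b).2
    ⟨fun _ ha => ?_, fun _ ha hb hab => ?_⟩
  · obtain ⟨β, rfl⟩ := exists_betaNum_eq ha
    rw [(termHom_codeEval v').edgeTerm hcv hPc]
    simp only [hG, hy]
    exact hxZ q β
  · obtain ⟨a, rfl⟩ := exists_gcode_eq ha
    obtain ⟨b, rfl⟩ := exists_gcode_eq hb
    by_contra hcon
    push Not at hcon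
    refine hab (congrArg gcode (hx q (funext fun s => ?_)))
    have := hcon s s.2
    rwa [hG, hG, hy, hy] at this

section PrimrecRules

variable {α β γ : Type*} [Primcodable α] [Primcodable β] [Primcodable γ]

attribute [fun_prop] Primrec Primrec.id Primrec.const Primrec.comp

@[fun_prop]
theorem primrec_pair {f : α → β} {g : α → γ} (hf : Primrec f) (hg : Primrec g) :
    Primrec fun x => (f x, g x) := hf.pair hg

@[fun_prop]
theorem primrec_fst {f : α → β × γ} (hf : Primrec f) : Primrec fun x => (f x).1 :=
  Primrec.fst.comp hf

@[fun_prop]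
theorem primrec_snd {f : α → β × γ} (hf : Primrec f) : Primrec fun x => (f x).2 :=
  Primrec.snd.comp hf

@[fun_prop]
theorem primrec_add {f g : α → ℕ} (hf : Primrec f) (hg : Primrec g) :
    Primrec fun x => f x + g x := Primrec.nat_add.comp hf hg

@[fun_prop]
theorem primrec_sub {f g : α → ℕ} (hf : Primrec f) (hg : Primrec g) :
    Primrec fun x => f x - g x := Primrec.nat_sub.comp hf hg

@[fun_prop]
theorem primrec_mul {f g : α → ℕ} (hf : Primrec f) (hg : Primrec g) :
    Primrec fun x => f x * g x := Primrec.nat_mul.comp hf hg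

@[fun_prop]
theorem primrec_div {f g : α → ℕ} (hf : Primrec f) (hg : Primrec g) :
    Primrec fun x => f x / g x := Primrec.nat_div.comp hf hg

@[fun_prop]
theorem primrec_mod {f g : α → ℕ} (hf : Primrec f) (hg : Primrec g) :
    Primrec fun x => f x % g x := Primrec.nat_mod.comp hf hg

@[fun_prop]
theorem primrec_natPair {f g : α → ℕ} (hf : Primrec f) (hg : Primrec g) :
    Primrec fun x => Nat.pair (f x) (g x) := Primrec₂.natPair.comp hf hg

@[fun_prop]
theorem primrec_unpair {f : α → ℕ} (hf : Primrec f) : Primrec fun x => (f x).unpair :=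
  Primrec.unpair.comp hf

theorem primrec_natRec {f : α → ℕ} {b : α → β} {s : α → ℕ → β → β} (hf : Primrec f)
    (hb : Primrec b) (hs : Primrec fun p : α × ℕ × β => s p.1 p.2.1 p.2.2) :
    Primrec fun x => (Nat.rec (b x) (s x) (f x) : β) :=
  Primrec.nat_rec' (h := fun x p => s x p.1 p.2) hf hb hs

@[fun_prop]
theorem primrec_pow {f g : α → ℕ} (hf : Primrec f) (hg : Primrec g) :
    Primrec fun x => f x ^ g x := by
  refine (primrec_natRec (s := fun x _ t => t * f x) hg (Primrec.const 1) (by fun_prop)).of_eq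
    fun x => ?_
  induction g x with
  | zero => rfl
  | succ n ih => rw [pow_succ, ← ih]

@[fun_prop]
theorem primrec_beq {f g : α → ℕ} (hf : Primrec f) (hg : Primrec g) :
    Primrec fun x => f x == g x := Primrec.beq.comp hf hg

@[fun_prop]
theorem primrec_beq_bool {f g : α → Bool} (hf : Primrec f) (hg : Primrec g) :
    Primrec fun x => f x == g x := Primrec.beq.comp hf hg

@[fun_prop]
theorem primrec_decide_lt {f g : α → ℕ} (hf : Primrec f) (hg : Primrec g) :
    Primrec fun x => decide (f x < g x) := (Primrec.nat_lt.comp hf hg).decide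

@[fun_prop]
theorem primrec_not {f : α → Bool} (hf : Primrec f) : Primrec fun x => !f x := Primrec.not.comp hf

@[fun_prop]
theorem primrec_and {f g : α → Bool} (hf : Primrec f) (hg : Primrec g) :
    Primrec fun x => f x && g x := Primrec.and.comp hf hg

@[fun_prop]
theorem primrec_or {f g : α → Bool} (hf : Primrec f) (hg : Primrec g) :
    Primrec fun x => f x || g x := Primrec.or.comp hf hg

@[fun_prop]
theorem primrec_cond {c : α → Bool} {f g : α → β} (hc : Primrec c) (hf : Primrec f)
    (hg : Primrec g) : Primrec fun x => bif c x then f x else g x := Primrec.cond hc hf hg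

@[fun_prop]
theorem primrec_cons {f : α → β} {g : α → List β} (hf : Primrec f) (hg : Primrec g) :
    Primrec fun x => f x :: g x := Primrec.list_cons.comp hf hg

@[fun_prop]
theorem primrec_append {f g : α → List β} (hf : Primrec f) (hg : Primrec g) :
    Primrec fun x => f x ++ g x := Primrec.list_append.comp hf hg

@[fun_prop]
theorem primrec_map {f : α → List β} {g : α → β → γ} (hf : Primrec f)
    (hg : Primrec fun p : α × β => g p.1 p.2) : Primrec fun x => (f x).map (g x) :=
  Primrec.list_map hf hg

@[fun_prop]
theorem primrec_flatMap {f : α → List β} {g : α → β → List γ} (hf : Primrec f)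
    (hg : Primrec fun p : α × β => g p.1 p.2) : Primrec fun x => (f x).flatMap (g x) :=
  Primrec.list_flatMap hf hg

@[fun_prop]
theorem primrec_foldr {f : α → List β} {g : α → γ} {h : α → β → γ → γ} (hf : Primrec f)
    (hg : Primrec g) (hh : Primrec fun p : α × β × γ => h p.1 p.2.1 p.2.2) :
    Primrec fun x => (f x).foldr (h x) (g x) :=
  Primrec.list_foldr (h := fun x p => h x p.1 p.2) hf hg hh

@[fun_prop]
theorem primrec_range {f : α → ℕ} (hf : Primrec f) : Primrec fun x => List.range (f x) :=
  Primrec.list_range.comp hf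

@[fun_prop]
theorem primrec_length {f : α → List β} (hf : Primrec f) : Primrec fun x => (f x).length :=
  Primrec.list_length.comp hf

@[fun_prop]
theorem primrec_getD {f : α → List β} {g : α → ℕ} {d : β} (hf : Primrec f) (hg : Primrec g) :
    Primrec fun x => (f x).getD (g x) d := (Primrec.list_getD d).comp hf hg

@[fun_prop]
theorem primrec_all {f : α → List β} {g : α → β → Bool} (hf : Primrec f)
    (hg : Primrec fun p : α × β => g p.1 p.2) : Primrec fun x => (f x).all (g x) := by
  refine (primrec_foldr (h := fun x y t => g x y && t) hf (Primrec.const true)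
    (primrec_and (hg.comp (by fun_prop : Primrec fun p : α × β × Bool => (p.1, p.2.1)))
      (by fun_prop))).of_eq fun x => ?_
  induction f x with
  | nil => rfl
  | cons y L ih => rw [List.foldr_cons, ih, List.all_cons]

@[fun_prop]
theorem primrec_any {f : α → List β} {g : α → β → Bool} (hf : Primrec f)
    (hg : Primrec fun p : α × β => g p.1 p.2) : Primrec fun x => (f x).any (g x) := by
  refine (primrec_not (primrec_all (g := fun x y => !g x y) hf (primrec_not hg))).of_eq fun x => ?_
  induction f x with
  | nil => rfl
  | cons y L ih => simp [← ih]

@[fun_prop]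
theorem primrec_sum {f : α → List ℕ} (hf : Primrec f) : Primrec fun x => (f x).sum :=
  primrec_foldr (h := fun _ y t => y + t) hf (Primrec.const 0) (by fun_prop)

@[fun_prop]
theorem primrec_prod {f : α → List ℕ} (hf : Primrec f) : Primrec fun x => (f x).prod :=
  primrec_foldr (h := fun _ y t => y * t) hf (Primrec.const 1) (by fun_prop)

@[fun_prop]
theorem primrec_replicate {f : α → ℕ} {g : α → β} (hf : Primrec f) (hg : Primrec g) :
    Primrec fun x => List.replicate (f x) (g x) := by
  refine (primrec_map (g := fun x _ => g x) (primrec_range hf) (by fun_prop)).of_eq fun x => ?_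
  simp

@[fun_prop]
theorem primrec_contains {f : α → List ℕ} {g : α → ℕ} (hf : Primrec f) (hg : Primrec g) :
    Primrec fun x => (f x).contains (g x) := by
  refine (primrec_any (g := fun x y => g x == y) hf (by fun_prop)).of_eq fun x => ?_
  exact (List.contains_eq_any_beq ..).symm

@[fun_prop]
theorem primrec_decode_getD [Inhabited β] {f : α → ℕ} (hf : Primrec f) :
    Primrec fun x => (Encodable.decode (α := β) (f x)).getD default :=
  Primrec.option_getD.comp (Primrec.decode.comp hf) (Primrec.const default)

@[fun_prop]
theorem primrec_listRec {f : α → List β} {g : α → γ} {h : α → β → List β → γ → γ}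
    (hf : Primrec f) (hg : Primrec g)
    (hh : Primrec fun p : α × β × List β × γ => h p.1 p.2.1 p.2.2.1 p.2.2.2) :
    Primrec fun x => (List.rec (g x) (h x) (f x) : γ) :=
  Primrec.list_rec (h := fun x p => h x p.1 p.2.1 p.2.2) hf hg hh

end PrimrecRules

section PrimrecDefs

variable {α : Type*} [Primcodable α]

@[fun_prop]
theorem primrec_gridBound {e k B j : α → ℕ} (he : Primrec e) (hk : Primrec k) (hB : Primrec B)
    (hj : Primrec j) : Primrec fun x => gridBound (e x) (k x) (B x) (j x) := by
  refine (primrec_natRec (b := fun _ => 1) (s := fun x _ t => t + 1 + B x * (t ^ k x) ^ e x) hj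
    (by fun_prop) (by fun_prop)).of_eq fun x => ?_
  induction j x with
  | zero => rfl
  | succ n ih => rw [gridBound, ← ih]

@[fun_prop]
theorem primrec_tvar {f : α → ℕ} (hf : Primrec f) : Primrec fun x => tvar (f x) := by
  unfold tvar; fun_prop

@[fun_prop]
theorem primrec_tneg {f : α → ℕ} (hf : Primrec f) : Primrec fun x => tneg (f x) := by
  unfold tneg; fun_prop

@[fun_prop]
theorem primrec_tadd {f g : α → ℕ} (hf : Primrec f) (hg : Primrec g) :
    Primrec fun x => tadd (f x) (g x) := by
  unfold tadd; fun_prop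

@[fun_prop]
theorem primrec_tmul {f g : α → ℕ} (hf : Primrec f) (hg : Primrec g) :
    Primrec fun x => tmul (f x) (g x) := by
  unfold tmul; fun_prop

@[fun_prop]
theorem primrec_tnum {f : α → ℕ} (hf : Primrec f) : Primrec fun x => tnum (f x) := by
  refine (primrec_natRec (b := fun _ => tzero) (s := fun _ _ t => tadd t tone) hf
    (by fun_prop) (by fun_prop)).of_eq fun x => ?_
  induction f x with
  | zero => rfl
  | succ n ih => rw [tnum, ← ih]

@[fun_prop]
theorem primrec_polyTerm {σ : α → ℕ → ℕ} {Q : α → PolyL}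
    (hσ : Primrec fun p : α × ℕ => σ p.1 p.2) (hQ : Primrec Q) :
    Primrec fun x => polyTerm (σ x) (Q x) := by
  have h : Primrec fun p : α × List ℕ => p.2.foldr (fun i s => tmul (σ p.1 i) s) tone :=
    primrec_foldr (by fun_prop) (by fun_prop) (primrec_tmul
      (hσ.comp (by fun_prop : Primrec fun p : (α × List ℕ) × ℕ × ℕ => (p.1.1, p.2.1)))
      (by fun_prop))
  have h' : Primrec fun p : α × (Bool × List ℕ) × ℕ =>
      p.2.1.2.foldr (fun i s => tmul (σ p.1 i) s) tone :=
    h.comp (by fun_prop : Primrec fun p : α × (Bool × List ℕ) × ℕ => (p.1, p.2.1.2))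
  unfold polyTerm
  fun_prop

@[fun_prop]
theorem primrec_monoDeriv {v : α → ℕ} {L : α → List ℕ} (hv : Primrec v) (hL : Primrec L) :
    Primrec fun x => monoDeriv (v x) (L x) := by
  unfold monoDeriv
  fun_prop

@[fun_prop]
theorem primrec_polyDeriv {v : α → ℕ} {Q : α → PolyL} (hv : Primrec v) (hQ : Primrec Q) :
    Primrec fun x => polyDeriv (v x) (Q x) := by
  unfold polyDeriv
  fun_prop

@[fun_prop]
theorem primrec_dig {K a d : α → ℕ} (hK : Primrec K) (ha : Primrec a) (hd : Primrec d) :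
    Primrec fun x => dig (K x) (a x) (d x) := by
  unfold dig
  fun_prop

@[fun_prop]
theorem primrec_enc {e K : α → ℕ} {f : α → ℕ → ℕ} (he : Primrec e) (hK : Primrec K)
    (hf : Primrec fun p : α × ℕ => f p.1 p.2) : Primrec fun x => enc (e x) (K x) (f x) := by
  unfold enc
  fun_prop

theorem primrec_termSub {l A B i : α → ℕ} {X Y : α → ℕ → ℕ} (hl : Primrec l) (hA : Primrec A)
    (hB : Primrec B) (hX : Primrec fun p : α × ℕ => X p.1 p.2)
    (hY : Primrec fun p : α × ℕ => Y p.1 p.2) (hi : Primrec i) :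
    Primrec fun x => termSub (l x) (A x) (B x) (X x) (Y x) (i x) := by
  have h1 : Primrec fun x => X x (i x).unpair.2 :=
    hX.comp (by fun_prop : Primrec fun x => (x, (i x).unpair.2))
  have h2 : Primrec fun x => Y x (i x).unpair.2 :=
    hY.comp (by fun_prop : Primrec fun x => (x, (i x).unpair.2))
  unfold termSub
  fun_prop

theorem primrec_polyTerm_termSub {l A B : α → ℕ} {X Y : α → ℕ → ℕ} {Q : α → PolyL}
    (hl : Primrec l) (hA : Primrec A)
    (hB : Primrec B) (hX : Primrec fun p : α × ℕ => X p.1 p.2)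
    (hY : Primrec fun p : α × ℕ => Y p.1 p.2) (hQ : Primrec Q) :
    Primrec fun x => polyTerm (termSub (l x) (A x) (B x) (X x) (Y x)) (Q x) :=
  primrec_polyTerm (primrec_termSub (by fun_prop) (by fun_prop) (by fun_prop)
    (hX.comp (by fun_prop : Primrec fun p : (α × ℕ) × ℕ => (p.1.1, p.2)))
    (hY.comp (by fun_prop : Primrec fun p : (α × ℕ) × ℕ => (p.1.1, p.2))) (by fun_prop)) hQ

attribute [fun_prop] primrec_polyTerm_termSub

@[fun_prop]
theorem primrec_annTerm {l r y : α → ℕ} {Y : α → ℕ → ℕ} {Q : α → PolyL} (hl : Primrec l)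
    (hr : Primrec r) (hy : Primrec y) (hY : Primrec fun p : α × ℕ => Y p.1 p.2)
    (hQ : Primrec Q) : Primrec fun x => annTerm (l x) (r x) (y x) (Y x) (Q x) :=
  primrec_polyTerm_termSub hl (by fun_prop) hr (by fun_prop) hY hQ

@[fun_prop]
theorem primrec_edgePoint {k e K P b j : α → ℕ} (hk : Primrec k) (he : Primrec e)
    (hK : Primrec K) (hP : Primrec P) (hb : Primrec b) (hj : Primrec j) :
    Primrec fun x => edgePoint (k x) (e x) (K x) (P x) (b x) (j x) := by
  unfold edgePoint
  fun_prop

@[fun_prop]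
theorem primrec_maskNum {e K i a : α → ℕ} {J : α → List ℕ} (he : Primrec e) (hK : Primrec K)
    (hJ : Primrec J) (hi : Primrec i) (ha : Primrec a) :
    Primrec fun x => maskNum (e x) (K x) (J x) (i x) (a x) := by
  unfold maskNum
  fun_prop

@[fun_prop]
theorem primrec_tvarX {l i : α → ℕ} (hl : Primrec l) (hi : Primrec i) :
    Primrec fun x => tvarX (l x) (i x) := by
  unfold tvarX
  fun_prop

@[fun_prop]
theorem primrec_tvarY {l i : α → ℕ} (hl : Primrec l) (hi : Primrec i) :
    Primrec fun x => tvarY (l x) (i x) := by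
  unfold tvarY
  fun_prop

@[fun_prop]
theorem primrec_tvarG {l q i : α → ℕ} (hl : Primrec l) (hq : Primrec q) (hi : Primrec i) :
    Primrec fun x => tvarG (l x) (q x) (i x) := by
  unfold tvarG
  fun_prop

@[fun_prop]
theorem primrec_edgeTerm {k n l e K P b : α → ℕ} {p : α → PolyL} {X : α → ℕ → ℕ}
    (hk : Primrec k) (hn : Primrec n) (hl : Primrec l) (he : Primrec e)
    (hK : Primrec K) (hP : Primrec P) (hp : Primrec p) (hX : Primrec fun p : α × ℕ => X p.1 p.2)
    (hb : Primrec b) :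
    Primrec fun x => edgeTerm (k x) (n x) (l x) (e x) (K x) (P x) (p x) (X x) (b x) := by
  unfold edgeTerm
  refine primrec_polyTerm_termSub hl (by fun_prop) (by fun_prop) ?_ (by fun_prop) hp
  exact hX.comp (by fun_prop : Primrec fun p : α × ℕ => (p.1, edgePoint (k p.1) (e p.1) (K p.1)
    (P p.1) (b p.1) (p.2 / n p.1) * n p.1 + p.2 % n p.1))

@[fun_prop]
theorem primrec_tpow {t m : α → ℕ} (ht : Primrec t) (hm : Primrec m) :
    Primrec fun x => tpow (t x) (m x) :=
  primrec_natRec hm (by fun_prop) (by fun_prop)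

@[fun_prop]
theorem primrec_tsumL {L : α → List ℕ} (hL : Primrec L) : Primrec fun x => tsumL (L x) := by
  unfold tsumL
  fun_prop

@[fun_prop]
theorem primrec_certY {e K a i : α → ℕ} {D : α → CertData} (he : Primrec e) (hK : Primrec K)
    (hD : Primrec D) (ha : Primrec a) (hi : Primrec i) :
    Primrec fun x => certY (e x) (K x) (D x) (a x) (i x) := by
  unfold certY
  fun_prop

@[fun_prop]
theorem primrec_certX {n a s : α → ℕ} {D : α → CertData} (hn : Primrec n)
    (hD : Primrec D) (ha : Primrec a) (hs : Primrec s) :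
    Primrec fun x => certX (n x) (D x) (a x) (s x) := by
  unfold certX
  fun_prop

@[fun_prop]
theorem primrec_certE {b : α → ℕ} {D : α → CertData} (hD : Primrec D) (hb : Primrec b) :
    Primrec fun x => certE (D x) (b x) := by
  unfold certE
  fun_prop

@[fun_prop]
theorem primrec_certS {n a i : α → ℕ} {D : α → CertData} (hn : Primrec n)
    (hD : Primrec D) (ha : Primrec a) (hi : Primrec i) :
    Primrec fun x => certS (n x) (D x) (a x) (i x) := by
  unfold certS
  fun_prop

@[fun_prop]
theorem primrec_certZero {k n l e K P : α → ℕ} {p : α → PolyL} {D : α → CertData}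
    (hk : Primrec k) (hn : Primrec n) (hl : Primrec l) (he : Primrec e)
    (hK : Primrec K) (hP : Primrec P) (hp : Primrec p) (hD : Primrec D) :
    Primrec fun x => certZero (k x) (n x) (l x) (e x) (K x) (P x) (p x) (D x) := by
  unfold certZero
  fun_prop

@[fun_prop]
theorem primrec_certNe {k n l e K : α → ℕ} {D : α → CertData}
    (hk : Primrec k) (hn : Primrec n) (hl : Primrec l) (he : Primrec e)
    (hK : Primrec K) (hD : Primrec D) :
    Primrec fun x => certNe (k x) (n x) (l x) (e x) (K x) (D x) := by
  unfold certNe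
  fun_prop

@[fun_prop]
theorem primrec_domainClauses {s t u v : α → ℕ} (hs : Primrec s) (ht : Primrec t)
    (hu : Primrec u) (hv : Primrec v) :
    Primrec fun x => domainClauses (s x) (t x) (u x) (v x) := by
  unfold domainClauses ringEqs
  fun_prop

@[fun_prop]
theorem primrec_gridClause {k n l e P i : α → ℕ} {p : α → PolyL}
    (hk : Primrec k) (hn : Primrec n) (hl : Primrec l) (he : Primrec e)
    (hP : Primrec P) (hp : Primrec p) (hi : Primrec i) :
    Primrec fun x => gridClause (k x) (n x) (l x) (e x) (P x) (p x) (i x) := by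
  unfold gridClause gridClauses
  fun_prop

@[fun_prop]
theorem primrec_certClause {k n l e K P : α → ℕ} {p : α → PolyL} {D : α → CertData}
    (hk : Primrec k) (hn : Primrec n) (hl : Primrec l) (he : Primrec e)
    (hK : Primrec K) (hP : Primrec P) (hp : Primrec p) (hD : Primrec D) :
    Primrec fun x => certClause (k x) (n x) (l x) (e x) (K x) (P x) (p x) (D x) := by
  unfold certClause
  fun_prop

@[fun_prop]
theorem primrec_allClause {k n l e K P i : α → ℕ} {p : α → PolyL}
    (hk : Primrec k) (hn : Primrec n) (hl : Primrec l) (he : Primrec e)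
    (hK : Primrec K) (hP : Primrec P) (hp : Primrec p) (hi : Primrec i) :
    Primrec fun x => allClause (k x) (n x) (l x) (e x) (K x) (P x) (p x) (i x) := by
  unfold allClause
  fun_prop

@[fun_prop]
theorem primrec_refutes {k n l e K P N : α → ℕ} {p : α → PolyL}
    (hk : Primrec k) (hn : Primrec n) (hl : Primrec l) (he : Primrec e)
    (hK : Primrec K) (hP : Primrec P) (hp : Primrec p) (hN : Primrec N) :
    Primrec fun x => refutes (k x) (n x) (l x) (e x) (K x) (P x) (p x) (N x) := by
  unfold refutes
  fun_prop

@[fun_prop]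
theorem primrec_conjFml {L : α → List ℕ} (hL : Primrec L) : Primrec fun x => conjFml (L x) := by
  unfold conjFml
  fun_prop

@[fun_prop]
theorem primrec_disjFml {L : α → List ℕ} (hL : Primrec L) : Primrec fun x => disjFml (L x) := by
  unfold disjFml
  fun_prop

@[fun_prop]
theorem primrec_clauseFml {L : α → List (ℕ × Bool)} (hL : Primrec L) :
    Primrec fun x => clauseFml (L x) := by
  unfold clauseFml
  fun_prop

@[fun_prop]
theorem primrec_gridFml {k n l e P N : α → ℕ} {p : α → PolyL}
    (hk : Primrec k) (hn : Primrec n) (hl : Primrec l) (he : Primrec e)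
    (hP : Primrec P) (hp : Primrec p) (hN : Primrec N) :
    Primrec fun x => gridFml (k x) (n x) (l x) (e x) (P x) (p x) (N x) := by
  unfold gridFml exFml
  fun_prop

end PrimrecDefs

/-- Whether a number codes the numerator and the denominator of a rational number. -/
def ratMem (j : ℕ) : Bool :=
  decide (0 < j.unpair.2) && (List.range (j.unpair.2 + 1)).all fun t => t == 1 ||
    !(((j.unpair.1 + 1) / 2 % t == 0) && (j.unpair.2 % t == 0))

/-- The code of the numerator and the denominator of a rational number. -/
def ratPair (q : ℚ) : ℕ := Nat.pair (Encodable.encode q.num) q.den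

theorem encode_int_add_one_div_two (z : ℤ) : (Encodable.encode z + 1) / 2 = z.natAbs := by
  cases z with
  | ofNat n => exact (by omega : (2 * n + 1) / 2 = n)
  | negSucc n => exact (by omega : (2 * n + 1 + 1) / 2 = n + 1)

theorem encode_int_mod_two (z : ℤ) : (Encodable.encode z % 2 == 0) = decide (0 ≤ z) := by
  cases z with
  | ofNat n =>
    have h : Encodable.encode (Int.ofNat n) = 2 * n := rfl
    rw [h, decide_eq_true (show 0 ≤ Int.ofNat n from Int.natCast_nonneg n)]
    simp
  | negSucc n =>
    have h : Encodable.encode (Int.negSucc n) = 2 * n + 1 := rfl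
    rw [h, decide_eq_false (by simp)]
    simp

theorem ratMem_ratPair (q : ℚ) : ratMem (ratPair q) = true := by
  rw [ratMem, ratPair, Nat.unpair_pair, encode_int_add_one_div_two]
  simp only [Bool.and_eq_true, decide_eq_true_eq, List.all_eq_true, Bool.or_eq_true, beq_iff_eq,
    Bool.not_eq_true', Bool.and_eq_false_iff, beq_eq_false_iff_ne]
  refine ⟨q.den_pos, fun t _ => or_iff_not_imp_left.2 fun ht => ?_⟩
  by_contra! h
  exact ht (Nat.dvd_one.1 (q.reduced ▸
    Nat.dvd_gcd (Nat.dvd_of_mod_eq_zero h.1) (Nat.dvd_of_mod_eq_zero h.2)))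

theorem exists_ratPair_eq {j : ℕ} (h : ratMem j = true) : ∃ q, ratPair q = j := by
  obtain ⟨a, d, rfl⟩ : ∃ a d, j = Nat.pair a d := ⟨_, _, (Nat.pair_unpair j).symm⟩
  obtain ⟨z, rfl⟩ : ∃ z : ℤ, Encodable.encode z = a :=
    ⟨Denumerable.ofNat ℤ a, Denumerable.encode_ofNat a⟩
  rw [ratMem, Nat.unpair_pair, encode_int_add_one_div_two] at h
  simp only [Bool.and_eq_true, decide_eq_true_eq, List.all_eq_true, Bool.or_eq_true, beq_iff_eq,
    Bool.not_eq_true', Bool.and_eq_false_iff, beq_eq_false_iff_ne, List.mem_range] at h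
  refine ⟨⟨z, d, h.1.ne', ?_⟩, rfl⟩
  by_contra hg
  rcases (h.2 (z.natAbs.gcd d) (Nat.lt_succ_of_le (Nat.gcd_le_right _ h.1))).resolve_left hg
    with h | h
  · exact h (Nat.mod_eq_zero_of_dvd (Nat.gcd_dvd_left _ _))
  · exact h (Nat.mod_eq_zero_of_dvd (Nat.gcd_dvd_right _ _))

/-- The number of a rational number in the enumeration of the rational numbers. -/
def ratIndex (q : ℚ) : ℕ := @Encodable.encode ℚ Primcodable.toEncodable q

@[fun_prop]
theorem primrec_ratIndex : Primrec ratIndex := Primrec.encode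

theorem ratIndex_eq (q : ℚ) :
    ratIndex q = Nat.count (fun j => ratMem j = true) (ratPair q) := by
  have h : ratIndex q =
      (List.range (ratPair q)).countP fun j =>
        @decide (j ∈ Set.range (@Encodable.encode ℚ Rat.instEncodable))
          (@Encodable.decidableRangeEncode ℚ Rat.instEncodable j) := rfl
  rw [h, Nat.count]
  refine List.countP_congr fun j _ => ?_
  refine (@decide_eq_true_iff _ (Encodable.decidableRangeEncode ℚ j)).trans
    (Iff.trans ?_ decide_eq_true_iff.symm)
  constructor
  · rintro ⟨q, rfl⟩
    exact ratMem_ratPair q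
  · exact exists_ratPair_eq

theorem ratPair_le (q : ℚ) :
    ratPair q ≤ Nat.pair (ratIndex q) 1 := by
  rw [ratIndex_eq]
  set m := Nat.count (fun j => ratMem j = true) (ratPair q) with hm
  by_contra! h
  have hs : (Finset.range (m + 1)).image (fun a => Nat.pair a 1) ⊆
      (Finset.range (ratPair q)).filter fun j => ratMem j = true := by
    intro j hj
    obtain ⟨a, ha, rfl⟩ := Finset.mem_image.1 hj
    refine Finset.mem_filter.2 ⟨Finset.mem_range.2 (lt_of_le_of_lt ?_ h), ?_⟩
    · exact (strictMono_nat_of_lt_succ fun a => Nat.pair_lt_pair_left 1 a.lt_succ_self).monotone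
        (Nat.lt_succ_iff.1 (Finset.mem_range.1 ha))
    · have h2 : ∀ t : ℕ, t ≤ 1 → t ≠ 1 → 1 % t ≠ 0 := by
        intro t h1 h2
        interval_cases t <;> simp_all
      simp only [ratMem, Nat.unpair_pair, Bool.and_eq_true, decide_eq_true_eq, List.all_eq_true,
        Bool.or_eq_true, beq_iff_eq, Bool.not_eq_true', Bool.and_eq_false_iff,
        beq_eq_false_iff_ne, List.mem_range]
      exact ⟨one_pos, fun t ht => or_iff_not_imp_left.2 fun h => Or.inr (h2 t (by omega) h)⟩
  have hc := Finset.card_le_card hs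
  rw [Finset.card_image_of_injective _ fun a b h => (Nat.pair_eq_pair.1 h).1, Finset.card_range,
    ← Nat.count_eq_card_filter_range, ← hm] at hc
  omega

theorem primrec_ratPair : Primrec ratPair := by
  refine Primrec.of_graph ⟨fun q => Nat.pair (ratIndex q) 1, by fun_prop, fun q => ratPair_le q⟩ ?_
  have hmem : Primrec ratMem := by
    unfold ratMem
    fun_prop
  have key : Primrec fun p : ℚ × ℕ => ratMem p.2 && (ratIndex p.1 ==
      ((List.range p.2).map fun i => bif ratMem i then 1 else 0).sum) := by
    fun_prop
  have hsum : ∀ j, ((List.range j).map fun i => bif ratMem i then 1 else 0).sum =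
      Nat.count (fun j => ratMem j = true) j := by
    intro j
    induction j with
    | zero => rfl
    | succ j ih => rw [List.range_succ, List.map_append, List.sum_append, ih, Nat.count_succ,
        List.map_singleton, List.sum_singleton, cond_eq_ite]
  refine (Primrec.eq.comp key (Primrec.const true)).of_eq fun p => ?_
  rw [hsum, ratIndex_eq, Bool.and_eq_true, beq_iff_eq]
  constructor
  · rintro ⟨h1, h2⟩
    exact Nat.count_injective (ratMem_ratPair p.1) h1 h2
  · intro h
    rw [h]
    exact ⟨h ▸ ratMem_ratPair p.1, rfl⟩

section PrimrecRat

variable {α : Type*} [Primcodable α]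

@[fun_prop]
theorem primrec_den {q : α → ℚ} (hq : Primrec q) : Primrec fun x => (q x).den := by
  have h := primrec_ratPair.comp hq
  exact (by fun_prop : Primrec fun x => (ratPair (q x)).unpair.2).of_eq fun x => by simp [ratPair]

@[fun_prop]
theorem primrec_natAbs_num {q : α → ℚ} (hq : Primrec q) : Primrec fun x => (q x).num.natAbs := by
  have h := primrec_ratPair.comp hq
  refine (by fun_prop : Primrec fun x => ((ratPair (q x)).unpair.1 + 1) / 2).of_eq fun x => ?_
  rw [ratPair, Nat.unpair_pair, encode_int_add_one_div_two]

@[fun_prop]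
theorem primrec_num_nonneg {q : α → ℚ} (hq : Primrec q) :
    Primrec fun x => decide (0 ≤ (q x).num) := by
  have h := primrec_ratPair.comp hq
  refine (by fun_prop : Primrec fun x => (ratPair (q x)).unpair.1 % 2 == 0).of_eq fun x => ?_
  rw [ratPair, Nat.unpair_pair, encode_int_mod_two]

@[fun_prop]
theorem primrec_intPoly {k n l : α → ℕ} {c : α → PolyCode} (hk : Primrec k) (hn : Primrec n)
    (hl : Primrec l) (hc : Primrec c) :
    Primrec fun x => intPoly (k x) (n x) (l x) (c x) := by
  unfold intPoly denProd monoList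
  fun_prop

end PrimrecRat

/-- The list of the pairs `(e', Pc)` for which `e' ≤ e` and `Pc` is the number of an injective
pattern in `e'` directions. -/
def patternList (k e : ℕ) : List (ℕ × ℕ) :=
  (List.range (e + 1)).flatMap fun e' => (List.range ((k ^ e') ^ k)).flatMap fun Pc =>
    bif (List.range k).all fun i => (List.range k).all fun j =>
      (i == j) || !(dig (k ^ e') Pc i == dig (k ^ e') Pc j) then [(e', Pc)] else []

theorem mem_patternList {k e : ℕ} {x : ℕ × ℕ} : x ∈ patternList k e ↔
    x.1 ≤ e ∧ ∃ P : Fin k → Fin x.1 → Fin k, Function.Injective P ∧ betaNum P = x.2 := by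
  have hdig : ∀ {e' : ℕ} (P : Fin k → Fin e' → Fin k) (j : Fin k),
      dig (k ^ e') (betaNum P) j = finFunctionFinEquiv (P j) := fun P j =>
    dig_gcode (fun j => finFunctionFinEquiv (P j)) j
  obtain ⟨e', Pc⟩ := x
  simp only [patternList, List.mem_flatMap, List.mem_range, Nat.lt_succ_iff]
  constructor
  · rintro ⟨e', he', Pc, hPc, h⟩
    rw [Bool.cond_eq_ite] at h
    split_ifs at h with hall
    · obtain ⟨rfl, rfl⟩ := Prod.mk.inj (List.mem_singleton.1 h)
      obtain ⟨P, rfl⟩ := exists_betaNum_eq hPc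
      refine ⟨he', P, fun i j hij => ?_, rfl⟩
      simp only [List.all_eq_true, List.mem_range, Bool.or_eq_true, beq_iff_eq, Bool.not_eq_true',
        beq_eq_false_iff_ne] at hall
      refine Fin.ext ((hall i i.2 j j.2).resolve_right fun h => h ?_)
      rw [hdig, hdig, hij]
    · simp at h
  · rintro ⟨he', P, hP, rfl⟩
    refine ⟨e', he', _, betaNum_lt P, ?_⟩
    rw [Bool.cond_eq_ite, if_pos, List.mem_singleton]
    simp only [List.all_eq_true, List.mem_range, Bool.or_eq_true, beq_iff_eq, Bool.not_eq_true',
      beq_eq_false_iff_ne]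
    refine fun i hi j hj => or_iff_not_imp_left.2 fun hij h => hij ?_
    have h' := (hdig P ⟨i, hi⟩).symm.trans (h.trans (hdig P ⟨j, hj⟩))
    exact congrArg Fin.val (hP (finFunctionFinEquiv.injective (Fin.ext h')))

/-- The formula stating that there are grids of all sizes for some pattern in at most `e`
directions. -/
def patternFml (k n l : ℕ) (p : PolyL) (N e : ℕ) : ℕ :=
  disjFml ((patternList k e).map fun x => gridFml k n l x.1 x.2 p N)

theorem isFml_patternFml (k n l : ℕ) (p : PolyL) (N e : ℕ) :
    IsFml (Set.Iio l) (patternFml k n l p N e) fun v => ∃ x ∈ patternList k e,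
      ∃ v', (∀ i < l, v' i = v i) ∧
        ∀ i < N, ClauseTrue (EqTrue (codeEval v')) (gridClause k n l x.1 x.2 p i) :=
  isFml_disjFml _ fun x _ => isFml_gridFml k n l x.1 x.2 p N

/-- Whether the first clauses are contradictory for all patterns in at most `k * k` directions
and a number of directions satisfying `f`. -/
def enough (f : ℕ → Bool) (k n l : ℕ) (p : PolyL) (M : ℕ) : Bool :=
  k == 0 || (patternList k (k * k)).all fun x => !f x.1 ||
    (List.range (M + 1)).any fun N =>
      refutes k n l x.1 (gridBound x.1 k (k * p.length) x.1) x.2 p N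

theorem exists_enough {f : ℕ → Bool}
    (hf : ∀ e, f e = true ↔ Order.succ^[e] ℵ₀ ≤ (𝔠 : Cardinal.{0})) (k n l : ℕ) (p : PolyL) :
    ∃ M, enough f k n l p M = true := by
  rcases Nat.eq_zero_or_pos k with rfl | hk
  · exact ⟨0, rfl⟩
  have h : ∀ x ∈ patternList k (k * k), f x.1 = true →
      ∃ N, refutes k n l x.1 (gridBound x.1 k (k * p.length) x.1) x.2 p N = true := by
    rintro x hx hfx
    obtain ⟨-, P, -, hP⟩ := mem_patternList.1 hx
    rw [← hP]
    exact exists_refutes hk ((hf _).1 hfx) (fun j d => dig_dig_betaNum P j d) p _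
  choose! N hN using h
  refine ⟨((patternList k (k * k)).map N).sum, ?_⟩
  simp only [enough, Bool.or_eq_true, List.all_eq_true, List.any_eq_true, List.mem_range,
    Bool.not_eq_true']
  refine Or.inr fun x hx => ?_
  rcases hfx : f x.1 with _ | _
  · exact Or.inl rfl
  · exact Or.inr ⟨N x, Nat.lt_succ_of_le (List.le_sum_of_mem (List.mem_map_of_mem hx)),
      hN x hx hfx⟩

theorem iterate_succ_le_of_le {a c : Cardinal.{0}} {i j : ℕ} (h : i ≤ j)
    (hj : Order.succ^[j] a ≤ c) : Order.succ^[i] a ≤ c := by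
  induction j, h using Nat.le_induction with
  | base => exact hj
  | succ j _ ih =>
    rw [Function.iterate_succ_apply'] at hj
    exact ih ((Order.le_succ _).trans hj)

theorem patternFml_iff_goodArr {f : ℕ → Bool}
    (hf : ∀ e, f e = true ↔ Order.succ^[e] ℵ₀ ≤ (𝔠 : Cardinal.{0})) {k n l : ℕ} {cc : PolyCode}
    (hk : 0 < k) (hn : 0 < n) {M : ℕ} (hM : enough f k n l (intPoly k n l cc) M = true)
    {v : ℕ → ℝ} (hv : ∀ j, l ≤ j → v j = 0) {e : ℕ} (he : e ≤ k * k) (hfe : f e = true) :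
    (∃ x ∈ patternList k e, ∃ v' : ℕ → ℝ, (∀ i < l, v' i = v i) ∧ ∀ i < M + 1,
      ClauseTrue (EqTrue (codeEval v')) (gridClause k n l x.1 x.2 (intPoly k n l cc) i)) ↔
      GoodArr (zeroRel k n l cc v) e := by
  constructor
  · rintro ⟨x, hx, v', hv', h⟩
    obtain ⟨he', P, hP, hPc⟩ := mem_patternList.1 hx
    simp only [enough, Bool.or_eq_true, List.all_eq_true, List.any_eq_true, List.mem_range,
      Bool.not_eq_true', beq_iff_eq, hk.ne', false_or] at hM
    have hfe' : f x.1 = true := (hf _).2 (iterate_succ_le_of_le he' ((hf _).1 hfe))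
    obtain ⟨N, hN, hr⟩ := (hM x
      (mem_patternList.2 ⟨he'.trans he, P, hP, hPc⟩)).resolve_left (by simp [hfe'])
    rw [← hPc] at hr h
    exact (goodArr_zeroRel_of_gridClauses hn hP (fun j d => dig_dig_betaNum P j d) le_rfl hr hv
      hv' fun i hi => h i (hi.trans hN)).mono he'
  · intro hG
    obtain ⟨e', he', P, hP, hgrid⟩ := hG.exists_hasGrid ((hf _).1 hfe)
    obtain ⟨v', hv', h⟩ :=
      exists_gridClauses_of_hasGrid (fun j d => dig_dig_betaNum P j d) hv hgrid
    exact ⟨(e', betaNum P), mem_patternList.2 ⟨he', P, hP, rfl⟩, v', hv', fun i _ => h i⟩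

theorem not_goodArr_zero {k : ℕ} (hk : 2 ≤ k) {V : Type} (Z : (Fin k → V) → Prop) :
    ¬ GoodArr Z 0 := by
  rintro ⟨e', he', P, -, -, hP, -⟩
  obtain rfl := Nat.le_zero.1 he'
  have h : (⟨0, by omega⟩ : Fin k) = ⟨1, by omega⟩ := hP (Subsingleton.elim _ _)
  simp at h

theorem ProperlyColorable.mono {V : Type u} {E : Set (Finset V)} {κ μ : Cardinal.{u}}
    (h : κ ≤ μ) : ProperlyColorable E κ → ProperlyColorable E μ := by
  rintro ⟨C, φ, hC, hφ⟩
  exact ⟨C, φ, hC.trans h, hφ⟩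

theorem chromaticNumber_relEdges_eq_iff {k m : ℕ} (hk : 2 ≤ k) {V : Type}
    {Z : (Fin k → V) → Prop}
    (hZ : ∀ μ : Cardinal.{0}, ℵ₀ ≤ μ → ¬ ProperlyColorable (relEdges Z) μ →
      GoodArr Z m ∧ ∀ e, 𝔠 ≤ Order.succ^[e] μ → GoodArr Z e) {κ : Cardinal.{0}} (hκ : ℵ₀ < κ) :
    chromaticNumber (relEdges Z) = κ ↔ ∃ e < m, (¬ Order.succ^[e + 1] κ ≤ 𝔠 ∧
      ∀ μ, ℵ₀ ≤ μ → μ < κ → Order.succ^[e + 1] μ ≤ 𝔠) ∧ GoodArr Z (e + 1) ∧ ¬ GoodArr Z e := by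
  constructor
  · intro h
    have hne : {μ | ProperlyColorable (relEdges Z) μ}.Nonempty := by
      by_contra hne
      rw [chromaticNumber, Set.not_nonempty_iff_eq_empty.1 hne, Cardinal.sInf_empty] at h
      exact not_lt_zero (h ▸ hκ)
    have hPC : ProperlyColorable (relEdges Z) κ := h ▸ csInf_mem hne
    have hnot : ∀ μ < κ, ¬ ProperlyColorable (relEdges Z) μ := fun μ hμ hc =>
      hμ.not_ge (h.symm.trans_le (csInf_le' hc))
    classical
    have hex : ∃ e, GoodArr Z e := ⟨m, (hZ ℵ₀ le_rfl (hnot _ hκ)).1⟩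
    obtain ⟨e, he⟩ := Nat.exists_eq_succ_of_ne_zero
      (fun h0 => not_goodArr_zero hk Z (h0 ▸ Nat.find_spec hex) : Nat.find hex ≠ 0)
    have h1 : GoodArr Z (e + 1) := by
      rw [← Nat.succ_eq_add_one, ← he]
      exact Nat.find_spec hex
    have h2 : ¬ GoodArr Z e := Nat.find_min hex (by omega)
    refine ⟨e, ?_, ⟨fun hle => h1.not_properlyColorable hκ.le hle hPC, fun μ hμ hμκ => ?_⟩, h1, h2⟩
    · by_contra! hme
      exact h2 ((hZ ℵ₀ le_rfl (hnot _ hκ)).1.mono hme)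
    · by_contra! hlt
      rw [Function.iterate_succ_apply', Order.lt_succ_iff] at hlt
      exact h2 ((hZ μ hμ (hnot _ hμκ)).2 e hlt)
  · rintro ⟨e, -, ⟨hg1, hg2⟩, h1, h2⟩
    have hPC : ProperlyColorable (relEdges Z) κ := by
      by_contra hnc
      rw [not_le, Function.iterate_succ_apply', Order.lt_succ_iff] at hg1
      exact h2 ((hZ κ hκ.le hnc).2 e hg1)
    refine IsLeast.csInf_eq ⟨hPC, fun μ hμ => ?_⟩
    by_contra! hlt
    have hmax : max μ ℵ₀ < κ := max_lt hlt hκ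
    exact h1.not_properlyColorable (le_max_right _ _) (hg2 _ (le_max_right _ _) hmax)
      (ProperlyColorable.mono (le_max_left _ _) hμ)

theorem exists_primrec_bool_of_downward {b : ℕ → Prop} (h : ∀ i j, i ≤ j → b j → b i) :
    ∃ f : ℕ → Bool, Primrec f ∧ ∀ e, f e = true ↔ b e := by
  classical
  by_cases hall : ∀ e, b e
  · exact ⟨fun _ => true, Primrec.const true, fun e => by simp [hall e]⟩
  · push Not at hall
    refine ⟨fun e => decide (e < Nat.find hall), by fun_prop, fun e => ?_⟩
    rw [decide_eq_true_iff, Nat.lt_find_iff]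
    exact ⟨fun he => not_not.1 (he e le_rfl), fun he i hi => not_not.2 (h i e hi he)⟩

theorem exists_computable_search {α : Type*} [Primcodable α] {p : α → ℕ → Bool}
    (hp : Primrec fun x : α × ℕ => p x.1 x.2) (h : ∀ x, ∃ m, p x m = true) :
    ∃ f : α → ℕ, Computable f ∧ ∀ x, p x (f x) = true := by
  refine ⟨fun x => Nat.find (h x), ?_, fun x => Nat.find_spec (h x)⟩
  refine (Partrec.rfind (p := fun x m => Part.some (p x m)) hp.to_comp.partrec).of_eq fun x => ?_
  refine Part.eq_some_iff.2 (Nat.mem_rfind.2 ⟨?_, fun {m} hm => ?_⟩)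
  · exact Part.mem_some_iff.2 (Nat.find_spec (h x)).symm
  · exact Part.mem_some_iff.2 (Bool.eq_false_of_not_eq_true (Nat.find_min (h x) hm)).symm

/-- The formula stating that the least number of directions of a pattern satisfies `g`. -/
def chromFml (g : ℕ → Bool) (k n l : ℕ) (p : PolyL) (N : ℕ) : ℕ :=
  disjFml ((List.range (k * k)).map fun e => bif g e then
    Nat.pair 3 (Nat.pair (patternFml k n l p N (e + 1)) (Nat.pair 2 (patternFml k n l p N e)))
    else disjFml [])

theorem IsFml.cond {b : Set ℕ} {c : Bool} {s : ℕ} {Q : (ℕ → ℝ) → Prop} (h : IsFml b s Q) :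
    IsFml b (bif c then s else disjFml []) fun v => c = true ∧ Q v := by
  cases c with
  | true => exact h.congr fun v => by simp
  | false =>
    exact (isFml_disjFml (α := ℕ) (f := id) (Q := fun _ _ => True) [] (by simp)).congr
      fun v => by simp

theorem isFml_chromFml (g : ℕ → Bool) (k n l : ℕ) (p : PolyL) (N : ℕ) {Q : ℕ → (ℕ → ℝ) → Prop}
    (hQ : ∀ e, IsFml (Set.Iio l) (patternFml k n l p N e) (Q e)) :
    IsFml (Set.Iio l) (chromFml g k n l p N) fun v => ∃ e ∈ List.range (k * k),
      g e = true ∧ Q (e + 1) v ∧ ¬ Q e v := by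
  have h (e : ℕ) := ((hQ (e + 1)).and (hQ e).not).cond (c := g e)
  obtain ⟨F, hF⟩ : ∃ F : ℕ → ℕ, F = fun e => bif g e then
    Nat.pair 3 (Nat.pair (patternFml k n l p N (e + 1)) (Nat.pair 2 (patternFml k n l p N e)))
    else disjFml [] := ⟨_, rfl⟩
  rw [chromFml, ← hF]
  replace h (e : ℕ) : IsFml (Set.Iio l) (F e) fun v => g e = true ∧ Q (e + 1) v ∧ ¬ Q e v := by
    rw [hF]
    exact h e
  exact isFml_disjFml (List.range (k * k)) (f := F)
    (Q := fun e v => g e = true ∧ Q (e + 1) v ∧ ¬ Q e v) fun e _ => h e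

section PrimrecFml

variable {α : Type*} [Primcodable α]

theorem primrec_all_dig_ne {k K a : α → ℕ} (hk : Primrec k) (hK : Primrec K) (ha : Primrec a) :
    Primrec fun x => (List.range (k x)).all fun i => (List.range (k x)).all fun j =>
      (i == j) || !(dig (K x) (a x) i == dig (K x) (a x) j) := by
  have h₁ : Primrec fun x : (α × ℕ) × ℕ => dig (K x.1.1) (a x.1.1) x.1.2 := by fun_prop
  have h₂ : Primrec fun x : (α × ℕ) × ℕ => dig (K x.1.1) (a x.1.1) x.2 := by fun_prop
  exact primrec_all (primrec_range hk) (primrec_all (primrec_range (by fun_prop))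
    (primrec_or (by fun_prop) (primrec_not (primrec_beq h₁ h₂))))

@[fun_prop]
theorem primrec_patternList {k e : α → ℕ} (hk : Primrec k) (he : Primrec e) :
    Primrec fun x => patternList (k x) (e x) := by
  unfold patternList
  refine primrec_flatMap (by fun_prop) (primrec_flatMap (by fun_prop)
    (primrec_cond (primrec_all_dig_ne ?_ ?_ ?_) ?_ (Primrec.const []))) <;> fun_prop

@[fun_prop]
theorem primrec_patternFml {k n l N e : α → ℕ} {p : α → PolyL} (hk : Primrec k) (hn : Primrec n)
    (hl : Primrec l) (hp : Primrec p) (hN : Primrec N) (he : Primrec e) :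
    Primrec fun x => patternFml (k x) (n x) (l x) (p x) (N x) (e x) := by
  unfold patternFml
  fun_prop

@[fun_prop]
theorem primrec_enough {f : ℕ → Bool} {k n l M : α → ℕ} {p : α → PolyL} (hf : Primrec f)
    (hk : Primrec k) (hn : Primrec n) (hl : Primrec l) (hp : Primrec p) (hM : Primrec M) :
    Primrec fun x => enough f (k x) (n x) (l x) (p x) (M x) := by
  unfold enough
  fun_prop

@[fun_prop]
theorem primrec_chromFml {g : ℕ → Bool} {k n l N : α → ℕ} {p : α → PolyL} (hg : Primrec g)
    (hk : Primrec k) (hn : Primrec n) (hl : Primrec l) (hp : Primrec p) (hN : Primrec N) :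
    Primrec fun x => chromFml g (k x) (n x) (l x) (p x) (N x) := by
  unfold chromFml
  fun_prop

end PrimrecFml

/-- For each uncountable cardinal `κ`, the set of algebraic hypergraphs of chromatic
number exactly `κ` is decidable: a computable function maps (the code of) each
`((k,n)+ℓ)`-ary polynomial `p` over `ℚ` to (the code of) a formula `θ(y)` in `ℓ` free
variables such that for every `c ∈ ℝ^ℓ`, `χ(H_c) = κ` iff `ℝ ⊨ θ(c)`. -/
theorem chromatic_eq_decidable (κ : Cardinal.{0}) (hκ : Cardinal.aleph0 < κ) :
    ∃ G : ℕ × ℕ × ℕ × PolyCode → ℕ, Computable G ∧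
      ∀ k n ℓ : ℕ, 2 ≤ k → 1 ≤ n → ∀ c : PolyCode,
        ∃ θ : OFFml, θ.code = G (k, n, ℓ, c) ∧ (∀ i ∈ θ.fv, i < ℓ) ∧
          ∀ cp : Fin ℓ → ℝ,
            (chromaticNumber (zeroEdgesParam k n ℓ (decodePolyP k n ℓ c) cp) = κ ↔
              θ.Realize (fun i => if h : i < ℓ then cp ⟨i, h⟩ else 0)) := by
  obtain ⟨f, hf, hfs⟩ := exists_primrec_bool_of_downward
    (b := fun e => Order.succ^[e] ℵ₀ ≤ (𝔠 : Cardinal.{0})) fun i j h => iterate_succ_le_of_le h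
  obtain ⟨g₁, hg₁, hg₁s⟩ := exists_primrec_bool_of_downward
    (b := fun e => Order.succ^[e] κ ≤ 𝔠) fun i j h => iterate_succ_le_of_le h
  obtain ⟨g₂, hg₂, hg₂s⟩ := exists_primrec_bool_of_downward
    (b := fun e => ∀ μ, ℵ₀ ≤ μ → μ < κ → Order.succ^[e] μ ≤ 𝔠)
    fun i j h hj μ h1 h2 => iterate_succ_le_of_le h (hj μ h1 h2)
  obtain ⟨M, hM, hMs⟩ := exists_computable_search
    (p := fun (x : ℕ × ℕ × ℕ × PolyCode) m =>
      enough f x.1 x.2.1 x.2.2.1 (intPoly x.1 x.2.1 x.2.2.1 x.2.2.2) m)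
    (by fun_prop) fun x => exists_enough hfs _ _ _ _
  obtain ⟨g, hg⟩ : ∃ g : ℕ → Bool, g = fun e => !g₁ (e + 1) && g₂ (e + 1) := ⟨_, rfl⟩
  have hgp : Primrec g := hg ▸ by fun_prop
  obtain ⟨F, hF, hFs⟩ : ∃ F : (ℕ × ℕ × ℕ × PolyCode) × ℕ → ℕ, Primrec F ∧ ∀ k n l c N,
      F ((k, n, l, c), N) = chromFml g k n l (intPoly k n l c) (N + 1) :=
    ⟨fun x => chromFml g x.1.1 x.1.2.1 x.1.2.2.1
      (intPoly x.1.1 x.1.2.1 x.1.2.2.1 x.1.2.2.2) (x.2 + 1), by fun_prop, fun _ _ _ _ _ => rfl⟩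
  refine ⟨fun x => F (x, M x), hF.to_comp.comp (Computable.id.pair hM), fun k n l hk hn c => ?_⟩
  have hfml := isFml_chromFml g k n l (intPoly k n l c) (M (k, n, l, c) + 1)
    fun e => isFml_patternFml k n l _ _ e
  rw [← hFs] at hfml
  obtain ⟨θ, hθ, hfv, hθs⟩ := hfml
  refine ⟨θ, hθ, hfv, fun cp => ?_⟩
  set v : ℕ → ℝ := fun i => if h : i < l then cp ⟨i, h⟩ else 0 with hv
  have hv0 : ∀ j, l ≤ j → v j = 0 := fun j hj => dif_neg hj.not_gt
  have hE : zeroEdgesParam k n l (decodePolyP k n l c) cp = relEdges (zeroRel k n l c v) := by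
    have hcp : (fun j : Fin l => v j) = cp := funext fun j => dif_pos j.2
    simp only [zeroEdgesParam, relEdges, zeroRel, hcp]
  rw [hθs, hE, chromaticNumber_relEdges_eq_iff hk
    (fun μ hμ => goodArr_zeroRel_of_not_properlyColorable (by omega) c v hμ) hκ]
  refine exists_congr fun e => ?_
  rw [hg, List.mem_range, Bool.and_eq_true, Bool.not_eq_true', ← Bool.not_eq_true, hg₁s, hg₂s]
  refine and_congr_right fun he => and_congr_right fun hg => ?_
  have hfe : f (e + 1) = true := (hfs _).2 (hg.2 ℵ₀ le_rfl hκ)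
  rw [patternFml_iff_goodArr hfs (by omega) hn (hMs (k, n, l, c)) hv0 he hfe,
    patternFml_iff_goodArr hfs (by omega) hn (hMs (k, n, l, c)) hv0 (Nat.le_of_lt he)
      ((hfs _).2 (iterate_succ_le_of_le e.le_succ ((hfs _).1 hfe)))]
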